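/- There exist absolute constants c₁, c₂ > 0 such that for all reals R ≥ 16 and x ≥ R^{5/2}, c₁·x·(log R)^{−δ}·(log log R)^{−3/2} ≤ #{n ≤ x : Σ_{d | n, d ≤ R} μ(d) ≠ 0} ≤ c₂·x·(log R)^{−δ}·(log log R)^{−3/2}, where δ := 1 − (1 + log log 2)/log 2 = 0.086071…. -/

import Mathlib

open scoped Classical
open Finset.HasAntidiagonal (antidiagonal)

/-- The total weight `∑ ∏ 1 / bᵢ!` of sequences `b₁, …, bₙ` with sum `k` all of whose partial sums
`b₁ + ⋯ + bᵣ` satisfy `c r`. -/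
noncomputable def walk (c : ℕ → ℕ → Prop) : ℕ → ℕ → ℝ
  | 0, k => if k = 0 then 1 else 0
  | n + 1, k => if c (n + 1) k then
      ∑ p ∈ antidiagonal k, walk c n p.1 * (1 / (p.2.factorial : ℝ)) else 0

noncomputable abbrev parking : ℕ → ℕ → ℝ := walk fun r k => k ≤ r

noncomputable abbrev ballot : ℕ → ℕ → ℝ := walk fun r k => r ≤ k

noncomputable abbrev weakBallot : ℕ → ℕ → ℝ := walk fun r k => r ≤ k + 1

lemma walk_nonneg (c : ℕ → ℕ → Prop) (n k : ℕ) : 0 ≤ walk c n k := by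
  induction n generalizing k with
  | zero => unfold walk; split_ifs <;> simp
  | succ n ih =>
    unfold walk
    split_ifs
    · exact Finset.sum_nonneg fun p _ => mul_nonneg (ih _) (by positivity)
    · exact le_rfl

lemma walk_eq_zero {c : ℕ → ℕ → Prop} {n k : ℕ} (hn : n ≠ 0) (h : ¬ c n k) : walk c n k = 0 := by
  cases n with
  | zero => exact absurd rfl hn
  | succ n => simp [walk, h]

lemma parking_eq_zero {n k : ℕ} (h : n < k) : parking n k = 0 := by
  cases n with
  | zero => simp [parking, walk]; omega
  | succ n => exact walk_eq_zero (by simp) (by omega)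

lemma ballot_eq_zero {n k : ℕ} (h : k < n) : ballot n k = 0 :=
  walk_eq_zero (by omega) (by omega)

lemma sum_antidiagonal_assoc (f g h : ℕ → ℝ) (n : ℕ) :
    ∑ p ∈ antidiagonal n, (∑ q ∈ antidiagonal p.1, f q.1 * g q.2) * h p.2 =
      ∑ p ∈ antidiagonal n, f p.1 * ∑ q ∈ antidiagonal p.2, g q.1 * h q.2 := by
  have := congrArg (PowerSeries.coeff n)
    (mul_assoc (PowerSeries.mk f) (PowerSeries.mk g) (PowerSeries.mk h))
  simpa [PowerSeries.coeff_mul] using this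

lemma sum_antidiagonal_pow_div_factorial (N : ℝ) (k : ℕ) :
    ∑ p ∈ antidiagonal k, N ^ p.1 / (p.1.factorial : ℝ) * (1 / (p.2.factorial : ℝ)) =
      (N + 1) ^ k / (k.factorial : ℝ) := by
  rw [(Commute.all N 1).add_pow', Finset.sum_div]
  refine Finset.sum_congr rfl fun p hp => ?_
  rw [Finset.HasAntidiagonal.mem_antidiagonal] at hp
  subst hp
  have := Nat.add_choose_mul_factorial_mul_factorial p.2 p.1
  rw [add_comm p.2 p.1] at this
  have h2 : ((p.1 + p.2).choose p.1 : ℝ) * (p.1.factorial : ℝ) * (p.2.factorial : ℝ) =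
    ((p.1 + p.2).factorial : ℝ) := by rw [← this]; push_cast; ring
  simp only [one_pow, nsmul_eq_mul]
  rw [← h2]
  have : ((p.1 + p.2).choose p.1 : ℝ) ≠ 0 := by
    exact_mod_cast (Nat.choose_pos (Nat.le_add_right _ _)).ne'
  field_simp

lemma sum_antidiagonal_parking_aux (N : ℝ) (k : ℕ) :
    ∑ p ∈ antidiagonal k, (if p.1 = 0 then (1 : ℝ) else
        N ^ p.1 / (p.1.factorial : ℝ) - N ^ (p.1 - 1) / ((p.1 - 1).factorial : ℝ)) *
          (1 / (p.2.factorial : ℝ)) =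
      if k = 0 then (1 : ℝ) else
        (N + 1) ^ k / (k.factorial : ℝ) - (N + 1) ^ (k - 1) / ((k - 1).factorial : ℝ) := by
  cases k with
  | zero => simp
  | succ k =>
    have h := sum_antidiagonal_pow_div_factorial N (k + 1)
    rw [Finset.Nat.sum_antidiagonal_succ] at h ⊢
    have h2 := sum_antidiagonal_pow_div_factorial N k
    simp only [Nat.add_eq_zero_iff, one_ne_zero, and_false, if_false, Nat.add_sub_cancel, if_true,
      sub_mul, Finset.sum_sub_distrib] at h ⊢
    rw [h2, ← h]
    simp; ring

lemma parking_eq (n k : ℕ) (h : k ≤ n + 1) :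
    parking n k = if k = 0 then (1 : ℝ) else
      ((n : ℝ) + 1) ^ k / (k.factorial : ℝ) -
          ((n : ℝ) + 1) ^ (k - 1) / ((k - 1).factorial : ℝ) := by
  induction n generalizing k with
  | zero =>
    have : k = 0 ∨ k = 1 := by omega
    rcases this with rfl | rfl <;> simp [parking, walk]
  | succ n ih =>
    rcases Nat.lt_or_ge (n + 1) k with hk | hk
    · obtain rfl : k = n + 2 := by omega
      rw [parking_eq_zero (by omega), if_neg (by omega)]
      have : ((n + 1 + 1).factorial : ℝ) = (n + 1 + 1) * (n + 1).factorial := by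
        rw [Nat.factorial_succ]; push_cast; ring
      push_cast
      have h3 : ((n + 2).factorial : ℝ) = (n + 1 + 1) * (n + 1).factorial := this
      simp only [h3]
      field_simp
      ring

    · show walk _ (n + 1) k = _
      rw [walk, if_pos hk]
      rw [Nat.cast_succ, ← sum_antidiagonal_parking_aux]
      refine Finset.sum_congr rfl fun p hp => ?_
      rw [Finset.HasAntidiagonal.mem_antidiagonal] at hp
      rw [show walk _ n p.1 = parking n p.1 from rfl, ih p.1 (by omega)]

lemma sum_ballot_mul_parking (n M : ℕ) (h : n ≤ M) :
    ∑ p ∈ antidiagonal M, ballot n p.1 * parking (M - n) p.2 = parking M M := by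
  induction n with
  | zero =>
    rw [Finset.sum_eq_single (0, M)]
    · simp [ballot, walk]
    · intro p hp hne
      rw [Finset.HasAntidiagonal.mem_antidiagonal] at hp
      have : p.1 ≠ 0 := by
        rintro h0; apply hne; ext <;> simp <;> omega
      simp [ballot, walk, this]
    · simp
  | succ n ih =>
    rw [← ih (by omega)]
    have h1 : ∀ p ∈ antidiagonal M, ballot n p.1 * parking (M - n) p.2 =
        ballot n p.1 * ∑ q ∈ antidiagonal p.2,
          1 / (q.1.factorial : ℝ) * parking (M - (n + 1)) q.2 := by
      intro p hp
      rw [Finset.HasAntidiagonal.mem_antidiagonal] at hp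
      rcases Nat.lt_or_ge p.1 n with hlt | hge
      · rw [ballot_eq_zero hlt]; simp
      · congr 1
        have : M - n = (M - (n + 1)) + 1 := by omega
        rw [this]
        show walk _ _ _ = _
        rw [walk, if_pos (by omega), ← Finset.Nat.sum_antidiagonal_swap]
        exact Finset.sum_congr rfl fun q _ => mul_comm _ _
    have h2 : ∀ p ∈ antidiagonal M, ballot (n + 1) p.1 * parking (M - (n + 1)) p.2 =
        (∑ q ∈ antidiagonal p.1, ballot n q.1 * (1 / (q.2.factorial : ℝ))) *
          parking (M - (n + 1)) p.2 := by
      intro p hp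
      rw [Finset.HasAntidiagonal.mem_antidiagonal] at hp
      rcases Nat.lt_or_ge p.1 (n + 1) with hlt | hge
      · rw [parking_eq_zero (n := M - (n + 1)) (by omega)]; simp
      · congr 1
        show walk _ _ _ = _
        rw [walk, if_pos hge]
    rw [Finset.sum_congr rfl h1, Finset.sum_congr rfl h2]
    exact sum_antidiagonal_assoc (ballot n) (fun k => 1 / (k.factorial : ℝ))
        (parking (M - (n + 1))) M

lemma weakBallot_le_ballot (n k : ℕ) : weakBallot n k ≤ 2 * ballot (n + 1) (k + 2) := by
  induction n generalizing k with
  | zero =>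
    show walk _ 0 k ≤ 2 * walk _ 1 (k + 2)
    have h01 : 0 + 1 ≤ k + 2 := by omega
    rw [walk, walk]
    simp only [h01, if_true]
    split_ifs with h
    · subst h
      rw [Finset.sum_eq_single (0, 2)]
      · simp [walk]
      · intro p hp hne
        rw [Finset.HasAntidiagonal.mem_antidiagonal] at hp
        have : p.1 ≠ 0 := by
          rintro h0; apply hne; ext <;> simp <;> omega
        simp [walk, this]
      · simp
    · exact mul_nonneg zero_le_two
        (Finset.sum_nonneg fun p _ => mul_nonneg (walk_nonneg _ _ _) (by positivity))
  | succ n ih =>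
    show walk _ (n + 1) k ≤ 2 * walk _ (n + 2) (k + 2)
    rw [walk, walk]
    by_cases h : n + 1 ≤ k + 1
    · have h' : n + 1 + 1 ≤ k + 2 := by omega
      rw [if_pos h, if_pos h', Finset.Nat.sum_antidiagonal_succ, Finset.Nat.sum_antidiagonal_succ,
        mul_add, mul_add, Finset.mul_sum]
      refine le_add_of_nonneg_of_le
        (mul_nonneg zero_le_two (mul_nonneg (walk_nonneg _ _ _) (by positivity))) ?_
      refine le_add_of_nonneg_of_le
        (mul_nonneg zero_le_two (mul_nonneg (walk_nonneg _ _ _) (by positivity))) ?_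
      refine Finset.sum_le_sum fun p _ => ?_
      rw [← mul_assoc]
      exact mul_le_mul_of_nonneg_right (ih _) (by positivity)
    · have h' : ¬ n + 1 + 1 ≤ k + 2 := by omega
      rw [if_neg h, if_neg h', mul_zero]

lemma pow_div_factorial_le {N k : ℕ} (h : k ≤ N) :
    (N : ℝ) ^ k / (k.factorial : ℝ) ≤ (N : ℝ) ^ N / (N.factorial : ℝ) := by
  rw [div_le_div_iff₀ (by positivity) (by positivity)]
  have h1 : N.factorial ≤ k.factorial * N ^ (N - k) := by
    have := Nat.factorial_mul_pow_le_factorial (m := k) (n := N - k)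
    obtain ⟨d, rfl⟩ := Nat.exists_eq_add_of_le h
    rw [Nat.add_sub_cancel_left, ← Nat.factorial_mul_ascFactorial]
    gcongr
    rcases Nat.eq_zero_or_pos d with rfl | hd
    · simp
    · exact (Nat.ascFactorial_le_pow_add k d)
  have h2 : (N.factorial : ℝ) ≤ k.factorial * (N : ℝ) ^ (N - k) := by exact_mod_cast h1
  calc (N : ℝ) ^ k * N.factorial ≤ (N : ℝ) ^ k * (k.factorial * (N : ℝ) ^ (N - k)) := by gcongr
    _ = (N : ℝ) ^ N * k.factorial := by
      rw [mul_left_comm, ← pow_add, Nat.add_sub_cancel' h, mul_comm]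

lemma factorial_le_stirling {n : ℕ} (hn : n ≠ 0) :
    (n.factorial : ℝ) ≤ Real.exp 1 * √n * ((n : ℝ) / Real.exp 1) ^ n := by
  obtain ⟨m, rfl⟩ := Nat.exists_eq_succ_of_ne_zero hn
  have h := Stirling.stirlingSeq'_antitone (Nat.zero_le m)
  simp only [Function.comp, Nat.succ_eq_add_one, zero_add] at h
  rw [Stirling.stirlingSeq_one, Stirling.stirlingSeq, div_le_div_iff₀ (by positivity)
      (by positivity)] at h
  have h2 : √(2 * ((m + 1 : ℕ) : ℝ)) = √2 * √((m + 1 : ℕ) : ℝ) := Real.sqrt_mul (by norm_num) _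
  rw [h2] at h
  have h3 : (0 : ℝ) < √2 := by positivity
  rw [Nat.succ_eq_add_one]
  refine le_of_mul_le_mul_right ?_ h3
  linarith

/-- `κ n = (n + 1) ^ (-3 / 2)`. -/
noncomputable def kap (n : ℕ) : ℝ := 1 / (((n : ℝ) + 1) * √((n : ℝ) + 1))

lemma kap_pos (n : ℕ) : 0 < kap n := by unfold kap; positivity

lemma kap_anti {m n : ℕ} (h : m ≤ n) : kap n ≤ kap m := by
  unfold kap
  have : (m : ℝ) ≤ n := by exact_mod_cast h
  gcongr

lemma parking_eq_mul {n k : ℕ} (h : k ≤ n + 1) :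
    parking n k = ((n : ℝ) + 1 - k) / (n + 1) * (((n : ℝ) + 1) ^ k / (k.factorial : ℝ)) := by
  rw [parking_eq n k h]
  cases k with
  | zero => simp; field_simp
  | succ k =>
    rw [if_neg (by omega), Nat.factorial_succ]
    push_cast
    field_simp
    ring

lemma pow_self_div_factorial_le {N : ℕ} (hN : N ≠ 0) :
    (N : ℝ) ^ N / (N.factorial : ℝ) ≤ Real.exp 1 ^ N / √N := by
  have hN' : (0 : ℝ) < N := by positivity
  have h := Stirling.le_factorial_stirling N
  have h1 : √(N : ℝ) ≤ √(2 * Real.pi * N) :=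
    Real.sqrt_le_sqrt (by nlinarith [Real.pi_gt_three])
  have h2 : √(N : ℝ) * (N / Real.exp 1) ^ N ≤ N.factorial :=
    (mul_le_mul_of_nonneg_right h1 (by positivity)).trans h
  rw [div_le_div_iff₀ (by positivity) (by positivity)]
  calc (N : ℝ) ^ N * √N = Real.exp 1 ^ N * (√(N : ℝ) * (N / Real.exp 1) ^ N) := by
        rw [div_pow]; field_simp
    _ ≤ _ := by gcongr

lemma le_pow_self_div_factorial {N : ℕ} (hN : N ≠ 0) :
    Real.exp 1 ^ N / (Real.exp 1 * √N) ≤ (N : ℝ) ^ N / (N.factorial : ℝ) := by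
  have hN' : (0 : ℝ) < N := by positivity
  have h := factorial_le_stirling hN
  rw [div_le_div_iff₀ (by positivity) (by positivity)]
  calc Real.exp 1 ^ N * N.factorial
      ≤ Real.exp 1 ^ N * (Real.exp 1 * √N * ((N : ℝ) / Real.exp 1) ^ N) := by gcongr
    _ = _ := by rw [div_pow]; field_simp

lemma parking_sub_le {n d : ℕ} (h : d ≤ n) :
    parking n (n - d) ≤ Real.exp 1 * (d + 1) * (Real.exp 1 ^ n * kap n) := by
  rw [parking_eq_mul (by omega)]
  have h1 := pow_div_factorial_le (N := n + 1) (k := n - d) (by omega)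
  have h2 := h1.trans (pow_self_div_factorial_le (N := n + 1) (by omega))
  push_cast at h2
  have h3 : (n : ℝ) + 1 - ((n - d : ℕ) : ℝ) = d + 1 := by
    rw [Nat.cast_sub h]; ring
  rw [h3, kap]
  calc ((d : ℝ) + 1) / (n + 1) * (((n : ℝ) + 1) ^ (n - d) / ((n - d).factorial : ℝ))
      ≤ ((d : ℝ) + 1) / (n + 1) * (Real.exp 1 ^ (n + 1) / √((n : ℝ) + 1)) := by gcongr
    _ = _ := by rw [pow_succ]; field_simp

lemma le_parking_self (n : ℕ) : Real.exp 1 ^ n * kap n ≤ parking n n := by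
  rw [parking_eq_mul (by omega)]
  have h2 := le_pow_self_div_factorial (N := n + 1) (by omega)
  push_cast at h2
  rw [kap]
  calc Real.exp 1 ^ n * (1 / (((n : ℝ) + 1) * √((n : ℝ) + 1)))
      = 1 / (n + 1) * (Real.exp 1 ^ (n + 1) / (Real.exp 1 * √((n : ℝ) + 1))) := by
        rw [pow_succ]; field_simp
    _ ≤ 1 / (n + 1) * (((n : ℝ) + 1) ^ (n + 1) / ((n + 1).factorial : ℝ)) := by gcongr
    _ = _ := by
      rw [Nat.factorial_succ]; push_cast; rw [pow_succ]; field_simp; ring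

lemma le_parking_two_mul (h : ℕ) :
    (2 * Real.exp 1) ^ h / (2 * Real.exp 1 * (h + 1)) ≤ parking (2 * h) h := by
  rw [parking_eq_mul (by omega)]
  rcases Nat.eq_zero_or_pos h with rfl | hh
  · have := Real.add_one_le_exp (1 : ℝ)
    simp
    rw [← mul_inv]
    apply inv_le_one_of_one_le₀
    linarith
  · have h1 : (0 : ℝ) < h := by exact_mod_cast hh
    have h2 := factorial_le_stirling hh.ne'
    have h3 : √(h : ℝ) ≤ h + 1 := by
      rw [Real.sqrt_le_left (by positivity)]; nlinarith
    push_cast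
    have h4 : (1 : ℝ) / 2 ≤ (2 * h + 1 - h) / (2 * h + 1) := by
      rw [div_le_div_iff₀ (by positivity) (by positivity)]; nlinarith
    have h5 : (2 * (h : ℝ)) ^ h ≤ (2 * h + 1) ^ h := by gcongr; linarith
    have h6 : (2 * Real.exp 1) ^ h / (Real.exp 1 * (h + 1)) ≤
        (2 * (h : ℝ)) ^ h / h.factorial := by
      rw [div_le_div_iff₀ (by positivity) (by positivity)]
      calc (2 * Real.exp 1) ^ h * h.factorial
          ≤ (2 * Real.exp 1) ^ h * (Real.exp 1 * (h + 1) * ((h : ℝ) / Real.exp 1) ^ h) := by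
            gcongr; exact h2.trans (by gcongr)
        _ = _ := by rw [div_pow, mul_pow, mul_pow]; field_simp
    calc (2 * Real.exp 1) ^ h / (2 * Real.exp 1 * (h + 1))
        = 1 / 2 * ((2 * Real.exp 1) ^ h / (Real.exp 1 * (h + 1))) := by field_simp
      _ ≤ (2 * h + 1 - h) / (2 * h + 1) * ((2 * h + 1) ^ h / h.factorial) := by
        refine mul_le_mul h4 (h6.trans (by gcongr)) (by positivity) (le_trans (by norm_num) h4)

/-- Ballot numbers above the diagonal, bounded by comparison with parking functions. -/
lemma ballot_add_le (n h : ℕ) :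
    ballot n (n + h) ≤
      2 * Real.exp 1 ^ 2 * (Real.exp 1 ^ n * kap n) * ((h + 1) * (Real.exp 1 / 2) ^ h) := by
  have h1 := sum_ballot_mul_parking n (n + 2 * h) (by omega)
  have h2 : ballot n (n + h) * parking (2 * h) h ≤ parking (n + 2 * h) (n + 2 * h) := by
    rw [← h1]
    have := Finset.single_le_sum (f := fun p : ℕ × ℕ =>
      ballot n p.1 * parking (n + 2 * h - n) p.2) (s := antidiagonal (n + 2 * h))
      (fun p _ => mul_nonneg (walk_nonneg _ _ _) (walk_nonneg _ _ _))
      (Finset.HasAntidiagonal.mem_antidiagonal.2 (show (n + h, h).1 + (n + h, h).2 = _ by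
        simp; omega))
    simpa using this
  have h3 := parking_sub_le (Nat.zero_le (n + 2 * h))
  simp only [Nat.sub_zero, Nat.cast_zero, zero_add, mul_one] at h3
  have h4 := le_parking_two_mul h
  have h5 : ballot n (n + h) * ((2 * Real.exp 1) ^ h / (2 * Real.exp 1 * (h + 1))) ≤
      Real.exp 1 * (Real.exp 1 ^ (n + 2 * h) * kap n) :=
    (mul_le_mul_of_nonneg_left h4 (walk_nonneg _ _ _)).trans (h2.trans (h3.trans (by
      have := kap_anti (show n ≤ n + 2 * h by omega)
      gcongr)))
  rw [← mul_div_assoc, div_le_iff₀ (by positivity)] at h5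
  have h6 : (0 : ℝ) < (2 * Real.exp 1) ^ h := by positivity
  refine le_of_mul_le_mul_right (h5.trans (le_of_eq ?_)) h6
  rw [pow_add, mul_pow, div_pow, mul_comm 2 h, pow_mul]
  field_simp

lemma log_two_bounds : 0.6931 < Real.log 2 ∧ Real.log 2 < 0.6932 :=
  ⟨by linarith [Real.log_two_gt_d9], by linarith [Real.log_two_lt_d9]⟩

lemma exp_one_bounds : 2.718 < Real.exp 1 ∧ Real.exp 1 < 2.719 :=
  ⟨by linarith [Real.exp_one_gt_d9], by linarith [Real.exp_one_lt_d9]⟩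

lemma exists_sum_le_of_geom {β : ℝ} (h0 : 0 ≤ β) (h1 : β < 1) :
    ∃ C : ℝ, 0 < C ∧ ∀ s : Finset ℕ, ∑ h ∈ s, ((h : ℝ) + 1) ^ 2 * β ^ h ≤ C := by
  have hs : Summable fun h : ℕ => ((h : ℝ) + 1) ^ 2 * β ^ h := by
    have hb : ‖β‖ < 1 := by rwa [Real.norm_of_nonneg h0]
    have e2 := summable_pow_mul_geometric_of_norm_lt_one 2 hb
    have e1 := summable_pow_mul_geometric_of_norm_lt_one 1 hb
    have e0 := summable_pow_mul_geometric_of_norm_lt_one 0 hb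
    refine ((e2.add (e1.mul_left 2)).add e0).congr fun n => ?_
    ring
  refine ⟨∑' h : ℕ, ((h : ℝ) + 1) ^ 2 * β ^ h + 1, ?_, fun s => ?_⟩
  · have : 0 ≤ ∑' h : ℕ, ((h : ℝ) + 1) ^ 2 * β ^ h := tsum_nonneg fun _ => by positivity
    linarith
  · have := hs.sum_le_tsum s (fun _ _ => by positivity)
    linarith

lemma exists_sum_ballot_le : ∃ C : ℝ, 0 < C ∧ ∀ (s : Finset ℕ) (n : ℕ),
    ∑ k ∈ s, Real.log 2 ^ k * ballot n k ≤ C * ((Real.exp 1 * Real.log 2) ^ n * kap n) := by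
  have ht := log_two_bounds
  have he := exp_one_bounds
  obtain ⟨C, hC, hCs⟩ := exists_sum_le_of_geom (β := Real.exp 1 * Real.log 2 / 2)
    (by nlinarith) (by nlinarith)
  refine ⟨2 * Real.exp 1 ^ 2 * C, by positivity, fun s n => ?_⟩
  have ht0 : 0 < Real.log 2 := by linarith
  have hk := kap_pos n
  calc ∑ k ∈ s, Real.log 2 ^ k * ballot n k
      = ∑ k ∈ s with n ≤ k, Real.log 2 ^ k * ballot n k := by
        rw [Finset.sum_filter]
        refine Finset.sum_congr rfl fun k _ => ?_
        split_ifs with h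
        · rfl
        · rw [ballot_eq_zero (by omega), mul_zero]
    _ ≤ ∑ k ∈ s with n ≤ k, 2 * Real.exp 1 ^ 2 * ((Real.exp 1 * Real.log 2) ^ n * kap n) *
          ((((k - n : ℕ) : ℝ) + 1) ^ 2 * (Real.exp 1 * Real.log 2 / 2) ^ (k - n)) := by
        refine Finset.sum_le_sum fun k hk => ?_
        obtain ⟨h, rfl⟩ := Nat.exists_eq_add_of_le (Finset.mem_filter.1 hk).2
        rw [Nat.add_sub_cancel_left]
        calc Real.log 2 ^ (n + h) * ballot n (n + h)
            ≤ Real.log 2 ^ (n + h) * (2 * Real.exp 1 ^ 2 * (Real.exp 1 ^ n * kap n) *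
              ((h + 1) * (Real.exp 1 / 2) ^ h)) := by gcongr; exact ballot_add_le n h
          _ = 2 * Real.exp 1 ^ 2 * ((Real.exp 1 * Real.log 2) ^ n * kap n) *
              ((h + 1) * (Real.exp 1 * Real.log 2 / 2) ^ h) := by
            rw [pow_add, mul_pow, div_pow, div_pow, mul_pow]; ring
          _ ≤ _ := by
            gcongr
            have : (0 : ℝ) ≤ h := by positivity
            nlinarith
    _ ≤ _ := by
        rw [← Finset.mul_sum]
        rw [mul_right_comm]
        gcongr
        refine le_trans (le_of_eq ?_) (hCs ((s.filter (n ≤ ·)).image (· - n)))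
        rw [Finset.sum_image]
        intro a ha b hb hab
        simp at ha hb hab
        omega

lemma kap_eq_rpow (n : ℕ) : kap n = ((n : ℝ) + 1) ^ (-(3 / 2) : ℝ) := by
  have h : (0 : ℝ) < (n : ℝ) + 1 := by positivity
  rw [kap, Real.sqrt_eq_rpow, Real.rpow_neg h.le, one_div]
  congr 1
  nth_rewrite 1 [← Real.rpow_one ((n : ℝ) + 1)]
  rw [← Real.rpow_add h]
  norm_num

lemma kap_sub_le {v j : ℕ} (h : j ≤ v) : kap (v - j) ≤ ((j : ℝ) + 1) ^ 2 * kap v := by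
  obtain ⟨d, rfl⟩ := Nat.exists_eq_add_of_le h
  rw [Nat.add_sub_cancel_left, kap, kap]
  push_cast
  have hd : (0 : ℝ) ≤ d := by positivity
  have hj : (0 : ℝ) ≤ j := by positivity
  have h1 : (j : ℝ) + d + 1 ≤ (j + 1) * (d + 1) := by nlinarith
  have h2 : √((j : ℝ) + d + 1) ≤ (j + 1) * √((d : ℝ) + 1) := by
    rw [Real.sqrt_le_left (by positivity), mul_pow, Real.sq_sqrt (by positivity)]
    nlinarith [mul_nonneg hj hd, mul_nonneg (mul_nonneg hj hd) hj, mul_nonneg hj hj]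
  rw [mul_one_div, div_le_div_iff₀ (by positivity) (by positivity)]
  calc 1 * (((j : ℝ) + d + 1) * √((j : ℝ) + d + 1))
      ≤ 1 * (((j + 1) * (d + 1)) * ((j + 1) * √((d : ℝ) + 1))) := by gcongr
    _ = _ := by ring

lemma kap_le_four_mul {m n : ℕ} (h : n ≤ 2 * m) : kap m ≤ 4 * kap n := by
  have h0 : (n : ℝ) ≤ 2 * m := by exact_mod_cast h
  have hm : (0 : ℝ) ≤ m := by positivity
  rw [kap, kap, mul_one_div, div_le_div_iff₀ (by positivity) (by positivity)]
  have h1 : (n : ℝ) + 1 ≤ 2 * (m + 1) := by linarith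
  have h2 : √((n : ℝ) + 1) ≤ 2 * √((m : ℝ) + 1) := by
    rw [Real.sqrt_le_left (by positivity), mul_pow, Real.sq_sqrt (by positivity)]
    linarith
  calc 1 * (((n : ℝ) + 1) * √((n : ℝ) + 1)) ≤ 1 * ((2 * (m + 1)) * (2 * √((m : ℝ) + 1))) := by
        gcongr
    _ = _ := by ring

lemma exists_sum_kap_le : ∃ C : ℝ, 0 < C ∧ ∀ s : Finset ℕ, ∑ n ∈ s, kap n ≤ C := by
  have h : Summable kap := by
    have := (summable_nat_add_iff 1).2
      (Real.summable_nat_rpow.2 (show (-(3 / 2) : ℝ) < -1 by norm_num))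
    refine this.congr fun n => ?_
    rw [kap_eq_rpow]; push_cast; rfl
  refine ⟨∑' n, kap n + 1, ?_, fun s => ?_⟩
  · have : 0 ≤ ∑' n, kap n := tsum_nonneg fun n => (kap_pos n).le
    linarith
  · have := h.sum_le_tsum s (fun n _ => (kap_pos n).le)
    linarith

lemma exists_kap_conv : ∃ C : ℝ, 0 < C ∧ ∀ N : ℕ,
    ∑ j ∈ Finset.range (N + 1), kap j * kap (N - j) ≤ C * kap N := by
  obtain ⟨C, hC, h⟩ := exists_sum_kap_le
  refine ⟨8 * C, by positivity, fun N => ?_⟩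
  calc ∑ j ∈ Finset.range (N + 1), kap j * kap (N - j)
      ≤ ∑ j ∈ Finset.range (N + 1), 4 * kap N * (kap j + kap (N - j)) := by
        refine Finset.sum_le_sum fun j hj => ?_
        have hj := Finset.mem_range.1 hj
        have h1 := kap_pos j
        have h2 := kap_pos (N - j)
        have h3 := kap_pos N
        rcases le_total N (2 * j) with h4 | h4
        · have := kap_le_four_mul h4
          nlinarith
        · have := kap_le_four_mul (show N ≤ 2 * (N - j) by omega)
          nlinarith
    _ ≤ _ := by
      rw [← Finset.mul_sum, Finset.sum_add_distrib]
      have h5 := Finset.sum_range_reflect kap (N + 1)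
      have h6 : ∑ j ∈ Finset.range (N + 1), kap (N - j) = ∑ j ∈ Finset.range (N + 1), kap j := by
        rw [← h5]
        exact Finset.sum_congr rfl fun j _ => by congr 1
      rw [h6]
      have := h (Finset.range (N + 1))
      have := kap_pos N
      nlinarith

lemma exists_geom_kap_conv {ρ : ℝ} (h0 : 0 ≤ ρ) (h1 : ρ < 1) : ∃ C : ℝ, 0 < C ∧ ∀ v : ℕ,
    ∑ j ∈ Finset.range (v + 1), ρ ^ j * kap (v - j) ≤ C * kap v := by
  obtain ⟨C, hC, h⟩ := exists_sum_le_of_geom h0 h1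
  refine ⟨C, hC, fun v => ?_⟩
  calc ∑ j ∈ Finset.range (v + 1), ρ ^ j * kap (v - j)
      ≤ ∑ j ∈ Finset.range (v + 1), (((j : ℝ) + 1) ^ 2 * ρ ^ j) * kap v := by
        refine Finset.sum_le_sum fun j hj => ?_
        have := kap_sub_le (show j ≤ v by have := Finset.mem_range.1 hj; omega)
        calc ρ ^ j * kap (v - j) ≤ ρ ^ j * (((j : ℝ) + 1) ^ 2 * kap v) := by gcongr
          _ = _ := by ring
    _ ≤ _ := by
      rw [← Finset.sum_mul]
      exact mul_le_mul_of_nonneg_right (h _) (kap_pos v).le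

lemma exists_sum_weakBallot_le : ∃ C : ℝ, 0 < C ∧ ∀ (s : Finset ℕ) (n : ℕ),
    ∑ k ∈ s, Real.log 2 ^ k * weakBallot n k ≤ C * ((Real.exp 1 * Real.log 2) ^ n * kap n) := by
  obtain ⟨C, hC, h⟩ := exists_sum_ballot_le
  have ht0 : 0 < Real.log 2 := by linarith [log_two_bounds.1]
  refine ⟨2 / Real.log 2 ^ 2 * C * (Real.exp 1 * Real.log 2), by positivity, fun s n => ?_⟩
  have h1 := h (s.map (addRightEmbedding 2)) (n + 1)
  rw [Finset.sum_map] at h1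
  have h2 := kap_anti (Nat.le_succ n)
  calc ∑ k ∈ s, Real.log 2 ^ k * weakBallot n k
      ≤ ∑ k ∈ s, 2 / Real.log 2 ^ 2 * (Real.log 2 ^ (k + 2) * ballot (n + 1) (k + 2)) := by
        refine Finset.sum_le_sum fun k _ => ?_
        calc Real.log 2 ^ k * weakBallot n k
            ≤ Real.log 2 ^ k * (2 * ballot (n + 1) (k + 2)) := by
              gcongr; exact weakBallot_le_ballot n k
          _ = _ := by rw [pow_add]; field_simp
    _ ≤ 2 / Real.log 2 ^ 2 * (C * ((Real.exp 1 * Real.log 2) ^ (n + 1) * kap (n + 1))) := by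
        rw [← Finset.mul_sum]
        gcongr
        exact h1
    _ ≤ 2 / Real.log 2 ^ 2 * (C * ((Real.exp 1 * Real.log 2) ^ (n + 1) * kap n)) := by
        gcongr
    _ = _ := by rw [pow_succ]; ring

lemma exists_sum_parking_le : ∃ C : ℝ, 0 < C ∧ ∀ (s : Finset ℕ) (n : ℕ),
    ∑ k ∈ s, (2 * Real.log 2) ^ k * parking n k ≤
      C * ((2 * Real.exp 1 * Real.log 2) ^ n * kap n) := by
  have ht := log_two_bounds
  have ht0 : 0 < Real.log 2 := by linarith
  obtain ⟨C, hC, hCs⟩ := exists_sum_le_of_geom (β := 1 / (2 * Real.log 2))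
    (by positivity) (by rw [div_lt_one (by positivity)]; linarith)
  refine ⟨Real.exp 1 * C, by positivity, fun s n => ?_⟩
  have hk := kap_pos n
  calc ∑ k ∈ s, (2 * Real.log 2) ^ k * parking n k
      = ∑ k ∈ s with k ≤ n, (2 * Real.log 2) ^ k * parking n k := by
        rw [Finset.sum_filter]
        refine Finset.sum_congr rfl fun k _ => ?_
        split_ifs with h
        · rfl
        · rw [parking_eq_zero (by omega), mul_zero]
    _ ≤ ∑ k ∈ s with k ≤ n, Real.exp 1 * ((2 * Real.exp 1 * Real.log 2) ^ n * kap n) *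
          ((((n - k : ℕ) : ℝ) + 1) ^ 2 * (1 / (2 * Real.log 2)) ^ (n - k)) := by
        refine Finset.sum_le_sum fun k hk => ?_
        have hkn := (Finset.mem_filter.1 hk).2
        obtain ⟨d, rfl⟩ := Nat.exists_eq_add_of_le hkn
        rw [Nat.add_sub_cancel_left]
        have h1 := parking_sub_le (n := k + d) (d := d) (by omega)
        rw [Nat.add_sub_cancel] at h1
        calc (2 * Real.log 2) ^ k * parking (k + d) k
            ≤ (2 * Real.log 2) ^ k * (Real.exp 1 * (d + 1) *
              (Real.exp 1 ^ (k + d) * kap (k + d))) := by gcongr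
          _ = Real.exp 1 * ((2 * Real.exp 1 * Real.log 2) ^ (k + d) * kap (k + d)) *
              ((d + 1) * (1 / (2 * Real.log 2)) ^ d) := by
            simp only [pow_add, mul_pow, div_pow, one_pow]; field_simp
          _ ≤ _ := by
            gcongr
            have : (0 : ℝ) ≤ d := by positivity
            nlinarith
    _ ≤ _ := by
        rw [← Finset.mul_sum]
        rw [mul_right_comm]
        gcongr
        refine le_trans (le_of_eq ?_) (hCs ((s.filter (· ≤ n)).image (n - ·)))
        rw [Finset.sum_image]
        intro a ha b hb hab
        simp at ha hb hab
        omega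

section Powerset
variable {ι : Type*} [DecidableEq ι]

lemma sum_powerset_union {A B : Finset ι} (h : Disjoint A B) (f : Finset ι → ℝ) :
    ∑ s ∈ (A ∪ B).powerset, f s = ∑ a ∈ A.powerset, ∑ b ∈ B.powerset, f (a ∪ b) := by
  rw [← Finset.sum_product']
  symm
  refine Finset.sum_nbij' (fun p => p.1 ∪ p.2) (fun s => (s ∩ A, s ∩ B)) ?_ ?_ ?_ ?_ ?_
  · intro p hp
    simp only [Finset.mem_product, Finset.mem_powerset] at hp ⊢
    exact Finset.union_subset_union hp.1 hp.2
  · intro s _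
    simp
  · intro p hp
    simp only [Finset.mem_product, Finset.mem_powerset] at hp
    have h1 : p.1 ∩ B = ∅ := Finset.disjoint_iff_inter_eq_empty.1 (h.mono_left hp.1)
    have h2 : p.2 ∩ A = ∅ := Finset.disjoint_iff_inter_eq_empty.1 (h.symm.mono_left hp.2)
    ext1 <;> simp [Finset.union_inter_distrib_right, h1, h2, Finset.inter_eq_left.2 hp.1,
      Finset.inter_eq_left.2 hp.2]
  · intro s hs
    rw [Finset.mem_powerset] at hs
    simp [← Finset.inter_union_distrib_left, Finset.inter_eq_left.2 hs]
  · intros; rfl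

/-- The Mecke (insertion) formula for sums over subsets. -/
lemma sum_powerset_sum_mem (B : Finset ι) (G : Finset ι → ι → ℝ) :
    ∑ a ∈ B.powerset, ∑ r ∈ a, G a r =
      ∑ r ∈ B, ∑ a ∈ (B.erase r).powerset, G (insert r a) r := by
  rw [Finset.sum_sigma', Finset.sum_sigma']
  refine Finset.sum_bij' (fun p _ => ⟨p.2, p.1.erase p.2⟩) (fun p _ => ⟨insert p.1 p.2, p.1⟩)
    ?_ ?_ ?_ ?_ ?_
  · rintro ⟨a, r⟩ h
    simp only [Finset.mem_sigma, Finset.mem_powerset] at h ⊢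
    exact ⟨h.1 h.2, Finset.erase_subset_erase _ h.1⟩
  · rintro ⟨r, a⟩ h
    simp only [Finset.mem_sigma, Finset.mem_powerset] at h ⊢
    exact ⟨Finset.insert_subset h.1 (h.2.trans (Finset.erase_subset _ _)),
      Finset.mem_insert_self _ _⟩
  · rintro ⟨a, r⟩ h
    simp only [Finset.mem_sigma, Finset.mem_powerset] at h
    simp [Finset.insert_erase h.2]
  · rintro ⟨r, a⟩ h
    simp only [Finset.mem_sigma, Finset.mem_powerset] at h
    have : r ∉ a := fun hr => by simpa using h.2 hr
    simp [Finset.erase_insert this]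
  · rintro ⟨a, r⟩ h
    simp only [Finset.mem_sigma, Finset.mem_powerset] at h
    simp [Finset.insert_erase h.2]

lemma succ_mul_sum_powerset_card (B : Finset ι) (w : ι → ℝ) (b : ℕ) :
    ((b : ℝ) + 1) * ∑ s ∈ B.powerset with s.card = b + 1, ∏ i ∈ s, w i =
      ∑ r ∈ B, w r * ∑ s ∈ (B.erase r).powerset with s.card = b, ∏ i ∈ s, w i := by
  have h := sum_powerset_sum_mem B (fun s _ => if s.card = b + 1 then ∏ i ∈ s, w i else 0)
  simp only [Finset.sum_const, nsmul_eq_mul] at h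
  rw [Finset.mul_sum, Finset.sum_filter]
  convert h using 1
  · refine Finset.sum_congr rfl fun s _ => ?_
    split_ifs with hs
    · rw [hs]; push_cast; ring
    · simp
  · refine Finset.sum_congr rfl fun r _ => ?_
    rw [Finset.mul_sum, Finset.sum_filter]
    refine Finset.sum_congr rfl fun s hs => ?_
    have : r ∉ s := fun hr => by simpa using Finset.mem_powerset.1 hs hr
    rw [Finset.card_insert_of_notMem this, Finset.prod_insert this]
    simp

lemma sum_powerset_card_nonneg {κ : Type*} {B : Finset κ} {w : κ → ℝ} (hw : ∀ i, 0 ≤ w i)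
    (P : Finset κ → Prop) [DecidablePred P] : 0 ≤ ∑ s ∈ B.powerset with P s, ∏ i ∈ s, w i :=
  Finset.sum_nonneg fun _ _ => Finset.prod_nonneg fun i _ => hw i

lemma sum_powerset_card_le {w : ι → ℝ} (hw : ∀ i, 0 ≤ w i) {t : ℝ} (b : ℕ) {B : Finset ι}
    (ht : ∑ i ∈ B, w i ≤ t) :
    ∑ s ∈ B.powerset with s.card = b, ∏ i ∈ s, w i ≤ t ^ b * (1 / (b.factorial : ℝ)) := by
  have ht0 : 0 ≤ t := (Finset.sum_nonneg fun i _ => hw i).trans ht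
  induction b generalizing B with
  | zero =>
    rw [Finset.sum_eq_single ∅]
    · simp
    · intro s hs hne
      simp at hs
      exact absurd hs.2 hne
    · simp
  | succ b ih =>
    have h := succ_mul_sum_powerset_card B w b
    have hb : (0 : ℝ) < b + 1 := by positivity
    refine le_of_mul_le_mul_left ?_ hb
    rw [h]
    calc ∑ r ∈ B, w r * ∑ s ∈ (B.erase r).powerset with s.card = b, ∏ i ∈ s, w i
        ≤ ∑ r ∈ B, w r * (t ^ b * (1 / (b.factorial : ℝ))) := by
          refine Finset.sum_le_sum fun r _ => mul_le_mul_of_nonneg_left (ih ?_) (hw r)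
          exact (Finset.sum_le_sum_of_subset_of_nonneg (Finset.erase_subset _ _)
            fun i _ _ => hw i).trans ht
      _ ≤ t * (t ^ b * (1 / (b.factorial : ℝ))) := by
          rw [← Finset.sum_mul]; gcongr
      _ = _ := by
          rw [Nat.factorial_succ]; push_cast; rw [pow_succ]; field_simp

lemma le_sum_powerset_card {w : ι → ℝ} (hw : ∀ i, 0 ≤ w i) {ω : ℝ} (hω0 : 0 ≤ ω)
    (b : ℕ) {B : Finset ι} (hω : ∀ i ∈ B, w i ≤ ω) {S : ℝ} (hS : S ≤ ∑ i ∈ B, w i)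
    (h : b * ω ≤ S) :
    (S - b * ω) ^ b * (1 / (b.factorial : ℝ)) ≤
      ∑ s ∈ B.powerset with s.card = b, ∏ i ∈ s, w i := by
  induction b generalizing B S with
  | zero =>
    rw [Finset.sum_eq_single ∅]
    · simp
    · intro s hs hne
      simp at hs
      exact absurd hs.2 hne
    · simp
  | succ b ih =>
    rcases B.eq_empty_or_nonempty with rfl | ⟨x, hx⟩
    · simp only [Finset.sum_empty] at hS
      have : (0 : ℝ) ≤ (b + 1 : ℕ) * ω := by positivity
      have h0 : S - (b + 1 : ℕ) * ω = 0 := by linarith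
      rw [h0, zero_pow (by omega), zero_mul]
      exact sum_powerset_card_nonneg hw _
    have hk := succ_mul_sum_powerset_card B w b
    have hb : (0 : ℝ) < b + 1 := by positivity
    refine le_of_mul_le_mul_left ?_ hb
    rw [hk]
    push_cast at h ⊢
    have hS0 : 0 ≤ S := le_trans (by positivity) h
    calc ((b : ℝ) + 1) * ((S - (b + 1) * ω) ^ (b + 1) * (1 / ((b + 1).factorial : ℝ)))
        = (S - (b + 1) * ω) * ((S - ω - b * ω) ^ b * (1 / (b.factorial : ℝ))) := by
          rw [Nat.factorial_succ]; push_cast; rw [pow_succ, show S - ω - b * ω = S - (b + 1) * ω by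
            ring]; field_simp
      _ ≤ (∑ i ∈ B, w i) * ((S - ω - b * ω) ^ b * (1 / (b.factorial : ℝ))) := by
          have : 0 ≤ S - ω - b * ω := by linarith
          gcongr
          nlinarith
      _ ≤ _ := by
          rw [Finset.sum_mul]
          refine Finset.sum_le_sum fun r hr => mul_le_mul_of_nonneg_left (ih ?_ ?_ ?_) (hw r)
          · intro i hi; exact hω i (Finset.mem_of_mem_erase hi)
          · have := Finset.add_sum_erase B w hr
            have := hω r hr
            linarith
          · linarith

/-- The union of the first `n` blocks. -/
noncomputable def blockUnion (E : ℕ → Finset ι) (n : ℕ) : Finset ι := (Finset.range n).biUnion E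

lemma blockUnion_zero (E : ℕ → Finset ι) : blockUnion E 0 = ∅ := by simp [blockUnion]

lemma blockUnion_succ (E : ℕ → Finset ι) (n : ℕ) :
    blockUnion E (n + 1) = blockUnion E n ∪ E n := by
  rw [blockUnion, Finset.range_add_one, Finset.biUnion_insert, Finset.union_comm]; rfl

lemma blockUnion_mono (E : ℕ → Finset ι) {m n : ℕ} (h : m ≤ n) :
    blockUnion E m ⊆ blockUnion E n :=
  Finset.biUnion_subset_biUnion_of_subset_left _ (Finset.range_subset_range.2 h)

lemma disjoint_blockUnion {E : ℕ → Finset ι} {n : ℕ}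
    (hE : ∀ i j, i < j → j ≤ n → Disjoint (E i) (E j)) : Disjoint (blockUnion E n) (E n) := by
  rw [blockUnion, Finset.disjoint_biUnion_left]
  exact fun i hi => hE i n (Finset.mem_range.1 hi) le_rfl

/-- `s` has `k` elements and its occupation numbers on the first `r` blocks satisfy `c r`. -/
def IsWalkSet (E : ℕ → Finset ι) (c : ℕ → ℕ → Prop) (n k : ℕ) (s : Finset ι) : Prop :=
  s.card = k ∧ ∀ r, 1 ≤ r → r ≤ n → c r (s ∩ blockUnion E r).card

noncomputable def walkSets (E : ℕ → Finset ι) (c : ℕ → ℕ → Prop) (n k : ℕ) : Finset (Finset ι) :=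
  (blockUnion E n).powerset.filter (IsWalkSet E c n k)

lemma sum_walkSets_zero (E : ℕ → Finset ι) (c : ℕ → ℕ → Prop) (w : ι → ℝ) (k : ℕ) :
    ∑ s ∈ walkSets E c 0 k, ∏ i ∈ s, w i = walk c 0 k := by
  have h : ∀ s : Finset ι, (∀ r, 1 ≤ r → r ≤ 0 → c r (s ∩ blockUnion E r).card) :=
    fun s r h1 h2 => by omega
  rw [walkSets, blockUnion_zero, Finset.sum_filter, walk]
  simp [IsWalkSet, eq_comm (b := k)]
  congr 1
  simp only [eq_iff_iff, and_iff_left_iff_imp]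
  intros; omega

lemma sum_walkSets_succ {E : ℕ → Finset ι} (c : ℕ → ℕ → Prop) (w : ι → ℝ) {n : ℕ} (k : ℕ)
    (hE : ∀ i j, i < j → j ≤ n → Disjoint (E i) (E j)) (hc : c (n + 1) k) :
    ∑ s ∈ walkSets E c (n + 1) k, ∏ i ∈ s, w i =
      ∑ p ∈ antidiagonal k, (∑ s ∈ walkSets E c n p.1, ∏ i ∈ s, w i) *
        ∑ s ∈ (E n).powerset with s.card = p.2, ∏ i ∈ s, w i := by
  have hd := disjoint_blockUnion hE
  rw [walkSets, Finset.sum_filter, blockUnion_succ, sum_powerset_union hd]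
  have : ∀ p ∈ antidiagonal k, (∑ s ∈ walkSets E c n p.1, ∏ i ∈ s, w i) *
        ∑ s ∈ (E n).powerset with s.card = p.2, ∏ i ∈ s, w i =
      ∑ a ∈ (blockUnion E n).powerset, ∑ b ∈ (E n).powerset,
        if b.card = p.2 ∧ IsWalkSet E c n p.1 a
        then (∏ i ∈ a, w i) * ∏ i ∈ b, w i else 0 := by
    intro p _
    rw [walkSets, Finset.sum_filter, Finset.sum_filter, Finset.sum_mul_sum]
    refine Finset.sum_congr rfl fun a _ => Finset.sum_congr rfl fun b _ => ?_
    by_cases h1 : IsWalkSet E c n p.1 a <;> by_cases h2 : b.card = p.2 <;> simp [h1, h2]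
  rw [Finset.sum_congr rfl this, Finset.sum_comm' (t' := (blockUnion E n).powerset)
    (s' := fun _ => antidiagonal k) (by simp)]
  refine Finset.sum_congr rfl fun a ha => ?_
  rw [Finset.sum_comm' (t' := (E n).powerset) (s' := fun _ => antidiagonal k) (by simp)]
  refine Finset.sum_congr rfl fun b hb => ?_
  rw [Finset.mem_powerset] at ha hb
  have hab : Disjoint a b := hd.mono ha hb
  have hiff : IsWalkSet E c (n + 1) k (a ∪ b) ↔ a.card + b.card = k ∧
      ∀ r, 1 ≤ r → r ≤ n → c r (a ∩ blockUnion E r).card := by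
    rw [IsWalkSet]
    rw [Finset.card_union_of_disjoint hab]
    refine and_congr_right fun hk => ?_
    have hr : ∀ r ≤ n, (a ∪ b) ∩ blockUnion E r = a ∩ blockUnion E r := by
      intro r hr
      rw [Finset.union_inter_distrib_right, Finset.disjoint_iff_inter_eq_empty.1
        (hd.symm.mono hb (blockUnion_mono E hr)), Finset.union_empty]
    constructor
    · intro h r h1 h2
      rw [← hr r h2]; exact h r h1 (by omega)
    · intro h r h1 h2
      rcases Nat.lt_or_ge n r with h3 | h3
      · obtain rfl : r = n + 1 := by omega
        rw [blockUnion_succ, Finset.inter_eq_left.2 (Finset.union_subset_union ha hb),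
          Finset.card_union_of_disjoint hab, hk]
        exact hc
      · rw [hr r h3]; exact h r h1 h3
  rw [if_congr hiff rfl rfl, Finset.prod_union hab]
  by_cases hk : a.card + b.card = k
  · rw [Finset.sum_eq_single (a.card, b.card)]
    · simp [hk, IsWalkSet]
    · rintro p _ hp
      rw [if_neg]
      rintro ⟨h2, h1, _⟩
      exact hp (by ext <;> simp [h1, h2])
    · simp [hk]
  · rw [if_neg (by tauto), Finset.sum_eq_zero]
    intro p hp
    rw [Finset.HasAntidiagonal.mem_antidiagonal] at hp
    rw [if_neg]
    rintro ⟨h2, h1, _⟩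
    omega

lemma walkSets_succ_eq_empty {E : ℕ → Finset ι} {c : ℕ → ℕ → Prop} {n k : ℕ} (hc : ¬ c (n + 1) k) :
    walkSets E c (n + 1) k = ∅ := by
  rw [walkSets, Finset.filter_eq_empty_iff]
  rintro s hs ⟨h1, h2⟩
  have := h2 (n + 1) (by omega) le_rfl
  rw [Finset.inter_eq_left.2 (Finset.mem_powerset.1 hs), h1] at this
  exact hc this

lemma sum_walkSets_le {E : ℕ → Finset ι} (c : ℕ → ℕ → Prop) {w : ι → ℝ} (hw : ∀ i, 0 ≤ w i)
    {t : ℝ} (n k : ℕ) (hE : ∀ i j, i < j → j < n → Disjoint (E i) (E j))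
    (ht : ∀ i < n, ∑ x ∈ E i, w x ≤ t) :
    ∑ s ∈ walkSets E c n k, ∏ i ∈ s, w i ≤ t ^ k * walk c n k := by
  induction n generalizing k with
  | zero =>
    rw [sum_walkSets_zero, walk]
    split_ifs with h <;> simp [h]
  | succ n ih =>
    have ht0 : 0 ≤ t := (Finset.sum_nonneg fun i _ => hw i).trans (ht n (by omega))
    by_cases hc : c (n + 1) k
    · rw [sum_walkSets_succ c w k (fun i j h1 h2 => hE i j h1 (by omega)) hc, walk, if_pos hc,
        Finset.mul_sum]
      refine Finset.sum_le_sum fun p hp => ?_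
      rw [Finset.HasAntidiagonal.mem_antidiagonal] at hp
      calc _ ≤ (t ^ p.1 * walk c n p.1) * (t ^ p.2 * (1 / (p.2.factorial : ℝ))) := by
            refine mul_le_mul (ih p.1 (fun i j h1 h2 => hE i j h1 (by omega))
              fun i hi => ht i (by omega)) (sum_powerset_card_le hw _ (ht n (by omega)))
              ?_ (mul_nonneg (by positivity) (walk_nonneg _ _ _))
            exact Finset.sum_nonneg fun _ _ => Finset.prod_nonneg fun i _ => hw i
        _ = _ := by rw [← hp, pow_add]; ring
    · rw [walkSets_succ_eq_empty hc, Finset.sum_empty]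
      exact mul_nonneg (by positivity) (walk_nonneg _ _ _)

lemma le_sum_parkingSets {E : ℕ → Finset ι} {w : ι → ℝ} (hw : ∀ i, 0 ≤ w i)
    {t : ℝ} (ht0 : 0 ≤ t) (θ : ℕ → ℝ) (hθ : ∀ i, 0 ≤ θ i)
    (n k : ℕ) (hE : ∀ i j, i < j → j < n → Disjoint (E i) (E j))
    (ht : ∀ i < n, ∀ l ≤ i + 1, θ i * (t ^ l * (1 / (l.factorial : ℝ))) ≤
      ∑ s ∈ (E i).powerset with s.card = l, ∏ x ∈ s, w x) :
    (∏ i ∈ Finset.range n, θ i) * (t ^ k * parking n k) ≤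
      ∑ s ∈ walkSets E (fun r k => k ≤ r) n k, ∏ i ∈ s, w i := by
  induction n generalizing k with
  | zero =>
    rw [sum_walkSets_zero, Finset.prod_range_zero, one_mul]
    show t ^ k * walk _ 0 k ≤ _
    rw [walk]
    split_ifs with h <;> simp [h]
  | succ n ih =>
    by_cases hc : k ≤ n + 1
    · rw [sum_walkSets_succ (fun r k => k ≤ r) w k (fun i j h1 h2 => hE i j h1 (by omega)) hc]
      show _ * (_ * walk _ (n + 1) k) ≤ _
      rw [walk, if_pos hc, Finset.mul_sum, Finset.mul_sum, Finset.prod_range_succ]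
      refine Finset.sum_le_sum fun p hp => ?_
      rw [Finset.HasAntidiagonal.mem_antidiagonal] at hp
      calc _ = ((∏ i ∈ Finset.range n, θ i) * (t ^ p.1 * parking n p.1)) *
            (θ n * (t ^ p.2 * (1 / (p.2.factorial : ℝ)))) := by
            rw [← hp, pow_add]; ring
        _ ≤ _ := by
            refine mul_le_mul (ih p.1 (fun i j h1 h2 => hE i j h1 (by omega))
              fun i hi => ht i (by omega)) (ht n (by omega) p.2 (by omega)) ?_ ?_
            · exact mul_nonneg (hθ n) (by positivity)
            · exact Finset.sum_nonneg fun _ _ => Finset.prod_nonneg fun i _ => hw i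
    · rw [parking_eq_zero (by omega), mul_zero, mul_zero]
      exact Finset.sum_nonneg fun _ _ => Finset.prod_nonneg fun i _ => hw i

end Powerset

/-- The primes in the half-open interval `(y, z]`. -/
noncomputable def primesIoc (y z : ℝ) : Finset ℕ := (Finset.Ioc ⌊y⌋₊ ⌊z⌋₊).filter Nat.Prime

lemma mem_primesIoc {y z : ℝ} {p : ℕ} : p ∈ primesIoc y z ↔ p.Prime ∧ y < p ∧ (p : ℝ) ≤ z := by
  rw [primesIoc, Finset.mem_filter, Finset.mem_Ioc, and_comm]
  refine and_congr_right fun hp => ?_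
  have hp0 : p ≠ 0 := hp.ne_zero
  rw [Nat.floor_lt' hp0, Nat.le_floor_iff' hp0]

lemma prime_of_mem {y z : ℝ} {p : ℕ} (h : p ∈ primesIoc y z) : p.Prime := (mem_primesIoc.1 h).1

lemma two_le_of_mem {y z : ℝ} {p : ℕ} (h : p ∈ primesIoc y z) : (2 : ℝ) ≤ p := by
  exact_mod_cast (prime_of_mem h).two_le

lemma primesIoc_union {a b c : ℝ} (h1 : a ≤ b) (h2 : b ≤ c) :
    primesIoc a c = primesIoc a b ∪ primesIoc b c := by
  ext p
  simp only [Finset.mem_union, mem_primesIoc]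
  constructor
  · rintro ⟨h, h3, h4⟩
    rcases le_or_gt (p : ℝ) b with h5 | h5
    · exact Or.inl ⟨h, h3, h5⟩
    · exact Or.inr ⟨h, h5, h4⟩
  · rintro (⟨h, h3, h4⟩ | ⟨h, h3, h4⟩)
    · exact ⟨h, h3, h4.trans h2⟩
    · exact ⟨h, h1.trans_lt h3, h4⟩

lemma primesIoc_disjoint {a b c d : ℝ} (h : b ≤ c) : Disjoint (primesIoc a b) (primesIoc c d) := by
  rw [Finset.disjoint_left]
  intro p h1 h2
  rw [mem_primesIoc] at h1 h2
  linarith [h1.2.2, h2.2.1]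

lemma sum_primesIoc_union {a b c : ℝ} (h1 : a ≤ b) (h2 : b ≤ c) (f : ℕ → ℝ) :
    ∑ p ∈ primesIoc a c, f p = ∑ p ∈ primesIoc a b, f p + ∑ p ∈ primesIoc b c, f p := by
  rw [primesIoc_union h1 h2, Finset.sum_union (primesIoc_disjoint le_rfl)]

lemma sum_primesIoc_log_le {x : ℝ} (hx : 0 ≤ x) :
    ∑ p ∈ primesIoc 0 x, Real.log p ≤ Real.log 4 * x := by
  have := Chebyshev.theta_le_log4_mul_x hx
  rw [Chebyshev.theta] at this
  rw [primesIoc, Nat.floor_zero]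
  exact this

lemma primesIoc_natCast (n : ℕ) : primesIoc 0 n = (Finset.Ioc 0 n).filter Nat.Prime := by
  rw [primesIoc, Nat.floor_zero, Nat.floor_natCast]

lemma log_factorial_eq (n : ℕ) :
    Real.log n.factorial =
      ∑ p ∈ primesIoc 0 n, (padicValNat p n.factorial : ℝ) * Real.log p := by
  rw [Real.log_nat_eq_sum_factorization, Finsupp.sum_of_support_subset (s := primesIoc 0 n)]
  · refine Finset.sum_congr rfl fun p hp => ?_
    rw [Nat.factorization_def _ (prime_of_mem hp)]
  · intro p hp
    rw [Nat.support_factorization] at hp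
    have hp' := Nat.prime_of_mem_primeFactors hp
    rw [mem_primesIoc]
    refine ⟨hp', by exact_mod_cast hp'.pos, ?_⟩
    exact_mod_cast (hp'.dvd_factorial).1 (Nat.dvd_of_mem_primeFactors hp)
  · simp

lemma padicValNat_factorial_le_mul {p n : ℕ} (hp : p.Prime) :
    (padicValNat p n.factorial : ℝ) ≤ n * (1 / ((p : ℝ) - 1)) := by
  have := Fact.mk hp
  have h := sub_one_mul_padicValNat_factorial (p := p) n
  have h1 : (p - 1) * padicValNat p n.factorial ≤ n := by omega
  have h2 : ((p - 1 : ℕ) : ℝ) * padicValNat p n.factorial ≤ n := by exact_mod_cast h1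
  rw [Nat.cast_sub hp.one_le, Nat.cast_one] at h2
  have h3 : (0 : ℝ) < (p : ℝ) - 1 := by
    have : (1 : ℝ) < p := by exact_mod_cast hp.one_lt
    linarith
  rw [mul_one_div, le_div_iff₀ h3]
  linarith

lemma le_padicValNat_factorial {p n : ℕ} (hp : p.Prime) :
    (n : ℝ) / p - 1 ≤ padicValNat p n.factorial := by
  have := Fact.mk hp
  have h0 := padicValNat_factorial_mul (p := p) (n / p)
  have h1 : padicValNat p (p * (n / p)).factorial ≤ padicValNat p n.factorial := by
    rw [← Nat.factorization_def _ hp, ← Nat.factorization_def _ hp]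
    exact (Nat.factorization_le_iff_dvd (Nat.factorial_ne_zero _) (Nat.factorial_ne_zero _)).2
      (Nat.factorial_dvd_factorial (Nat.mul_div_le n p)) p
  have h2 : n / p ≤ padicValNat p n.factorial := by omega
  have h3 : ((n / p : ℕ) : ℝ) ≤ padicValNat p n.factorial := by exact_mod_cast h2
  have h4 := Nat.lt_div_mul_add hp.pos (a := n)
  have hp0 : (0 : ℝ) < p := by exact_mod_cast hp.pos
  have h5 : (n : ℝ) < (n / p : ℕ) * p + p := by exact_mod_cast h4
  have h6 : (n : ℝ) / p < (n / p : ℕ) + 1 := by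
    rw [div_lt_iff₀ hp0]; linarith
  linarith

lemma sum_log_div_le (n : ℕ) (hn : n ≠ 0) :
    ∑ p ∈ primesIoc 0 n, Real.log p / p ≤ Real.log n + Real.log 4 := by
  have hn0 : (0 : ℝ) < n := by positivity
  have h1 : Real.log n.factorial ≤ n * Real.log n := by
    rw [← Real.log_pow]
    exact Real.log_le_log (by positivity) (by exact_mod_cast Nat.factorial_le_pow n)
  rw [log_factorial_eq] at h1
  have h2 : ∑ p ∈ primesIoc 0 n, ((n : ℝ) * (Real.log p / p) - Real.log p) ≤ n * Real.log n := by
    refine le_trans (Finset.sum_le_sum fun p hp => ?_) h1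
    have := le_padicValNat_factorial (n := n) (prime_of_mem hp)
    have h3 : 0 ≤ Real.log p := Real.log_natCast_nonneg p
    calc (n : ℝ) * (Real.log p / p) - Real.log p = ((n : ℝ) / p - 1) * Real.log p := by ring
      _ ≤ _ := by gcongr
  rw [Finset.sum_sub_distrib, ← Finset.mul_sum] at h2
  have h3 := sum_primesIoc_log_le hn0.le
  refine le_of_mul_le_mul_left ?_ hn0
  linarith

lemma le_sum_log_div_sub_one (n : ℕ) (hn : n ≠ 0) :
    Real.log n - 1 ≤ ∑ p ∈ primesIoc 0 n, Real.log p / ((p : ℝ) - 1) := by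
  have hn0 : (0 : ℝ) < n := by positivity
  have h1 := Stirling.le_log_factorial_stirling hn
  have hl : 0 ≤ Real.log n := Real.log_natCast_nonneg n
  have h2 : 0 ≤ Real.log (2 * Real.pi) := Real.log_nonneg (by linarith [Real.pi_gt_three])
  have h3 : Real.log n.factorial ≤ n * ∑ p ∈ primesIoc 0 n, Real.log p / ((p : ℝ) - 1) := by
    rw [log_factorial_eq, Finset.mul_sum]
    refine Finset.sum_le_sum fun p hp => ?_
    have := padicValNat_factorial_le_mul (n := n) (prime_of_mem hp)
    have h3 : 0 ≤ Real.log p := Real.log_natCast_nonneg p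
    calc (padicValNat p n.factorial : ℝ) * Real.log p ≤ (n * (1 / ((p : ℝ) - 1))) * Real.log p := by
          gcongr
      _ = _ := by ring
  refine le_of_mul_le_mul_left ?_ hn0
  linarith

lemma exists_sum_log_div_mul_le : ∃ C : ℝ, 0 < C ∧ ∀ s : Finset ℕ, (∀ p ∈ s, p.Prime) →
    ∑ p ∈ s, (Real.log p / ((p : ℝ) - 1) - Real.log p / p) ≤ C := by
  have hs : Summable fun n : ℕ => 4 * (n : ℝ) ^ (-(3 / 2) : ℝ) :=
    (Real.summable_nat_rpow.2 (by norm_num)).mul_left 4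
  refine ⟨∑' n : ℕ, 4 * (n : ℝ) ^ (-(3 / 2) : ℝ) + 1, ?_, fun s hp => ?_⟩
  · have : 0 ≤ ∑' n : ℕ, 4 * (n : ℝ) ^ (-(3 / 2) : ℝ) := tsum_nonneg fun n => by positivity
    linarith
  · have h1 := hs.sum_le_tsum s (fun _ _ => by positivity)
    refine le_trans (Finset.sum_le_sum fun p hps => ?_) (h1.trans (by linarith))
    have h2 : (2 : ℝ) ≤ p := by exact_mod_cast (hp p hps).two_le
    have h0 : (0 : ℝ) < p := by linarith
    have h3 := Real.log_le_rpow_div h0.le (show (0 : ℝ) < 1 / 2 by norm_num)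
    have h4 : (0 : ℝ) < p - 1 := by linarith
    calc Real.log p / ((p : ℝ) - 1) - Real.log p / p = Real.log p * (1 / (p * (p - 1))) := by
          field_simp; ring
      _ ≤ ((p : ℝ) ^ (1 / 2 : ℝ) / (1 / 2)) * (2 / (p : ℝ) ^ (2 : ℝ)) := by
          refine mul_le_mul h3 ?_ (by positivity) (by positivity)
          rw [div_le_div_iff₀ (by positivity) (by positivity), Real.rpow_two]
          nlinarith
      _ = 4 * ((p : ℝ) ^ (1 / 2 : ℝ) * (p : ℝ) ^ (-2 : ℝ)) := by
          rw [Real.rpow_neg h0.le]; ring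
      _ = _ := by rw [← Real.rpow_add h0]; norm_num

lemma log_div_le_log_div_sub_one {p : ℕ} (hp : p.Prime) :
    Real.log p / p ≤ Real.log p / ((p : ℝ) - 1) := by
  have h2 : (2 : ℝ) ≤ p := by exact_mod_cast hp.two_le
  have h4 : (0 : ℝ) < p - 1 := by linarith
  have h3 : 0 ≤ Real.log p := Real.log_natCast_nonneg p
  exact div_le_div_of_nonneg_left h3 h4 (by linarith)

lemma primesIoc_floor (x : ℝ) : primesIoc 0 x = primesIoc 0 (⌊x⌋₊ : ℕ) := by
  rw [primesIoc, primesIoc, Nat.floor_natCast]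

lemma log_floor_bounds {x : ℝ} (hx : 1 ≤ x) :
    Real.log ⌊x⌋₊ ≤ Real.log x ∧ Real.log x ≤ Real.log ⌊x⌋₊ + 1 := by
  have h1 : 1 ≤ ⌊x⌋₊ := Nat.one_le_floor_iff _ |>.2 hx
  have h2 : (1 : ℝ) ≤ ⌊x⌋₊ := by exact_mod_cast h1
  have h3 := Nat.floor_le (show 0 ≤ x by linarith)
  have h4 := Nat.lt_floor_add_one x
  refine ⟨Real.log_le_log (by linarith) h3, ?_⟩
  have h5 : x ≤ ⌊x⌋₊ * Real.exp 1 := by nlinarith [exp_one_bounds.1]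
  calc Real.log x ≤ Real.log (⌊x⌋₊ * Real.exp 1) := Real.log_le_log (by linarith) h5
    _ = _ := by rw [Real.log_mul (by linarith) (by positivity), Real.log_exp]

/-- Mertens' first theorem. -/
lemma exists_mertens_first : ∃ C : ℝ, 1 ≤ C ∧ ∀ x : ℝ, 1 ≤ x →
    Real.log x - C ≤ ∑ p ∈ primesIoc 0 x, Real.log p / p ∧
    ∑ p ∈ primesIoc 0 x, Real.log p / ((p : ℝ) - 1) ≤ Real.log x + C := by
  obtain ⟨C, hC, h⟩ := exists_sum_log_div_mul_le
  have h4 : 0 ≤ Real.log 4 := Real.log_nonneg (by norm_num)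
  refine ⟨C + Real.log 4 + 2, by linarith, fun x hx => ?_⟩
  have hx1 : 1 ≤ ⌊x⌋₊ := Nat.one_le_floor_iff _ |>.2 hx
  have hb := log_floor_bounds hx
  have h1 := sum_log_div_le ⌊x⌋₊ (by omega)
  have h2 := le_sum_log_div_sub_one ⌊x⌋₊ (by omega)
  have h3 := h (primesIoc 0 (⌊x⌋₊ : ℕ)) fun p hp => prime_of_mem hp
  rw [Finset.sum_sub_distrib] at h3
  rw [primesIoc_floor]
  constructor <;> linarith

lemma primesIoc_succ_sum (f : ℕ → ℝ) (n : ℕ) :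
    ∑ p ∈ primesIoc 0 ((n + 1 : ℕ) : ℝ), f p =
      ∑ p ∈ primesIoc 0 (n : ℝ), f p + if (n + 1).Prime then f (n + 1) else 0 := by
  rw [primesIoc_natCast, primesIoc_natCast, Finset.sum_filter, Finset.sum_filter,
    ← Finset.insert_Ioc_right_eq_Ioc_add_one (by omega), Finset.sum_insert (by simp), add_comm]

lemma mertens_second_step {u v : ℝ} (hv : 0 < v) (huv : v ≤ u) (h1 : u - v ≤ 1) :
    0 ≤ Real.log u - Real.log v - (u - v) / u ∧
      Real.log u - Real.log v - (u - v) / u ≤ 1 / v - 1 / u := by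
  have hu : 0 < u := hv.trans_le huv
  rw [← Real.log_div hu.ne' hv.ne']
  have h2 := Real.one_sub_inv_le_log_of_pos (div_pos hu hv)
  have h3 := Real.log_le_sub_one_of_pos (div_pos hu hv)
  have h4 : 1 - (u / v)⁻¹ = (u - v) / u := by field_simp
  have h5 : u / v - 1 = (u - v) / v := by field_simp
  have h6 : (u - v) / v - (u - v) / u ≤ 1 / v - 1 / u := by
    have : (u - v) / v - (u - v) / u = (u - v) * (1 / v - 1 / u) := by ring
    rw [this]
    have : 0 ≤ 1 / v - 1 / u := by
      rw [sub_nonneg]; exact one_div_le_one_div_of_le hv huv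
    nlinarith
  constructor <;> linarith

/-- Mertens' second theorem for natural endpoints. -/
lemma exists_mertens_second_nat : ∃ C : ℝ, 0 < C ∧ ∀ m n : ℕ, 2 ≤ m → m ≤ n →
    |(∑ p ∈ primesIoc 0 n, 1 / ((p : ℝ) - 1) - ∑ p ∈ primesIoc 0 m, 1 / ((p : ℝ) - 1)) -
      (Real.log (Real.log n) - Real.log (Real.log m))| ≤ C := by
  obtain ⟨C, hC, h⟩ := exists_mertens_first
  have hB : ∀ n : ℕ, 1 ≤ n →
      |∑ p ∈ primesIoc 0 (n : ℝ), Real.log p / ((p : ℝ) - 1) - Real.log n| ≤ C := by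
    intro n hn
    have h1 := h n (by exact_mod_cast hn)
    have h2 : ∑ p ∈ primesIoc 0 (n : ℝ), Real.log p / p ≤
        ∑ p ∈ primesIoc 0 (n : ℝ), Real.log p / ((p : ℝ) - 1) :=
      Finset.sum_le_sum fun p hp => log_div_le_log_div_sub_one (prime_of_mem hp)
    rw [abs_le]; constructor <;> linarith
  set B : ℕ → ℝ := fun n => ∑ p ∈ primesIoc 0 (n : ℝ), Real.log p / ((p : ℝ) - 1) - Real.log n
    with hBdef
  set S : ℕ → ℝ := fun n => ∑ p ∈ primesIoc 0 (n : ℝ), 1 / ((p : ℝ) - 1) with hS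
  set T : ℕ → ℝ := fun n => S n - B n / Real.log n - Real.log (Real.log n) with hT
  have hl2 := log_two_bounds
  have hlog : ∀ n : ℕ, 2 ≤ n → Real.log 2 ≤ Real.log n := fun n hn =>
    Real.log_le_log (by norm_num) (by exact_mod_cast hn)
  have hstep : ∀ n : ℕ, 2 ≤ n →
      |T (n + 1) - T n| ≤ (C + 1) * (1 / Real.log n - 1 / Real.log (n + 1 : ℕ)) := by
    intro n hn
    have hv := hlog n hn
    have hu := hlog (n + 1) (by omega)
    have hn0 : (0 : ℝ) < n := by positivity
    have huv : Real.log n ≤ Real.log (n + 1 : ℕ) :=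
      Real.log_le_log hn0 (by push_cast; linarith)
    have hd : Real.log (n + 1 : ℕ) - Real.log n ≤ 1 := by
      rw [← Real.log_div (by positivity) (by positivity)]
      refine (Real.log_le_sub_one_of_pos (by positivity)).trans ?_
      rw [sub_le_iff_le_add, div_le_iff₀ hn0]
      have : (2 : ℝ) ≤ n := by exact_mod_cast hn
      push_cast; linarith
    have hst := mertens_second_step (by linarith) huv hd
    have hSB : S (n + 1) - S n = (B (n + 1) - B n + (Real.log (n + 1 : ℕ) - Real.log n)) /
        Real.log (n + 1 : ℕ) := by
      simp only [hS, hBdef, primesIoc_succ_sum]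
      split_ifs with hp
      · have : ((n + 1 : ℕ) : ℝ) - 1 ≠ 0 := by push_cast; simp; omega
        have : Real.log (n + 1 : ℕ) ≠ 0 := by linarith
        field_simp
        ring
      · simp
    have hT' : T (n + 1) - T n = B n * (1 / Real.log n - 1 / Real.log (n + 1 : ℕ)) -
        (Real.log (Real.log (n + 1 : ℕ)) - Real.log (Real.log n) -
          (Real.log (n + 1 : ℕ) - Real.log n) / Real.log (n + 1 : ℕ)) := by
      simp only [hT]
      have : S (n + 1) = S n + (B (n + 1) - B n + (Real.log (n + 1 : ℕ) - Real.log n)) /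
        Real.log (n + 1 : ℕ) := by linarith
      rw [this]
      ring
    have hBn := abs_le.1 (hB n (by omega))
    have hpos : 0 ≤ 1 / Real.log n - 1 / Real.log (n + 1 : ℕ) := by
      rw [sub_nonneg]; exact one_div_le_one_div_of_le (by linarith) huv
    rw [hT', abs_le]
    constructor <;> nlinarith [mul_le_mul_of_nonneg_right hBn.1 hpos,
      mul_le_mul_of_nonneg_right hBn.2 hpos]
  have hsum : ∀ m n : ℕ, 2 ≤ m → m ≤ n →
      |T n - T m| ≤ (C + 1) * (1 / Real.log m - 1 / Real.log n) := by
    intro m n hm hmn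
    induction n, hmn using Nat.le_induction with
    | base => simp
    | succ n hmn ih =>
      have := hstep n (by omega)
      rw [abs_le] at *
      constructor <;> linarith
  refine ⟨(C + 1) * 2 + 4 * C, by linarith, fun m n hm hmn => ?_⟩
  have h1 := hsum m n hm hmn
  have hm1 := hlog m hm
  have hn1 := hlog n (hm.trans hmn)
  have hinv : ∀ x : ℝ, Real.log 2 ≤ x → 0 ≤ 1 / x ∧ 1 / x ≤ 2 := fun x hx => by
    have : 0 < x := by linarith
    refine ⟨by positivity, ?_⟩
    rw [div_le_iff₀ this]; linarith
  have hBd : ∀ n : ℕ, 2 ≤ n → |B n / Real.log n| ≤ 2 * C := fun n hn => by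
    have h3 := hinv _ (hlog n hn)
    have h4 := hB n (by omega)
    rw [div_eq_mul_one_div, abs_mul, abs_of_nonneg h3.1]
    calc |B n| * (1 / Real.log n) ≤ C * 2 := by gcongr; exact h3.2
      _ = _ := by ring
  have h2 : (S n - S m) - (Real.log (Real.log n) - Real.log (Real.log m)) =
      (T n - T m) + B n / Real.log n - B m / Real.log m := by simp only [hT]; ring
  have h5 : |T n - T m| ≤ (C + 1) * 2 := h1.trans (by
    have := hinv _ hm1
    have := hinv _ hn1
    gcongr; linarith)
  have h6 := hBd n (by omega)
  have h7 := hBd m hm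
  show |(S n - S m) - (Real.log (Real.log n) - Real.log (Real.log m))| ≤ _
  rw [h2]
  rw [abs_le] at *
  constructor <;> linarith

lemma log_log_floor_bounds {x : ℝ} (hx : 2 ≤ x) :
    Real.log (Real.log ⌊x⌋₊) ≤ Real.log (Real.log x) ∧
      Real.log (Real.log x) ≤ Real.log (Real.log ⌊x⌋₊) + 2 := by
  have h1 := log_floor_bounds (show 1 ≤ x by linarith)
  have h2 : 2 ≤ ⌊x⌋₊ := Nat.le_floor (by exact_mod_cast hx)
  have h3 : Real.log 2 ≤ Real.log ⌊x⌋₊ := Real.log_le_log (by norm_num) (by exact_mod_cast h2)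
  have h4 := log_two_bounds
  refine ⟨Real.log_le_log (by linarith) h1.1, ?_⟩
  have h5 : Real.log x ≤ Real.log ⌊x⌋₊ * Real.exp 2 := by
    have h6 := Real.add_one_le_exp (2 : ℝ)
    nlinarith
  calc Real.log (Real.log x) ≤ Real.log (Real.log ⌊x⌋₊ * Real.exp 2) :=
        Real.log_le_log (by linarith) h5
    _ = _ := by rw [Real.log_mul (by linarith) (by positivity), Real.log_exp]

/-- Mertens' second theorem. -/
lemma exists_mertens_second : ∃ C : ℝ, 0 < C ∧ ∀ y z : ℝ, 2 ≤ y → y ≤ z →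
    |∑ p ∈ primesIoc y z, 1 / ((p : ℝ) - 1) -
      (Real.log (Real.log z) - Real.log (Real.log y))| ≤ C := by
  obtain ⟨C, hC, h⟩ := exists_mertens_second_nat
  refine ⟨C + 4, by linarith, fun y z hy hyz => ?_⟩
  have hy2 : 2 ≤ ⌊y⌋₊ := Nat.le_floor (by exact_mod_cast hy)
  have h1 := h ⌊y⌋₊ ⌊z⌋₊ hy2 (Nat.floor_mono hyz)
  have h2 := log_log_floor_bounds hy
  have h3 := log_log_floor_bounds (hy.trans hyz)
  have h4 := sum_primesIoc_union (show (0 : ℝ) ≤ y by linarith) hyz fun p => 1 / ((p : ℝ) - 1)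
  rw [primesIoc_floor z, primesIoc_floor y] at h4
  rw [h4] at h1
  rw [abs_le] at *
  constructor <;> linarith

lemma exists_log_window : ∃ C : ℝ, 1 ≤ C ∧ ∀ y z : ℝ, 0 < y → y ≤ z →
    ∑ p ∈ primesIoc y z, Real.log p / ((p : ℝ) - 1) ≤ Real.log (z / y) + C ∧
    (1 ≤ y → Real.log (z / y) - C ≤ ∑ p ∈ primesIoc y z, Real.log p / p) := by
  obtain ⟨C, hC, h⟩ := exists_mertens_first
  refine ⟨2 * C, by linarith, fun y z hy hyz => ?_⟩
  have hz : 0 < z := hy.trans_le hyz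
  have hle : ∀ y z, ∑ p ∈ primesIoc y z, Real.log p / p ≤
        ∑ p ∈ primesIoc y z, Real.log p / ((p : ℝ) - 1) := fun y z =>
      Finset.sum_le_sum fun p hp => log_div_le_log_div_sub_one (prime_of_mem hp)
  have hl : 0 ≤ Real.log (z / y) := Real.log_nonneg (by rwa [one_le_div hy])
  rcases le_or_gt 1 y with hy1 | hy1
  · have h1 := sum_primesIoc_union hy.le hyz fun p => Real.log p / ((p : ℝ) - 1)
    have h2 := sum_primesIoc_union hy.le hyz fun p => Real.log p / (p : ℝ)
    have h3 := h y hy1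
    have h4 := h z (hy1.trans hyz)
    have h5 := hle 0 y
    have h6 := hle 0 z
    rw [Real.log_div hz.ne' hy.ne']
    constructor
    · linarith
    · intro _; linarith
  · refine ⟨?_, fun h' => absurd h' (by linarith)⟩
    rcases le_or_gt 1 z with hz1 | hz1
    · have h4 := h z hz1
      have h5 : Real.log z ≤ Real.log (z / y) :=
        Real.log_le_log hz (by rw [le_div_iff₀ hy]; nlinarith)
      have h6 : ∑ p ∈ primesIoc y z, Real.log p / ((p : ℝ) - 1) ≤
          ∑ p ∈ primesIoc 0 z, Real.log p / ((p : ℝ) - 1) := by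
        rw [sum_primesIoc_union hy.le hyz]
        refine le_add_of_nonneg_left (Finset.sum_nonneg fun p hp => ?_)
        have := two_le_of_mem hp
        exact div_nonneg (Real.log_natCast_nonneg p) (by linarith)
      linarith
    · have : primesIoc y z = ∅ := by
        rw [Finset.eq_empty_iff_forall_notMem]
        intro p hp
        have := two_le_of_mem hp
        linarith [(mem_primesIoc.1 hp).2.2]
      rw [this, Finset.sum_empty]
      linarith

lemma exists_prod_window : ∃ C : ℝ, 0 < C ∧ ∀ y z : ℝ, 2 ≤ y → y ≤ z →
    ∏ p ∈ primesIoc y z, (1 + 1 / ((p : ℝ) - 1)) ≤ C * (Real.log z / Real.log y) := by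
  obtain ⟨C, hC, h⟩ := exists_mertens_second
  refine ⟨Real.exp C, Real.exp_pos _, fun y z hy hyz => ?_⟩
  have hy0 : 0 < Real.log y := Real.log_pos (by linarith)
  have hz0 : 0 < Real.log z := Real.log_pos (by linarith)
  calc ∏ p ∈ primesIoc y z, (1 + 1 / ((p : ℝ) - 1))
      ≤ ∏ p ∈ primesIoc y z, Real.exp (1 / ((p : ℝ) - 1)) := by
        refine Finset.prod_le_prod (fun p hp => ?_) fun p hp => ?_
        · have := two_le_of_mem hp
          have : 0 ≤ 1 / ((p : ℝ) - 1) := div_nonneg zero_le_one (by linarith)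
          linarith
        · linarith [Real.add_one_le_exp (1 / ((p : ℝ) - 1))]
    _ = Real.exp (∑ p ∈ primesIoc y z, 1 / ((p : ℝ) - 1)) := (Real.exp_sum _ _).symm
    _ ≤ Real.exp (C + (Real.log (Real.log z) - Real.log (Real.log y))) := by
        refine Real.exp_le_exp.2 ?_
        have := (abs_le.1 (h y z hy hyz)).2
        linarith
    _ = _ := by
        rw [Real.exp_add, Real.exp_sub, Real.exp_log hz0, Real.exp_log hy0]

lemma exists_block_end (m : ℕ) (hm : 2 ≤ m) :
    ∃ n : ℕ, Real.log 2 < ∑ p ∈ primesIoc m ((n + 1 : ℕ) : ℝ), 1 / ((p : ℝ) - 1) := by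
  obtain ⟨C, hC, h⟩ := exists_mertens_second
  have hm' : (2 : ℝ) ≤ m := by exact_mod_cast hm
  obtain ⟨n, hn⟩ := exists_nat_ge
    (max (m : ℝ) (Real.exp (Real.exp (C + 1 + Real.log (Real.log m)))))
  refine ⟨n, ?_⟩
  have hn1 : (m : ℝ) ≤ (n + 1 : ℕ) := by push_cast; linarith [le_max_left (m : ℝ) _ |>.trans hn]
  have hn2 : Real.exp (Real.exp (C + 1 + Real.log (Real.log m))) ≤ (n + 1 : ℕ) := by
    push_cast; linarith [le_max_right (m : ℝ) _ |>.trans hn]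
  have h1 := (abs_le.1 (h m _ hm' hn1)).1
  have h2 : Real.exp (C + 1 + Real.log (Real.log m)) ≤ Real.log (n + 1 : ℕ) := by
    rwa [Real.le_log_iff_exp_le (by positivity)]
  have h3 : C + 1 + Real.log (Real.log m) ≤ Real.log (Real.log (n + 1 : ℕ)) := by
    rwa [Real.le_log_iff_exp_le ((Real.exp_pos _).trans_le h2)]
  linarith [log_two_bounds.2]

/-- The largest `n` for which the reciprocal sum of the primes in `(m, n]` is at most `log 2`. -/
noncomputable def blockEnd (m : ℕ) : ℕ :=
  sInf {n : ℕ | Real.log 2 < ∑ p ∈ primesIoc m ((n + 1 : ℕ) : ℝ), 1 / ((p : ℝ) - 1)}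

/-- Endpoints of blocks of primes of reciprocal sum about `log 2`. -/
noncomputable def blk : ℕ → ℕ
  | 0 => 2
  | j + 1 => blockEnd (blk j)

noncomputable def blockPrimes (j : ℕ) : Finset ℕ := primesIoc (blk j) (blk (j + 1))

lemma primesIoc_of_le {y z : ℝ} (h : z ≤ y) : primesIoc y z = ∅ := by
  rw [Finset.eq_empty_iff_forall_notMem]
  intro p hp
  have := mem_primesIoc.1 hp
  linarith

lemma lt_blockEnd {m : ℕ} (hm : 2 ≤ m) : m < blockEnd m := by
  have h : Real.log 2 < ∑ p ∈ primesIoc m ((blockEnd m + 1 : ℕ) : ℝ), 1 / ((p : ℝ) - 1) :=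
    Nat.sInf_mem (exists_block_end m hm)
  by_contra! hle
  have hsub : primesIoc m ((blockEnd m + 1 : ℕ) : ℝ) ⊆ {m + 1} := by
    intro p hp
    rw [mem_primesIoc] at hp
    have h1 : m < p := by exact_mod_cast hp.2.1
    have h2 : p ≤ blockEnd m + 1 := by exact_mod_cast hp.2.2
    simp; omega
  have h2 : ∑ p ∈ primesIoc m ((blockEnd m + 1 : ℕ) : ℝ), 1 / ((p : ℝ) - 1) ≤
      ∑ p ∈ ({m + 1} : Finset ℕ), 1 / ((p : ℝ) - 1) := by
    refine Finset.sum_le_sum_of_subset_of_nonneg hsub fun i hi _ => ?_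
    simp at hi; subst hi; simp
  have h3 : (2 : ℝ) ≤ m := by exact_mod_cast hm
  have h4 : (1 : ℝ) / m ≤ 1 / 2 := one_div_le_one_div_of_le (by norm_num) h3
  simp only [Finset.sum_singleton, Nat.cast_add, Nat.cast_one, add_sub_cancel_right] at h2 h
  linarith [log_two_bounds.1]

lemma sum_blockEnd_bounds {m : ℕ} (hm : 2 ≤ m) :
    Real.log 2 - 1 / blockEnd m ≤ ∑ p ∈ primesIoc m (blockEnd m), 1 / ((p : ℝ) - 1) ∧
      ∑ p ∈ primesIoc m (blockEnd m), 1 / ((p : ℝ) - 1) ≤ Real.log 2 := by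
  have h : Real.log 2 < ∑ p ∈ primesIoc m ((blockEnd m + 1 : ℕ) : ℝ), 1 / ((p : ℝ) - 1) :=
    Nat.sInf_mem (exists_block_end m hm)
  have hlt := lt_blockEnd hm
  constructor
  · have h1 := sum_primesIoc_union (Nat.cast_nonneg m) (show (m : ℝ) ≤ (blockEnd m + 1 : ℕ) by
      exact_mod_cast (by omega)) fun p => 1 / ((p : ℝ) - 1)
    have h2 := sum_primesIoc_union (Nat.cast_nonneg m) (show (m : ℝ) ≤ (blockEnd m : ℕ) by
      exact_mod_cast hlt.le) fun p => 1 / ((p : ℝ) - 1)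
    rw [primesIoc_succ_sum] at h1
    have h3 : (if (blockEnd m + 1).Prime then 1 / (((blockEnd m + 1 : ℕ) : ℝ) - 1) else 0) ≤
        1 / (blockEnd m : ℝ) := by
      split_ifs
      · push_cast; simp
      · positivity
    linarith
  · have h2 : blockEnd m - 1 ∉
        {n : ℕ | Real.log 2 < ∑ p ∈ primesIoc m ((n + 1 : ℕ) : ℝ), 1 / ((p : ℝ) - 1)} :=
      Nat.notMem_of_lt_sInf (show blockEnd m - 1 < blockEnd m by omega)
    simp only [Set.mem_ofPred_eq, not_lt] at h2
    rwa [Nat.sub_add_cancel (by omega)] at h2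

lemma two_le_blk (j : ℕ) : 2 ≤ blk j := by
  induction j with
  | zero => exact le_rfl
  | succ j ih => exact ih.trans (lt_blockEnd ih).le

lemma blk_strictMono : StrictMono blk :=
  strictMono_nat_of_lt_succ fun j => lt_blockEnd (two_le_blk j)

lemma sum_blockPrimes_le (j : ℕ) : ∑ p ∈ blockPrimes j, 1 / ((p : ℝ) - 1) ≤ Real.log 2 :=
  (sum_blockEnd_bounds (two_le_blk j)).2

lemma le_sum_blockPrimes (j : ℕ) :
    Real.log 2 - 1 / blk (j + 1) ≤ ∑ p ∈ blockPrimes j, 1 / ((p : ℝ) - 1) :=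
  (sum_blockEnd_bounds (two_le_blk j)).1

lemma blk_mono_cast {i j : ℕ} (h : i ≤ j) : (blk i : ℝ) ≤ blk j := by
  exact_mod_cast blk_strictMono.monotone h

lemma two_le_blk_cast (j : ℕ) : (2 : ℝ) ≤ blk j := by exact_mod_cast two_le_blk j

lemma log_blk_pos (j : ℕ) : 0 < Real.log (blk j) := Real.log_pos (by linarith [two_le_blk_cast j])

lemma sum_primesIoc_blk (f : ℕ → ℝ) (j : ℕ) :
    ∑ p ∈ primesIoc 2 (blk j), f p = ∑ i ∈ Finset.range j, ∑ p ∈ blockPrimes i, f p := by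
  induction j with
  | zero => simp [blk, primesIoc_of_le]
  | succ j ih =>
    rw [Finset.sum_range_succ, ← ih,
      sum_primesIoc_union (two_le_blk_cast j) (blk_mono_cast (Nat.le_succ j))]
    rfl

lemma exists_log_blk_bounds : ∃ c C : ℝ, 0 < c ∧ 0 < C ∧ ∀ j : ℕ,
    c * 2 ^ j ≤ Real.log (blk j) ∧ Real.log (blk j) ≤ C * 2 ^ j := by
  obtain ⟨C, hC, h⟩ := exists_mertens_second
  have hl2 := log_two_bounds
  have hs : ∀ j, Real.log (Real.log (blk j)) ≤
      ∑ i ∈ Finset.range j, ∑ p ∈ blockPrimes i, 1 / ((p : ℝ) - 1) + C + Real.log (Real.log 2) ∧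
      ∑ i ∈ Finset.range j, ∑ p ∈ blockPrimes i, 1 / ((p : ℝ) - 1) - C + Real.log (Real.log 2) ≤
        Real.log (Real.log (blk j)) := by
    intro j
    have h1 := abs_le.1 (h 2 (blk j) le_rfl (two_le_blk_cast j))
    rw [sum_primesIoc_blk] at h1
    constructor <;> linarith
  set D := C - Real.log (Real.log 2) with hD
  have h3 : ∀ j : ℕ, Real.exp (-D) * Real.exp 0.3 ^ j ≤ blk j := by
    intro j
    have h1 : (j : ℝ) * 0.3 ≤ ∑ i ∈ Finset.range j, ∑ p ∈ blockPrimes i, 1 / ((p : ℝ) - 1) := by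
      rw [← nsmul_eq_mul, ← Finset.card_range j, ← Finset.sum_const, Finset.card_range]
      refine Finset.sum_le_sum fun i _ => ?_
      have h4 := le_sum_blockPrimes i
      have h5 : (3 : ℝ) ≤ blk (i + 1) := by
        have h6 : blk i < blk (i + 1) := blk_strictMono (Nat.lt_succ_self i)
        exact_mod_cast (show 3 ≤ blk (i + 1) by have := two_le_blk i; omega)
      have h6 : (1 : ℝ) / blk (i + 1) ≤ 1 / 3 := one_div_le_one_div_of_le (by norm_num) h5
      norm_num at *
      linarith
    have h2 : (j : ℝ) * 0.3 - D ≤ Real.log (Real.log (blk j)) := by linarith [(hs j).2]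
    rw [Real.le_log_iff_exp_le (log_blk_pos j)] at h2
    have h4 : Real.log (blk j) ≤ blk j := Real.log_le_self (Nat.cast_nonneg _)
    calc Real.exp (-D) * Real.exp 0.3 ^ j = Real.exp (j * 0.3 - D) := by
          rw [← Real.exp_nat_mul, ← Real.exp_add]; ring_nf
      _ ≤ _ := h2.trans h4
  obtain ⟨G, hG, hGs⟩ := exists_sum_le_of_geom (β := Real.exp (-0.3)) (Real.exp_pos _).le
    (by rw [Real.exp_lt_one_iff]; norm_num)
  have h4 : ∀ s : Finset ℕ, ∑ i ∈ s, (1 : ℝ) / blk (i + 1) ≤ Real.exp D * G := by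
    intro s
    refine le_trans (Finset.sum_le_sum fun i _ => ?_)
      ((Finset.mul_sum _ _ _).symm.le.trans (mul_le_mul_of_nonneg_left (hGs s) (Real.exp_pos D).le))
    have h5 := (h3 i).trans (blk_mono_cast (Nat.le_succ i))
    have hi : (0 : ℝ) ≤ i := Nat.cast_nonneg _
    calc (1 : ℝ) / blk (i + 1) ≤ 1 / (Real.exp (-D) * Real.exp 0.3 ^ i) :=
          one_div_le_one_div_of_le (by positivity) h5
      _ = Real.exp D * (1 * Real.exp (-0.3) ^ i) := by
          rw [Real.exp_neg, Real.exp_neg, inv_pow]; field_simp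
      _ ≤ _ := by
        have : (1 : ℝ) ≤ ((i : ℝ) + 1) ^ 2 := by nlinarith
        gcongr
  have h2pow : ∀ j : ℕ, Real.exp (j * Real.log 2) = 2 ^ j := fun j => by
    rw [Real.exp_nat_mul, Real.exp_log (by norm_num)]
  refine ⟨Real.exp (-D - Real.exp D * G), Real.exp (C + Real.log (Real.log 2)), Real.exp_pos _,
    Real.exp_pos _, fun j => ⟨?_, ?_⟩⟩
  · rw [← h2pow, ← Real.exp_add, ← Real.le_log_iff_exp_le (log_blk_pos j)]
    have h5 : (j : ℝ) * Real.log 2 - Real.exp D * G ≤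
        ∑ i ∈ Finset.range j, ∑ p ∈ blockPrimes i, 1 / ((p : ℝ) - 1) := by
      have h6 := Finset.sum_le_sum fun i (_ : i ∈ Finset.range j) => le_sum_blockPrimes i
      rw [Finset.sum_sub_distrib, Finset.sum_const, Finset.card_range, nsmul_eq_mul] at h6
      linarith [h4 (Finset.range j)]
    linarith [(hs j).2]
  · rw [← h2pow, ← Real.exp_add, ← Real.log_le_iff_le_exp (log_blk_pos j)]
    have h5 : ∑ i ∈ Finset.range j, ∑ p ∈ blockPrimes i, 1 / ((p : ℝ) - 1) ≤ j * Real.log 2 := by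
      have h6 := Finset.sum_le_sum fun i (_ : i ∈ Finset.range j) => sum_blockPrimes_le i
      rwa [Finset.sum_const, Finset.card_range, nsmul_eq_mul] at h6
    linarith [(hs j).1]

section Coarse
variable {ι : Type*} [DecidableEq ι]

lemma mem_blockUnion {E : ℕ → Finset ι} {n : ℕ} {x : ι} :
    x ∈ blockUnion E n ↔ ∃ i < n, x ∈ E i := by
  simp [blockUnion]

lemma blockUnion_add (E : ℕ → Finset ι) (j m : ℕ) :
    blockUnion E (j + m) = blockUnion E j ∪ blockUnion (fun i => E (j + i)) m := by
  induction m with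
  | zero => simp [blockUnion_zero]
  | succ m ih => rw [← add_assoc, blockUnion_succ, ih, blockUnion_succ, Finset.union_assoc]

lemma blockUnion_reverse (E : ℕ → Finset ι) {j r : ℕ} (h : r ≤ j) :
    blockUnion E j = blockUnion E (j - r) ∪ blockUnion (fun i => E (j - 1 - i)) r := by
  ext x
  simp only [Finset.mem_union, mem_blockUnion]
  constructor
  · rintro ⟨i, hi, hx⟩
    by_cases h2 : i < j - r
    · exact Or.inl ⟨i, h2, hx⟩
    · refine Or.inr ⟨j - 1 - i, by omega, ?_⟩
      rwa [show j - 1 - (j - 1 - i) = i by omega]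
  · rintro (⟨i, hi, hx⟩ | ⟨i, hi, hx⟩)
    · exact ⟨i, by omega, hx⟩
    · exact ⟨j - 1 - i, by omega, hx⟩

/-- The walk constraint on the block counts of `s`, with no condition on the size of `s`. -/
def Obeys (E : ℕ → Finset ι) (c : ℕ → ℕ → Prop) (n : ℕ) (s : Finset ι) : Prop :=
  ∀ r, 1 ≤ r → r ≤ n → c r (s ∩ blockUnion E r).card

lemma sum_obeys_le {E : ℕ → Finset ι} (c : ℕ → ℕ → Prop) {w : ι → ℝ} (hw : ∀ i, 0 ≤ w i)
    {t : ℝ} {n : ℕ} (hE : ∀ i j, i < j → j < n → Disjoint (E i) (E j))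
    (ht : ∀ i < n, ∑ x ∈ E i, w x ≤ t) {B : ℝ}
    (hB : ∀ S : Finset ℕ, ∑ k ∈ S, t ^ k * walk c n k ≤ B) :
    ∑ s ∈ (blockUnion E n).powerset with Obeys E c n s, ∏ i ∈ s, w i ≤ B := by
  refine le_trans ?_ (hB (Finset.range ((blockUnion E n).card + 1)))
  rw [← Finset.sum_fiberwise_of_maps_to (g := Finset.card)
    (t := Finset.range ((blockUnion E n).card + 1))]
  · refine Finset.sum_le_sum fun k _ => le_trans (le_of_eq ?_) (sum_walkSets_le c hw n k hE ht)
    refine Finset.sum_congr ?_ fun _ _ => rfl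
    ext s
    rw [Finset.mem_filter, Finset.mem_filter, walkSets, Finset.mem_filter, and_assoc,
      and_comm (b := s.card = k)]
    rfl
  · intro s hs
    rw [Finset.mem_filter, Finset.mem_powerset] at hs
    exact Finset.mem_range.2 (Nat.lt_succ_of_le (Finset.card_le_card hs.1))

/-- The cheapest cover of the weighted divisor windows attached to `a`. -/
noncomputable def coverCost (β : ℝ) (l : ι → ℝ) (a : Finset ι) : ℝ :=
  a.powerset.inf' ⟨∅, Finset.empty_mem_powerset a⟩
    fun c => 2 ^ (a \ c).card * (β + ∑ r ∈ c, l r)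

lemma coverCost_le {β : ℝ} {l : ι → ℝ} {a c : Finset ι} (h : c ⊆ a) :
    coverCost β l a ≤ 2 ^ (a \ c).card * (β + ∑ r ∈ c, l r) :=
  Finset.inf'_le (fun c => 2 ^ (a \ c).card * (β + ∑ r ∈ c, l r)) (Finset.mem_powerset.2 h)

lemma le_coverCost {β : ℝ} {l : ι → ℝ} {a : Finset ι} {X : ℝ}
    (h : ∀ c ⊆ a, X ≤ 2 ^ (a \ c).card * (β + ∑ r ∈ c, l r)) : X ≤ coverCost β l a :=
  Finset.le_inf' _ _ fun c hc => h c (Finset.mem_powerset.1 hc)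

lemma coverCost_nonneg {β : ℝ} (hβ : 0 ≤ β) {l : ι → ℝ} (hl : ∀ i, 0 ≤ l i) (a : Finset ι) :
    0 ≤ coverCost β l a :=
  le_coverCost fun c _ => mul_nonneg (by positivity)
    (add_nonneg hβ (Finset.sum_nonneg fun i _ => hl i))

lemma coverCost_insert_le {β : ℝ} {l : ι → ℝ} {a : Finset ι} {r : ι} (hr : r ∉ a) :
    coverCost β l (insert r a) ≤ 2 * coverCost β l a := by
  rw [← div_le_iff₀' (by norm_num : (0 : ℝ) < 2)]
  refine le_coverCost fun c hc => ?_
  rw [div_le_iff₀' (by norm_num : (0 : ℝ) < 2)]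
  refine (coverCost_le (hc.trans (Finset.subset_insert r a))).trans (le_of_eq ?_)
  rw [Finset.insert_sdiff_of_notMem _ (fun h => hr (hc h)),
    Finset.card_insert_of_notMem (fun h => hr (Finset.mem_sdiff.1 h).1)]
  ring

/-- The ballot part of a set, weighted by its total logarithm. -/
lemma sum_ballot_log_le {E : ℕ → Finset ι} {w l : ι → ℝ} (hw : ∀ i, 0 ≤ w i) (hl : ∀ i, 0 ≤ l i)
    {t : ℝ} {n : ℕ} (hE : ∀ i j, i < j → j < n → Disjoint (E i) (E j))
    (ht : ∀ i < n, ∑ x ∈ E i, w x ≤ t) {B : ℝ}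
    (hB : ∀ S : Finset ℕ, ∑ k ∈ S, t ^ k * weakBallot n k ≤ B) {β Λ : ℝ} (hβ : 0 ≤ β)
    (hΛ : ∑ r ∈ blockUnion E n, w r * l r ≤ Λ) :
    ∑ s ∈ (blockUnion E n).powerset with Obeys E (fun r k => r ≤ k) n s,
      (∏ i ∈ s, w i) * (β + ∑ r ∈ s, l r) ≤ (β + Λ) * B := by
  have hweak := sum_obeys_le (fun r k => r ≤ k + 1) hw hE ht hB
  have hB0 : 0 ≤ B := (sum_powerset_card_nonneg hw _).trans hweak
  simp only [mul_add, Finset.sum_add_distrib, add_mul]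
  refine add_le_add ?_ ?_
  · rw [← Finset.sum_mul, mul_comm]
    refine mul_le_mul_of_nonneg_left (le_trans ?_ hweak) hβ
    refine Finset.sum_le_sum_of_subset_of_nonneg ?_
      fun _ _ _ => Finset.prod_nonneg fun i _ => hw i
    exact Finset.monotone_filter_right _ fun s _ hs r h1 h2 => (hs r h1 h2).trans (Nat.le_succ _)
  · have h1 : ∑ s ∈ (blockUnion E n).powerset with Obeys E (fun r k => r ≤ k) n s,
        (∏ i ∈ s, w i) * ∑ r ∈ s, l r = ∑ s ∈ (blockUnion E n).powerset, ∑ r ∈ s,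
          if Obeys E (fun r k => r ≤ k) n s then (∏ i ∈ s, w i) * l r else 0 := by
      rw [Finset.sum_filter]
      refine Finset.sum_congr rfl fun s _ => ?_
      split_ifs
      · rw [Finset.mul_sum]
      · simp
    rw [h1, sum_powerset_sum_mem]
    refine le_trans ?_ (mul_le_mul_of_nonneg_right hΛ hB0)
    rw [Finset.sum_mul]
    refine Finset.sum_le_sum fun r _ => ?_
    refine le_trans ?_ (mul_le_mul_of_nonneg_left hweak (mul_nonneg (hw r) (hl r)))
    rw [Finset.sum_filter, Finset.mul_sum]
    refine le_trans ?_ (Finset.sum_le_sum_of_subset_of_nonneg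
      (Finset.powerset_mono.2 (Finset.erase_subset r _)) ?_)
    · refine Finset.sum_le_sum fun s hs => ?_
      have hrs : r ∉ s := fun h => by
        have := Finset.mem_powerset.1 hs h
        simp at this
      have hp : 0 ≤ ∏ i ∈ s, w i := Finset.prod_nonneg fun i _ => hw i
      split_ifs with h2 h3
      · rw [Finset.prod_insert hrs]
        exact le_of_eq (by ring)
      · refine absurd (fun q hq1 hq2 => (h2 q hq1 hq2).trans ?_) h3
        refine le_trans (Finset.card_le_card ?_) (Finset.card_insert_le r (s ∩ blockUnion E q))
        intro x hx
        simp only [Finset.mem_inter, Finset.mem_insert] at hx ⊢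
        tauto
      · exact mul_nonneg (mul_nonneg (hw r) (hl r)) hp
      · simp
    · intro s _ _
      have hp : 0 ≤ ∏ i ∈ s, w i := Finset.prod_nonneg fun i _ => hw i
      have := mul_nonneg (hw r) (hl r)
      split_ifs <;> positivity

/-- Splitting at the last maximum of the block-count walk. -/
lemma exists_split (E : ℕ → Finset ι) (N : ℕ) (a : Finset ι) :
    ∃ j ≤ N, Obeys (fun i => E (j - 1 - i)) (fun r k => r ≤ k) j (a ∩ blockUnion E j) ∧
      Obeys (fun i => E (j + i)) (fun r k => k ≤ r) (N - j) (a \ blockUnion E j) := by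
  obtain ⟨j, hj, hmax⟩ := Finset.exists_max_image (Finset.range (N + 1))
    (fun i => ((a ∩ blockUnion E i).card : ℤ) - i) ⟨0, by simp⟩
  rw [Finset.mem_range] at hj
  refine ⟨j, by omega, fun r h1 h2 => ?_, fun r h1 h2 => ?_⟩
  · have h := hmax (j - r) (Finset.mem_range.2 (by omega))
    have hc : (a ∩ blockUnion E j).card ≤ (a ∩ blockUnion E (j - r)).card +
        ((a ∩ blockUnion E j) ∩ blockUnion (fun i => E (j - 1 - i)) r).card := by
      refine le_trans (Finset.card_le_card ?_) (Finset.card_union_le _ _)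
      intro x hx
      have := blockUnion_reverse E h2
      have hx2 := Finset.mem_inter.1 hx
      have hx3 := hx2.2
      rw [this] at hx3
      simp only [Finset.mem_union, Finset.mem_inter] at hx3 ⊢
      tauto
    have : ((j - r : ℕ) : ℤ) = j - r := by omega
    omega
  · have h := hmax (j + r) (Finset.mem_range.2 (by omega))
    have hc : (a ∩ blockUnion E j).card +
        ((a \ blockUnion E j) ∩ blockUnion (fun i => E (j + i)) r).card ≤
        (a ∩ blockUnion E (j + r)).card := by
      rw [← Finset.card_union_of_disjoint]
      · refine Finset.card_le_card fun x hx => ?_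
        rw [blockUnion_add]
        simp only [Finset.mem_union, Finset.mem_inter, Finset.mem_sdiff] at hx ⊢
        tauto
      · rw [Finset.disjoint_left]
        intro x hx hx2
        simp only [Finset.mem_inter, Finset.mem_sdiff] at hx hx2
        tauto
    push_cast at h
    omega

end Coarse

theorem exists_sum_coverCost_le : ∃ C > 0, ∀ {ι : Type} [DecidableEq ι]
    (E : ℕ → Finset ι) (w l : ι → ℝ) (N : ℕ)
    (β D : ℝ), (∀ i, 0 ≤ w i) → (∀ i, 0 ≤ l i) → 0 ≤ β → β ≤ D →
    (∀ i j, i < j → j < N → Disjoint (E i) (E j)) →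
    (∀ i < N, ∑ x ∈ E i, w x ≤ Real.log 2) →
    (∀ i ≤ N, ∑ r ∈ blockUnion E i, w r * l r ≤ D * 2 ^ i) →
    ∑ a ∈ (blockUnion E N).powerset, (∏ i ∈ a, w i) * coverCost β l a ≤
      C * (D * ((2 * Real.exp 1 * Real.log 2) ^ N * kap N)) := by
  obtain ⟨C1, hC1, hwb⟩ := exists_sum_weakBallot_le
  obtain ⟨C2, hC2, hpk⟩ := exists_sum_parking_le
  obtain ⟨C3, hC3, hcv⟩ := exists_kap_conv
  refine ⟨2 * C1 * C2 * C3, by positivity, ?_⟩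
  intro ι _ E w l N β D hw hl hβ hβD hE ht hlog
  have hD : 0 ≤ D := hβ.trans hβD
  have hpw : ∀ s : Finset ι, 0 ≤ ∏ i ∈ s, w i := fun s => Finset.prod_nonneg fun i _ => hw i
  have ht0 : 0 < Real.log 2 := Real.log_pos (by norm_num)
  set P : ℕ → Finset ι → Prop := fun j => Obeys (fun i => E (j - 1 - i)) (fun r k => r ≤ k) j
  set F : ℕ → Finset ι → Prop := fun j => Obeys (fun i => E (j + i)) (fun r k => k ≤ r) (N - j)
  set f : ℕ → Finset ι → ℝ := fun j a =>
    (if P j (a ∩ blockUnion E j) then (∏ i ∈ a ∩ blockUnion E j, w i) *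
      (β + ∑ r ∈ a ∩ blockUnion E j, l r) else 0) *
    (if F j (a \ blockUnion E j) then ∏ i ∈ a \ blockUnion E j, 2 * w i else 0) with hf
  have hf0 : ∀ j a, 0 ≤ f j a := by
    intro j a
    refine mul_nonneg ?_ ?_
    · split_ifs
      · exact mul_nonneg (hpw _) (add_nonneg hβ (Finset.sum_nonneg fun i _ => hl i))
      · exact le_rfl
    · split_ifs
      · exact Finset.prod_nonneg fun i _ => mul_nonneg zero_le_two (hw i)
      · exact le_rfl
  have hstep : ∀ a, (∏ i ∈ a, w i) * coverCost β l a ≤ ∑ j ∈ Finset.range (N + 1), f j a := by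
    intro a
    obtain ⟨j, hj, h1, h2⟩ := exists_split E N a
    refine le_trans ?_ (Finset.single_le_sum (fun j _ => hf0 j a)
      (Finset.mem_range.2 (Nat.lt_succ_of_le hj)))
    simp only [hf]
    rw [if_pos h1, if_pos h2]
    refine (mul_le_mul_of_nonneg_left
      (coverCost_le (Finset.inter_subset_left (s₂ := blockUnion E j))) (hpw a)).trans (le_of_eq ?_)
    have h3 : ∏ i ∈ a, w i = (∏ i ∈ a ∩ blockUnion E j, w i) * ∏ i ∈ a \ blockUnion E j, w i :=
      (Finset.prod_inter_mul_prod_sdiff a (blockUnion E j) w).symm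
    rw [Finset.prod_mul_distrib, Finset.prod_const, h3, Finset.sdiff_inter_self_left]
    ring
  have hone : ∀ j ∈ Finset.range (N + 1), ∑ a ∈ (blockUnion E N).powerset, f j a ≤
      (2 * C1 * C2) * (D * (2 * Real.exp 1 * Real.log 2) ^ N) * (kap j * kap (N - j)) := by
    intro j hj
    have hjN : j ≤ N := Nat.lt_succ_iff.1 (Finset.mem_range.1 hj)
    have hsplit : blockUnion E N = blockUnion E j ∪ blockUnion (fun i => E (j + i)) (N - j) := by
      rw [← blockUnion_add, Nat.add_sub_cancel' hjN]
    have hdis : Disjoint (blockUnion E j) (blockUnion (fun i => E (j + i)) (N - j)) := by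
      rw [Finset.disjoint_left]
      intro x hx hx2
      obtain ⟨i, hi, hx⟩ := mem_blockUnion.1 hx
      obtain ⟨i', hi', hx2⟩ := mem_blockUnion.1 hx2
      exact Finset.disjoint_left.1 (hE i (j + i') (by omega) (by omega)) hx hx2
    have hrev : blockUnion (fun i => E (j - 1 - i)) j = blockUnion E j := by
      have := blockUnion_reverse E (le_refl j)
      rw [Nat.sub_self, blockUnion_zero, Finset.empty_union] at this
      exact this.symm
    rw [hsplit, sum_powerset_union hdis]
    have hcalc : ∀ a ∈ (blockUnion E j).powerset,
        ∀ b ∈ (blockUnion (fun i => E (j + i)) (N - j)).powerset, f j (a ∪ b) =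
        (if P j a then (∏ i ∈ a, w i) * (β + ∑ r ∈ a, l r) else 0) *
        (if F j b then ∏ i ∈ b, 2 * w i else 0) := by
      intro a ha b hb
      rw [Finset.mem_powerset] at ha hb
      have e1 : (a ∪ b) ∩ blockUnion E j = a := by
        ext x
        have h1 := @ha x
        have h2 := @hb x
        have h3 : x ∈ blockUnion E j → x ∉ blockUnion (fun i => E (j + i)) (N - j) :=
          fun h => Finset.disjoint_left.1 hdis h
        simp only [Finset.mem_inter, Finset.mem_union]
        tauto
      have e2 : (a ∪ b) \ blockUnion E j = b := by
        ext x
        have h1 := @ha x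
        have h2 := @hb x
        have h3 : x ∈ blockUnion E j → x ∉ blockUnion (fun i => E (j + i)) (N - j) :=
          fun h => Finset.disjoint_left.1 hdis h
        simp only [Finset.mem_sdiff, Finset.mem_union]
        tauto
      simp only [hf]
      rw [e1, e2]
    rw [Finset.sum_congr rfl fun a ha => Finset.sum_congr rfl fun b hb => hcalc a ha b hb,
      ← Finset.sum_mul_sum, ← Finset.sum_filter, ← Finset.sum_filter]
    have hpast : ∑ a ∈ (blockUnion E j).powerset with P j a, (∏ i ∈ a, w i) * (β + ∑ r ∈ a, l r) ≤
        (β + D * 2 ^ j) * (C1 * ((Real.exp 1 * Real.log 2) ^ j * kap j)) := by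
      rw [← hrev]
      refine sum_ballot_log_le hw hl ?_ ?_ (fun S => hwb S j) hβ ?_
      · intro i i' h1 h2
        exact (hE _ _ (by omega) (by omega)).symm
      · intro i hi
        exact ht _ (by omega)
      · rw [hrev]
        exact hlog j hjN
    have hfut : ∑ b ∈ (blockUnion (fun i => E (j + i)) (N - j)).powerset with F j b,
        ∏ i ∈ b, 2 * w i ≤ C2 * ((2 * Real.exp 1 * Real.log 2) ^ (N - j) * kap (N - j)) := by
      refine sum_obeys_le (fun r k => k ≤ r) (fun i => mul_nonneg zero_le_two (hw i))
          (t := 2 * Real.log 2)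
        ?_ ?_ (fun S => hpk S (N - j))
      · intro i i' h1 h2
        exact hE _ _ (by omega) (by omega)
      · intro i hi
        rw [← Finset.mul_sum]
        exact mul_le_mul_of_nonneg_left (ht _ (by omega)) zero_le_two
    have hfut0 : 0 ≤ ∑ b ∈ (blockUnion (fun i => E (j + i)) (N - j)).powerset with F j b,
        ∏ i ∈ b, 2 * w i :=
      Finset.sum_nonneg fun _ _ => Finset.prod_nonneg fun i _ => mul_nonneg zero_le_two (hw i)
    have hk := kap_pos j
    have hk2 := kap_pos (N - j)
    have hβ2 : β + D * 2 ^ j ≤ 2 * D * 2 ^ j := by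
      have : D * 1 ≤ D * 2 ^ j := mul_le_mul_of_nonneg_left (one_le_pow₀ (by norm_num)) hD
      linarith
    calc _ ≤ ((2 * D * 2 ^ j) * (C1 * ((Real.exp 1 * Real.log 2) ^ j * kap j))) *
          (C2 * ((2 * Real.exp 1 * Real.log 2) ^ (N - j) * kap (N - j))) := by
          refine mul_le_mul (hpast.trans ?_) hfut hfut0 (by positivity)
          exact mul_le_mul_of_nonneg_right hβ2 (by positivity)
      _ = _ := by
          have : (2 * Real.exp 1 * Real.log 2) ^ N = 2 ^ j * (Real.exp 1 * Real.log 2) ^ j *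
              (2 * Real.exp 1 * Real.log 2) ^ (N - j) := by
            rw [← mul_pow, ← mul_assoc, ← pow_add, Nat.add_sub_cancel' hjN]
          rw [this]
          ring
  calc _ ≤ ∑ a ∈ (blockUnion E N).powerset, ∑ j ∈ Finset.range (N + 1), f j a :=
        Finset.sum_le_sum fun a _ => hstep a
    _ = ∑ j ∈ Finset.range (N + 1), ∑ a ∈ (blockUnion E N).powerset, f j a := Finset.sum_comm
    _ ≤ _ := Finset.sum_le_sum hone
    _ = (2 * C1 * C2) * (D * (2 * Real.exp 1 * Real.log 2) ^ N) *
        ∑ j ∈ Finset.range (N + 1), kap j * kap (N - j) := by rw [Finset.mul_sum]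
    _ ≤ (2 * C1 * C2) * (D * (2 * Real.exp 1 * Real.log 2) ^ N) * (C3 * kap N) :=
        mul_le_mul_of_nonneg_left (hcv N) (by positivity)
    _ = _ := by ring

lemma sum_log_primeFactors_le {n : ℕ} (hn : n ≠ 0) :
    ∑ r ∈ n.primeFactors, Real.log r ≤ Real.log n := by
  rw [← Real.log_prod (fun r hr => by exact_mod_cast (Nat.prime_of_mem_primeFactors hr).ne_zero)]
  rw [← Nat.cast_prod]
  refine Real.log_le_log ?_ ?_
  · exact_mod_cast Nat.pos_of_ne_zero (Finset.prod_ne_zero_iff.2 fun r hr =>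
      (Nat.prime_of_mem_primeFactors hr).ne_zero)
  · exact_mod_cast Nat.le_of_dvd (Nat.pos_of_ne_zero hn) (Nat.prod_primeFactors_dvd n)

lemma exists_sum_log_sub_log_rad_le : ∃ C > 0, ∀ x : ℝ, 1 ≤ x →
    ∑ n ∈ Finset.Icc 1 ⌊x⌋₊, (Real.log x - ∑ r ∈ n.primeFactors, Real.log r) ≤ C * x := by
  obtain ⟨C, hC, hM⟩ := exists_mertens_first
  have hl4 : 0 < Real.log 4 := Real.log_pos (by norm_num)
  refine ⟨C + Real.log 4, by linarith, fun x hx => ?_⟩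
  rw [Finset.sum_sub_distrib, Finset.sum_const, Nat.card_Icc, nsmul_eq_mul, Nat.add_sub_cancel]
  have h1 : ∑ n ∈ Finset.Icc 1 ⌊x⌋₊, ∑ r ∈ n.primeFactors, Real.log r =
      ∑ r ∈ primesIoc 0 x, Real.log r * (⌊x⌋₊ / r : ℕ) := by
    rw [Finset.sum_comm' (t' := primesIoc 0 x)
      (s' := fun r => (Finset.Ioc 0 ⌊x⌋₊).filter fun n => r ∣ n)]
    · refine Finset.sum_congr rfl fun r _ => ?_
      rw [Finset.sum_const, Nat.Ioc_filter_dvd_card_eq_div, nsmul_eq_mul, mul_comm]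
    · intro n r
      simp only [Finset.mem_Icc, Nat.mem_primeFactors, Finset.mem_filter, Finset.mem_Ioc,
        mem_primesIoc]
      constructor
      · rintro ⟨⟨h1, h2⟩, h3, h4, h5⟩
        refine ⟨⟨⟨h1, h2⟩, h4⟩, h3, by exact_mod_cast h3.pos, ?_⟩
        exact (Nat.le_floor_iff (by linarith)).1 ((Nat.le_of_dvd h1 h4).trans h2)
      · rintro ⟨⟨⟨h1, h2⟩, h4⟩, h3, h5⟩
        exact ⟨⟨h1, h2⟩, h3, h4, by omega⟩
  rw [h1]
  have h2 : ∑ r ∈ primesIoc 0 x, (Real.log r / r * x - Real.log r) ≤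
      ∑ r ∈ primesIoc 0 x, Real.log r * (⌊x⌋₊ / r : ℕ) := by
    refine Finset.sum_le_sum fun r hr => ?_
    have hr0 : 0 < (r : ℝ) := by exact_mod_cast (prime_of_mem hr).pos
    have hlr : 0 ≤ Real.log r := Real.log_natCast_nonneg r
    have h3 : x / r - 1 ≤ (⌊x⌋₊ / r : ℕ) := by
      rw [← Nat.floor_div_natCast]
      exact (Nat.sub_one_lt_floor _).le
    calc Real.log r / r * x - Real.log r = Real.log r * (x / r - 1) := by ring
      _ ≤ _ := mul_le_mul_of_nonneg_left h3 hlr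
  rw [Finset.sum_sub_distrib, ← Finset.sum_mul] at h2
  have h3 := (hM x hx).1
  have h4 := sum_primesIoc_log_le (show 0 ≤ x by linarith)
  have h5 : (⌊x⌋₊ : ℝ) * Real.log x ≤ x * Real.log x :=
    mul_le_mul_of_nonneg_right (Nat.floor_le (by linarith)) (Real.log_nonneg hx)
  have h6 := mul_le_mul_of_nonneg_right h3 (show 0 ≤ x by linarith)
  nlinarith

/-- A set of integers closed under removing all but a bounded part of each element has counting
function controlled by its logarithmic sum. -/
theorem exists_card_mul_log_le : ∃ C > 0, ∀ (S : ℕ → Prop) (x E : ℝ), 1 ≤ x → 1 ≤ E →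
    (∀ n, S n → n ≠ 0 → ∃ e : ℕ, e ≠ 0 ∧ (e : ℝ) ≤ E ∧
      ∀ r, r.Prime → r ∣ n → ¬ r ∣ e → S (n / r)) →
    (((Finset.Icc 1 ⌊x⌋₊).filter S).card : ℝ) * (Real.log x - Real.log E) ≤
      C * (x * (1 + ∑ m ∈ (Finset.Icc 1 ⌊x⌋₊).filter S, 1 / (m : ℝ))) := by
  obtain ⟨C, hC, hrad⟩ := exists_sum_log_sub_log_rad_le
  have hl4 : 0 < Real.log 4 := Real.log_pos (by norm_num)
  refine ⟨C + Real.log 4, by linarith, fun S x E hx hE hS => ?_⟩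
  have hx0 : 0 ≤ x := by linarith
  set T := (Finset.Icc 1 ⌊x⌋₊).filter S with hT
  have hrad' : ∑ n ∈ T, (Real.log x - ∑ r ∈ n.primeFactors, Real.log r) ≤ C * x := by
    refine le_trans ?_ (hrad x hx)
    refine Finset.sum_le_sum_of_subset_of_nonneg (Finset.filter_subset _ _) fun n hn _ => ?_
    rw [Finset.mem_Icc] at hn
    have h1 := sum_log_primeFactors_le (show n ≠ 0 by omega)
    have h2 : Real.log n ≤ Real.log x := Real.log_le_log (by exact_mod_cast hn.1)
      ((Nat.le_floor_iff hx0).1 hn.2)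
    linarith
  have hpt : ∀ n ∈ T, ∑ r ∈ n.primeFactors, Real.log r - Real.log E ≤
      ∑ r ∈ n.primeFactors.filter (fun r => S (n / r)), Real.log r := by
    intro n hn
    rw [hT, Finset.mem_filter, Finset.mem_Icc] at hn
    obtain ⟨e, he0, heE, he⟩ := hS n hn.2 (by omega)
    have h1 : ∑ r ∈ n.primeFactors, Real.log r ≤
        ∑ r ∈ n.primeFactors.filter (fun r => S (n / r)) ∪ e.primeFactors, Real.log r := by
      refine Finset.sum_le_sum_of_subset_of_nonneg ?_ fun r _ _ => Real.log_natCast_nonneg r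
      intro r hr
      rw [Finset.mem_union, Finset.mem_filter]
      by_cases h : r ∣ e
      · exact Or.inr (Nat.mem_primeFactors.2 ⟨Nat.prime_of_mem_primeFactors hr, h, he0⟩)
      · exact Or.inl ⟨hr, he r (Nat.prime_of_mem_primeFactors hr)
          (Nat.dvd_of_mem_primeFactors hr) h⟩
    have h2 := Finset.sum_union_inter (s₁ := n.primeFactors.filter (fun r => S (n / r)))
      (s₂ := e.primeFactors) (f := fun r : ℕ => Real.log r)
    have h3 : 0 ≤ ∑ r ∈ n.primeFactors.filter (fun r => S (n / r)) ∩ e.primeFactors, Real.log r :=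
      Finset.sum_nonneg fun r _ => Real.log_natCast_nonneg r
    have h4 := sum_log_primeFactors_le he0
    have h5 : Real.log e ≤ Real.log E :=
      Real.log_le_log (by exact_mod_cast Nat.pos_of_ne_zero he0) heE
    linarith
  have hsw : ∑ n ∈ T, ∑ r ∈ n.primeFactors.filter (fun r => S (n / r)), Real.log r ≤
      ∑ m ∈ T, ∑ r ∈ primesIoc 0 (x / m), Real.log r := by
    rw [Finset.sum_sigma', Finset.sum_sigma']
    rw [← Finset.sum_image (s := T.sigma fun n => n.primeFactors.filter (fun r => S (n / r)))
      (g := fun p : (_ : ℕ) × ℕ => (⟨p.1 / p.2, p.2⟩ : (_ : ℕ) × ℕ))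
      (f := fun p : (_ : ℕ) × ℕ => Real.log p.2)]
    · refine Finset.sum_le_sum_of_subset_of_nonneg ?_ fun r _ _ => Real.log_natCast_nonneg _
      intro q hq
      obtain ⟨⟨n, r⟩, hp, rfl⟩ := Finset.mem_image.1 hq
      simp only [Finset.mem_sigma, hT, Finset.mem_filter, Finset.mem_Icc, Nat.mem_primeFactors,
        mem_primesIoc] at hp ⊢
      obtain ⟨⟨⟨h1, h2⟩, h3⟩, ⟨h4, h5, h6⟩, h7⟩ := hp
      have h8 : 0 < n / r := Nat.div_pos (Nat.le_of_dvd h1 h5) h4.pos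
      refine ⟨⟨⟨h8, (Nat.div_le_self _ _).trans h2⟩, h7⟩, h4, by exact_mod_cast h4.pos, ?_⟩
      have h9 : (0 : ℝ) < (n / r : ℕ) := by exact_mod_cast h8
      rw [le_div_iff₀ h9]
      have h10 : r * (n / r) = n := Nat.mul_div_cancel' h5
      have h11 : ((r * (n / r) : ℕ) : ℝ) ≤ x := by
        rw [h10]; exact (Nat.le_floor_iff hx0).1 h2
      push_cast at h11
      exact h11
    · rintro ⟨n, r⟩ hp ⟨n', r'⟩ hp' h
      simp only [Finset.mem_coe, Finset.mem_sigma, Finset.mem_filter, Nat.mem_primeFactors]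
          at hp hp'
      simp only [Sigma.mk.injEq, heq_eq_eq] at h ⊢
      obtain ⟨h1, rfl⟩ := h
      refine ⟨?_, rfl⟩
      rw [← Nat.div_mul_cancel hp.2.1.2.1, h1, Nat.div_mul_cancel hp'.2.1.2.1]
  have hch : ∑ m ∈ T, ∑ r ∈ primesIoc 0 (x / m), Real.log r ≤
      Real.log 4 * x * ∑ m ∈ T, 1 / (m : ℝ) := by
    rw [Finset.mul_sum]
    refine Finset.sum_le_sum fun m _ => (sum_primesIoc_log_le (by positivity)).trans (le_of_eq ?_)
    ring
  have hsum := Finset.sum_le_sum hpt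
  rw [Finset.sum_sub_distrib, Finset.sum_const, nsmul_eq_mul] at hsum
  rw [Finset.sum_sub_distrib, Finset.sum_const, nsmul_eq_mul] at hrad'
  have hpos : 0 ≤ ∑ m ∈ T, 1 / (m : ℝ) := Finset.sum_nonneg fun m _ => by positivity
  have : 0 ≤ C * x * ∑ m ∈ T, 1 / (m : ℝ) := by positivity
  have : 0 ≤ Real.log 4 * x := by positivity
  nlinarith

noncomputable def mobiusSum (n : ℕ) (R : ℝ) : ℤ :=
  ∑ d ∈ n.divisors.filter (fun d : ℕ => (d : ℝ) ≤ R), ArithmeticFunction.moebius d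

lemma mobiusSum_eq {n : ℕ} (hn : n ≠ 0) (R : ℝ) :
    mobiusSum n R = ∑ s ∈ n.primeFactors.powerset,
      if ∏ r ∈ s, (r : ℝ) ≤ R then (-1) ^ s.card else 0 := by
  have h1 : mobiusSum n R = ∑ d ∈ n.divisors with Squarefree d,
      if (d : ℝ) ≤ R then ArithmeticFunction.moebius d else 0 := by
    rw [mobiusSum, Finset.sum_filter, Finset.sum_filter]
    refine Finset.sum_congr rfl fun d _ => ?_
    by_cases h : Squarefree d
    · simp [h]
    · simp [h]
  have h2 : (UniqueFactorizationMonoid.normalizedFactors n).toFinset = n.primeFactors := by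
    rw [Nat.factors_eq]; rfl
  rw [h1, Nat.sum_divisors_filter_squarefree hn, h2]
  refine Finset.sum_congr rfl fun s hs => ?_
  rw [Finset.mem_powerset] at hs
  rw [Finset.prod_val]
  have h3 : (((∏ r ∈ s, id r : ℕ)) : ℝ) = ∏ r ∈ s, (r : ℝ) := by push_cast; rfl
  have h4 : s.prod id = ∏ r ∈ s, r := rfl
  rw [h3, h4,
    ArithmeticFunction.isMultiplicative_moebius.map_prod_of_subset_primeFactors n s hs,
    Finset.prod_congr rfl fun r hr =>
      ArithmeticFunction.moebius_apply_prime (Nat.prime_of_mem_primeFactors (hs hr)),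
    Finset.prod_const]

/-- The sets of primes whose product crosses `R` upon multiplication by `p`. -/
def Crosses (R : ℝ) (p : ℕ) (s : Finset ℕ) : Prop :=
  ∏ r ∈ s, (r : ℝ) ≤ R ∧ R < p * ∏ r ∈ s, (r : ℝ)

lemma mobiusSum_eq_sum_crosses {n : ℕ} (R : ℝ) {p : ℕ} (hp : p ∈ n.primeFactors) :
    mobiusSum n R = ∑ s ∈ (n.primeFactors.erase p).powerset with Crosses R p s, (-1) ^ s.card := by
  have hn : n ≠ 0 := (Nat.mem_primeFactors.1 hp).2.2
  have hp1 : (1 : ℝ) ≤ p := by exact_mod_cast (Nat.prime_of_mem_primeFactors hp).one_lt.le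
  rw [mobiusSum_eq hn, ← Finset.insert_erase hp, Finset.sum_powerset_insert
    (Finset.notMem_erase p _), ← Finset.sum_add_distrib, Finset.sum_filter, Finset.insert_erase hp]
  refine Finset.sum_congr rfl fun s hs => ?_
  have hps : p ∉ s := fun h => Finset.notMem_erase p _ (Finset.mem_powerset.1 hs h)
  have h0 : 0 ≤ ∏ r ∈ s, (r : ℝ) := Finset.prod_nonneg fun r _ => Nat.cast_nonneg r
  rw [Finset.prod_insert hps, Finset.card_insert_of_notMem hps]
  by_cases h1 : p * ∏ r ∈ s, (r : ℝ) ≤ R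
  · have h2 : ∏ r ∈ s, (r : ℝ) ≤ R := le_trans (by nlinarith) h1
    rw [if_pos h1, if_pos h2, if_neg (fun h => absurd h.2 (not_lt.2 h1))]
    ring
  · by_cases h2 : ∏ r ∈ s, (r : ℝ) ≤ R
    · rw [if_neg h1, if_pos h2, if_pos ⟨h2, not_le.1 h1⟩, add_zero]
    · rw [if_neg h1, if_neg h2, if_neg (fun h => h2 h.1), add_zero]

lemma mobiusSum_ne_zero {n : ℕ} {R : ℝ} {p : ℕ} (hp : p ∈ n.primeFactors) {s : Finset ℕ}
    (h : s ⊆ n.primeFactors.erase p)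
    (hs : ∀ u ⊆ n.primeFactors.erase p, Crosses R p u ↔ u = s) : mobiusSum n R ≠ 0 := by
  rw [mobiusSum_eq_sum_crosses R hp]
  have : (n.primeFactors.erase p).powerset.filter (Crosses R p) = {s} := by
    ext u
    rw [Finset.mem_filter, Finset.mem_powerset, Finset.mem_singleton]
    constructor
    · rintro ⟨h1, h2⟩
      exact (hs u h1).1 h2
    · rintro rfl
      exact ⟨h, (hs u h).2 rfl⟩
  rw [this, Finset.sum_singleton]
  exact pow_ne_zero _ (by norm_num)

/-- A necessary condition for a nonzero truncated Möbius sum, in terms of the prime factors. -/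
def Straddles (R : ℝ) (s : Finset ℕ) : Prop :=
  (∀ r ∈ s, R < (r : ℝ)) ∨ ∃ p ∈ s, (∀ r ∈ s, p ≤ r) ∧ (p : ℝ) ≤ R ∧
    ∃ d ⊆ s.erase p, Crosses R p d

lemma straddles_of_mobiusSum_ne_zero {n : ℕ} {R : ℝ} (h : mobiusSum n R ≠ 0) :
    Straddles R n.primeFactors := by
  by_cases h0 : ∀ r ∈ n.primeFactors, R < (r : ℝ)
  · exact Or.inl h0
  · push Not at h0
    obtain ⟨q, hq, hqR⟩ := h0
    obtain ⟨p, hp, hmin⟩ := Finset.exists_min_image n.primeFactors id ⟨q, hq⟩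
    refine Or.inr ⟨p, hp, hmin, le_trans (by exact_mod_cast hmin q hq) hqR, ?_⟩
    rw [mobiusSum_eq_sum_crosses R hp] at h
    obtain ⟨d, hd, -⟩ := Finset.exists_ne_zero_of_sum_ne_zero h
    rw [Finset.mem_filter, Finset.mem_powerset] at hd
    exact ⟨d, hd.1, hd.2⟩

lemma straddles_hereditary {R : ℝ} (hR : 1 ≤ R) {n : ℕ} (hn : n ≠ 0)
    (h : Straddles R n.primeFactors) : ∃ e : ℕ, e ≠ 0 ∧ (e : ℝ) ≤ R ^ 2 ∧
      ∀ r, r.Prime → r ∣ n → ¬ r ∣ e → Straddles R (n / r).primeFactors := by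
  have hdiv : ∀ r : ℕ, r.Prime → r ∣ n → (n / r).primeFactors ⊆ n.primeFactors := fun r _ h2 =>
    Nat.primeFactors_mono (Nat.div_dvd_of_dvd h2) hn
  rcases h with h | ⟨p, hp, hmin, hpR, d, hd, h1, h2⟩
  · exact ⟨1, one_ne_zero, by rw [Nat.cast_one]; exact one_le_pow₀ hR,
      fun r hr1 hr2 _ => Or.inl fun q hq => h q (hdiv r hr1 hr2 hq)⟩
  · have hdn : ∀ q ∈ d, q ∈ n.primeFactors := fun q hq => Finset.erase_subset _ _ (hd hq)
    refine ⟨p * ∏ r ∈ d, r, ?_, ?_, ?_⟩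
    · refine mul_ne_zero (Nat.prime_of_mem_primeFactors hp).ne_zero
        (Finset.prod_ne_zero_iff.2 fun q hq => (Nat.prime_of_mem_primeFactors (hdn q hq)).ne_zero)
    · push_cast
      rw [pow_two]
      exact mul_le_mul hpR h1 (Finset.prod_nonneg fun r _ => Nat.cast_nonneg r) (by linarith)
    · intro r hr hrn hre
      have hkeep : ∀ q ∈ n.primeFactors, q ≠ r → q ∈ (n / r).primeFactors := by
        intro q hq hqr
        rw [Nat.mem_primeFactors] at hq ⊢
        refine ⟨hq.1, ?_, ?_⟩
        · have h3 : q ∣ r * (n / r) := by rw [Nat.mul_div_cancel' hrn]; exact hq.2.1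
          exact (((Nat.coprime_primes hq.1 hr).2 hqr).dvd_of_dvd_mul_left h3)
        · exact (Nat.div_pos (Nat.le_of_dvd (Nat.pos_of_ne_zero hn) hrn) hr.pos).ne'
      have hpr : p ≠ r := fun h => hre (h ▸ dvd_mul_right _ _)
      refine Or.inr ⟨p, hkeep p hp hpr, fun q hq => hmin q (hdiv r hr hrn hq), hpR, d, ?_, h1, h2⟩
      intro q hq
      have hqr : q ≠ r := fun h => hre (dvd_mul_of_dvd_right (h ▸ Finset.dvd_prod_of_mem _ hq) _)
      exact Finset.mem_erase.2 ⟨(Finset.mem_erase.1 (hd hq)).1, hkeep q (hdn q hq) hqr⟩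

lemma sum_inv_primeFactors_eq_le (s : Finset ℕ) (hs : ∀ r ∈ s, 2 ≤ r) :
    ∀ T : Finset ℕ, (∀ m ∈ T, m ≠ 0 ∧ m.primeFactors = s) →
      ∑ m ∈ T, 1 / (m : ℝ) ≤ ∏ r ∈ s, 1 / ((r : ℝ) - 1) := by
  induction s using Finset.induction_on with
  | empty =>
    intro T hT
    rw [Finset.prod_empty]
    have : T ⊆ {1} := by
      intro m hm
      obtain ⟨h1, h2⟩ := hT m hm
      rw [Nat.primeFactors_eq_empty] at h2
      rw [Finset.mem_singleton]; omega
    refine (Finset.sum_le_sum_of_subset_of_nonneg this fun _ _ _ => by positivity).trans ?_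
    simp
  | insert p s hps ih =>
    intro T hT
    have hp2 : 2 ≤ p := hs p (Finset.mem_insert_self _ _)
    have hp2' : (2 : ℝ) ≤ p := by exact_mod_cast hp2
    rw [Finset.prod_insert hps]
    set f : ℕ → ℕ × ℕ := fun m => (m.factorization p, m / p ^ m.factorization p) with hf
    set T' := T.image fun m => m / p ^ m.factorization p with hT'
    set K := T.sup fun m => m.factorization p with hK
    have hih : ∑ m ∈ T', 1 / (m : ℝ) ≤ ∏ r ∈ s, 1 / ((r : ℝ) - 1) := by
      refine ih (fun r hr => hs r (Finset.mem_insert_of_mem hr)) T' fun m' hm' => ?_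
      obtain ⟨m, hm, rfl⟩ := Finset.mem_image.1 hm'
      obtain ⟨h1, h2⟩ := hT m hm
      have hpp : p.Prime := Nat.prime_of_mem_primeFactors (h2 ▸ Finset.mem_insert_self p s)
      refine ⟨(Nat.ordCompl_pos p h1).ne', ?_⟩
      rw [← Nat.support_factorization, Nat.factorization_ordCompl, Finsupp.support_erase,
        Nat.support_factorization, h2, Finset.erase_insert hps]
    have hT'0 : 0 ≤ ∑ m ∈ T', 1 / (m : ℝ) := Finset.sum_nonneg fun _ _ => by positivity
    calc ∑ m ∈ T, 1 / (m : ℝ) = ∑ q ∈ T.image f, 1 / ((p : ℝ) ^ q.1 * (q.2 : ℝ)) := by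
          rw [Finset.sum_image]
          · refine Finset.sum_congr rfl fun m _ => ?_
            have := Nat.ordProj_mul_ordCompl_eq_self m p
            rw [← this]
            push_cast
            rw [this]
          · intro m _ m' _ h
            simp only [hf, Prod.mk.injEq] at h
            rw [← Nat.ordProj_mul_ordCompl_eq_self m p, h.2, h.1,
              Nat.ordProj_mul_ordCompl_eq_self m' p]
      _ ≤ ∑ q ∈ (Finset.Ico 1 (K + 1)) ×ˢ T', 1 / ((p : ℝ) ^ q.1 * (q.2 : ℝ)) := by
          refine Finset.sum_le_sum_of_subset_of_nonneg ?_ fun _ _ _ => by positivity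
          intro q hq
          obtain ⟨m, hm, rfl⟩ := Finset.mem_image.1 hq
          obtain ⟨h1, h2⟩ := hT m hm
          have hpm : p ∈ m.primeFactors := h2 ▸ Finset.mem_insert_self p s
          have hpp : p.Prime := Nat.prime_of_mem_primeFactors hpm
          have h3 : m.factorization p ≤ K :=
            Finset.le_sup (f := fun m : ℕ => m.factorization p) hm
          have h4 := hpp.factorization_pos_of_dvd h1 (Nat.dvd_of_mem_primeFactors hpm)
          simp only [hf, Finset.mem_product, Finset.mem_Ico]
          exact ⟨⟨h4, by omega⟩, Finset.mem_image_of_mem _ hm⟩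
      _ = (∑ k ∈ Finset.Ico 1 (K + 1), (1 / (p : ℝ)) ^ k) * ∑ m ∈ T', 1 / (m : ℝ) := by
          rw [Finset.sum_product, Finset.sum_mul_sum]
          refine Finset.sum_congr rfl fun k _ => Finset.sum_congr rfl fun m _ => ?_
          rw [one_div_pow, one_div_mul_one_div]
      _ ≤ 1 / ((p : ℝ) - 1) * ∏ r ∈ s, 1 / ((r : ℝ) - 1) := by
          refine mul_le_mul ?_ hih hT'0 (by
            have : (0 : ℝ) < p - 1 := by linarith
            positivity)
          have h5 : (1 : ℝ) / p < 1 := by rw [div_lt_one (by linarith)]; linarith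
          refine (geom_sum_Ico_le_of_lt_one (by positivity) h5).trans (le_of_eq ?_)
          have : (p : ℝ) - 1 ≠ 0 := by linarith
          field_simp

lemma sum_inv_straddles_le (S : Finset ℕ → Prop) (x : ℝ) :
    ∑ m ∈ (Finset.Icc 1 ⌊x⌋₊).filter (fun m => S m.primeFactors), 1 / (m : ℝ) ≤
      ∑ s ∈ (primesIoc 0 x).powerset with S s, ∏ r ∈ s, 1 / ((r : ℝ) - 1) := by
  rw [← Finset.sum_fiberwise_of_maps_to (g := Nat.primeFactors)
    (t := (primesIoc 0 x).powerset.filter S)]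
  · refine Finset.sum_le_sum fun s hs => sum_inv_primeFactors_eq_le s ?_ _ ?_
    · intro r hr
      exact (prime_of_mem (Finset.mem_powerset.1 (Finset.mem_filter.1 hs).1 hr)).two_le
    · intro m hm
      simp only [Finset.mem_filter, Finset.mem_Icc] at hm
      exact ⟨by omega, hm.2⟩
  · intro m hm
    simp only [Finset.mem_filter, Finset.mem_Icc, Finset.mem_powerset] at hm ⊢
    refine ⟨fun r hr => ?_, hm.2⟩
    have h1 := Nat.mem_primeFactors.1 hr
    rw [mem_primesIoc]
    exact ⟨h1.1, by exact_mod_cast h1.1.pos,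
      (Nat.le_floor_iff' h1.1.ne_zero).1 ((Nat.le_of_dvd (by omega) h1.2.1).trans hm.1.2)⟩

/-- The weight `1 / (r - 1)`, arranged to be nonnegative for every natural number. -/
noncomputable def wt (r : ℕ) : ℝ := 1 / ((r - 1 : ℕ) : ℝ)

lemma wt_nonneg (r : ℕ) : 0 ≤ wt r := by unfold wt; positivity

lemma wt_eq {r : ℕ} (h : 2 ≤ r) : wt r = 1 / ((r : ℝ) - 1) := by
  rw [wt, Nat.cast_sub (by omega), Nat.cast_one]

lemma prod_wt_nonneg (a : Finset ℕ) : 0 ≤ ∏ r ∈ a, wt r :=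
  Finset.prod_nonneg fun r _ => wt_nonneg r

lemma sum_coverCost_log_le {ι : Type*} [DecidableEq ι] (B : Finset ι)
    {w l : ι → ℝ} (hw : ∀ i, 0 ≤ w i)
    (hl : ∀ i, 0 ≤ l i) {β : ℝ} (hβ : 0 ≤ β) :
    ∑ a ∈ B.powerset, (∏ i ∈ a, w i) * coverCost β l a * ∑ r ∈ a, l r ≤
      2 * (∑ r ∈ B, w r * l r) * ∑ a ∈ B.powerset, (∏ i ∈ a, w i) * coverCost β l a := by
  simp only [Finset.mul_sum (s := Finset.powerset B)]
  have h0 : ∀ a, 0 ≤ (∏ i ∈ a, w i) * coverCost β l a := fun a =>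
    mul_nonneg (Finset.prod_nonneg fun i _ => hw i) (coverCost_nonneg hβ hl a)
  rw [← Finset.mul_sum]
  simp only [Finset.mul_sum (f := l)]
  rw [sum_powerset_sum_mem, mul_assoc, Finset.sum_mul, Finset.mul_sum]
  refine Finset.sum_le_sum fun r _ => ?_
  have hwl := mul_nonneg (hw r) (hl r)
  rw [← mul_assoc, Finset.mul_sum]
  refine le_trans (Finset.sum_le_sum fun a ha => ?_) (Finset.sum_le_sum_of_subset_of_nonneg
    (Finset.powerset_mono.2 (Finset.erase_subset r _)) fun a _ _ =>
      mul_nonneg (mul_nonneg zero_le_two hwl) (h0 a))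
  have hra : r ∉ a := fun h => by
    have := Finset.mem_powerset.1 ha h
    simp at this
  rw [Finset.prod_insert hra]
  have h1 := mul_le_mul_of_nonneg_left (coverCost_insert_le (β := β) (l := l) hra)
    (mul_nonneg hwl (Finset.prod_nonneg fun i _ => hw i : 0 ≤ ∏ i ∈ a, w i))
  linarith

lemma sum_biUnion_le {ι κ : Type*} [DecidableEq κ] (S : Finset ι) (W : ι → Finset κ) {f : κ → ℝ}
    (hf : ∀ x, 0 ≤ f x) : ∑ x ∈ S.biUnion W, f x ≤ ∑ i ∈ S, ∑ x ∈ W i, f x := by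
  induction S using Finset.induction_on with
  | empty => simp
  | insert i S hi ih =>
    rw [Finset.biUnion_insert, Finset.sum_insert hi]
    have h := Finset.sum_union_inter (s₁ := W i) (s₂ := S.biUnion W) (f := f)
    have h2 : 0 ≤ ∑ x ∈ W i ∩ S.biUnion W, f x := Finset.sum_nonneg fun x _ => hf x
    linarith

/-- The admissible largest primes, given the smallest prime `p` and the intermediate primes `a`. -/
def IsTopPrime (R : ℝ) (p : ℕ) (a : Finset ℕ) (q : ℕ) : Prop :=
  (∀ r ∈ a, r < q) ∧ ∃ d ⊆ a, (q : ℝ) * ∏ r ∈ d, (r : ℝ) ≤ R ∧ R < p * ((q : ℝ) * ∏ r ∈ d, (r : ℝ))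

noncomputable def topSum (R : ℝ) (p : ℕ) (a : Finset ℕ) : ℝ :=
  ∑ q ∈ primesIoc p R with IsTopPrime R p a q, wt q / Real.log q

lemma topSum_nonneg (R : ℝ) (p : ℕ) (a : Finset ℕ) : 0 ≤ topSum R p a :=
  Finset.sum_nonneg fun q _ => div_nonneg (wt_nonneg q) (Real.log_natCast_nonneg q)

lemma prod_natCast_le_of_subset {c d : Finset ℕ} (h : d ⊆ c) (hc : ∀ r ∈ c, 1 ≤ r) :
    ∏ r ∈ d, (r : ℝ) ≤ ∏ r ∈ c, (r : ℝ) := by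
  have h1 : (∏ r ∈ d, r) ≤ ∏ r ∈ c, r :=
    Finset.prod_le_prod_of_subset_of_one_le' h fun r hr _ => hc r hr
  rw [← Nat.cast_prod, ← Nat.cast_prod]
  exact Nat.cast_le.2 h1

lemma filter_isTopPrime_subset {R : ℝ} {p : ℕ} (hp : 0 < p) {a c : Finset ℕ}
    (ha : ∀ r ∈ a, 1 ≤ r) (hc : c ⊆ a) :
    (primesIoc p R).filter (IsTopPrime R p a) ⊆ (a \ c).powerset.biUnion fun d2 =>
      primesIoc (R / (p * ∏ r ∈ c, (r : ℝ)) / ∏ r ∈ d2, (r : ℝ)) (R / ∏ r ∈ d2, (r : ℝ)) := by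
  have hpos : ∀ d ⊆ a, 0 < ∏ r ∈ d, (r : ℝ) := fun d hd =>
    Finset.prod_pos fun r hr => by exact_mod_cast ha r (hd hr)
  have hone : ∀ d ⊆ a, 1 ≤ ∏ r ∈ d, (r : ℝ) := fun d hd =>
    Finset.one_le_prod fun r hr => by exact_mod_cast ha r (hd hr)
  have hp0 : (0 : ℝ) < p := by exact_mod_cast hp
  intro q hq'
  rw [Finset.mem_filter] at hq'
  obtain ⟨hq1, h1, d, hd, h2, h3⟩ := hq'
  rw [Finset.mem_biUnion]
  refine ⟨d \ c, Finset.mem_powerset.2 (Finset.sdiff_subset_sdiff hd le_rfl), ?_⟩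
  have hdc := hpos (d \ c) (Finset.sdiff_subset.trans hd)
  have hcp := hpos c hc
  have hq0 : (0 : ℝ) < q := by exact_mod_cast (prime_of_mem hq1).pos
  have hspl : ∏ r ∈ d, (r : ℝ) = (∏ r ∈ d ∩ c, (r : ℝ)) * ∏ r ∈ d \ c, (r : ℝ) :=
    (Finset.prod_inter_mul_prod_sdiff d c _).symm
  have hic : ∏ r ∈ d ∩ c, (r : ℝ) ≤ ∏ r ∈ c, (r : ℝ) :=
    prod_natCast_le_of_subset Finset.inter_subset_right fun r hr => ha r (hc hr)
  have hic1 := hone (d ∩ c) (Finset.inter_subset_left.trans hd)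
  rw [hspl] at h2 h3
  rw [mem_primesIoc]
  refine ⟨prime_of_mem hq1, ?_, ?_⟩
  · rw [div_div, div_lt_iff₀ (by positivity)]
    refine h3.trans_le ?_
    have : (∏ r ∈ d ∩ c, (r : ℝ)) * (p * (q * ∏ r ∈ d \ c, (r : ℝ))) ≤
      (∏ r ∈ c, (r : ℝ)) * (p * (q * ∏ r ∈ d \ c, (r : ℝ))) :=
        mul_le_mul_of_nonneg_right hic (by positivity)
    linarith
  · rw [le_div_iff₀ hdc]
    refine le_trans ?_ h2
    have : 1 * (q * ∏ r ∈ d \ c, (r : ℝ)) ≤ (∏ r ∈ d ∩ c, (r : ℝ)) * (q * ∏ r ∈ d \ c, (r : ℝ)) :=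
      mul_le_mul_of_nonneg_right hic1 (by positivity)
    linarith

lemma exists_topSum_le : ∃ C > 0, ∀ (R : ℝ) (p : ℕ) (a : Finset ℕ) (Q : ℝ), 0 < R → 2 ≤ p →
    (∀ r ∈ a, 1 ≤ r) → 1 < Q → (∀ q ∈ primesIoc p R, IsTopPrime R p a q → Q ≤ q) →
    topSum R p a ≤ C * (coverCost (Real.log p) (fun r : ℕ => Real.log r) a / Real.log Q ^ 2) := by
  obtain ⟨C, hC, hwin⟩ := exists_log_window
  refine ⟨1 + C / Real.log 2, by positivity, fun R p a Q hR hp ha hQ hq => ?_⟩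
  have ht : 0 < Real.log 2 := Real.log_pos (by norm_num)
  have hlQ : 0 < Real.log Q := Real.log_pos hQ
  rw [mul_div_assoc', le_div_iff₀ (by positivity), mul_comm, mul_comm (_ + _),
    ← div_le_iff₀ (by positivity)]
  refine le_coverCost fun c hc => ?_
  rw [div_le_iff₀ (by positivity)]
  have hpos : ∀ d ⊆ a, 0 < ∏ r ∈ d, (r : ℝ) := fun d hd =>
    Finset.prod_pos fun r hr => by exact_mod_cast ha r (hd hr)
  have hone : ∀ d ⊆ a, 1 ≤ ∏ r ∈ d, (r : ℝ) := fun d hd =>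
    Finset.one_le_prod fun r hr => by exact_mod_cast ha r (hd hr)
  have hp2 : (2 : ℝ) ≤ p := by exact_mod_cast hp
  have hlp : Real.log 2 ≤ Real.log p := Real.log_le_log (by norm_num) hp2
  set W : Finset ℕ → Finset ℕ := fun d2 =>
    primesIoc (R / (p * ∏ r ∈ c, (r : ℝ)) / ∏ r ∈ d2, (r : ℝ)) (R / ∏ r ∈ d2, (r : ℝ)) with hW
  have hcov := filter_isTopPrime_subset (R := R) (by omega : 0 < p) ha hc
  have hterm : ∀ q ∈ (primesIoc p R).filter (IsTopPrime R p a),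
      Real.log Q ^ 2 * (wt q / Real.log q) ≤ wt q * Real.log q := by
    intro q hq'
    rw [Finset.mem_filter] at hq'
    have h1 := hq q hq'.1 hq'.2
    have h2 : Real.log Q ≤ Real.log q := Real.log_le_log (by linarith) h1
    have h3 : 0 < Real.log q := by linarith
    have h4 := wt_nonneg q
    rw [mul_div_assoc', div_le_iff₀ h3]
    have : Real.log Q ^ 2 ≤ Real.log q ^ 2 := pow_le_pow_left₀ hlQ.le h2 2
    nlinarith
  have hlogc : Real.log (p * ∏ r ∈ c, (r : ℝ)) = Real.log p + ∑ r ∈ c, Real.log r := by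
    rw [Real.log_mul (by positivity) (hpos c hc).ne', Real.log_prod]
    exact fun r hr => by
      have := ha r (hc hr)
      positivity
  have hbnn : 0 ≤ ∑ r ∈ c, Real.log (r : ℝ) := Finset.sum_nonneg fun r _ =>
      Real.log_natCast_nonneg r
  calc Real.log Q ^ 2 * topSum R p a
      ≤ ∑ q ∈ (primesIoc p R).filter (IsTopPrime R p a), wt q * Real.log q := by
        rw [topSum, Finset.mul_sum]
        exact Finset.sum_le_sum hterm
    _ ≤ ∑ q ∈ (a \ c).powerset.biUnion W, wt q * Real.log q :=
        Finset.sum_le_sum_of_subset_of_nonneg hcov fun q _ _ =>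
          mul_nonneg (wt_nonneg q) (Real.log_natCast_nonneg q)
    _ ≤ ∑ d2 ∈ (a \ c).powerset, ∑ q ∈ W d2, wt q * Real.log q :=
        sum_biUnion_le _ _ fun q => mul_nonneg (wt_nonneg q) (Real.log_natCast_nonneg q)
    _ ≤ ∑ d2 ∈ (a \ c).powerset, (Real.log p + ∑ r ∈ c, Real.log r + C) := by
        refine Finset.sum_le_sum fun d2 hd2 => ?_
        have hd2p := hpos d2 ((Finset.mem_powerset.1 hd2).trans Finset.sdiff_subset)
        have hcp := hpos c hc
        have hc1 := hone c hc
        have h1 : (1 : ℝ) ≤ p * ∏ r ∈ c, (r : ℝ) := by nlinarith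
        have h2 : R / (p * ∏ r ∈ c, (r : ℝ)) / ∏ r ∈ d2, (r : ℝ) ≤ R / ∏ r ∈ d2, (r : ℝ) := by
          gcongr
          exact div_le_self hR.le h1
        have h3 := (hwin _ _ (by positivity) h2).1
        have h4 : R / (∏ r ∈ d2, (r : ℝ)) / (R / (p * ∏ r ∈ c, (r : ℝ)) / ∏ r ∈ d2, (r : ℝ)) =
            p * ∏ r ∈ c, (r : ℝ) := by
          field_simp
        rw [h4, hlogc] at h3
        refine le_trans (le_of_eq (Finset.sum_congr rfl fun q hq => ?_)) h3
        rw [wt_eq (prime_of_mem hq).two_le]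
        ring
    _ = 2 ^ (a \ c).card * (Real.log p + ∑ r ∈ c, Real.log r + C) := by
        rw [Finset.sum_const, Finset.card_powerset, nsmul_eq_mul]
        push_cast
        rfl
    _ ≤ 2 ^ (a \ c).card * (Real.log p + ∑ r ∈ c, Real.log r) * (1 + C / Real.log 2) := by
        rw [mul_assoc]
        refine mul_le_mul_of_nonneg_left ?_ (by positivity)
        have : C ≤ (Real.log p + ∑ r ∈ c, Real.log r) * (C / Real.log 2) := by
          calc C = Real.log 2 * (C / Real.log 2) := by field_simp
            _ ≤ _ := mul_le_mul_of_nonneg_right (by linarith) (by positivity)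
        linarith

lemma blockUnion_blockPrimes (j n : ℕ) :
    blockUnion (fun i => blockPrimes (j + i)) n = primesIoc (blk j) (blk (j + n)) := by
  induction n with
  | zero => rw [blockUnion_zero, add_zero, primesIoc_of_le le_rfl]
  | succ n ih =>
    rw [blockUnion_succ, ih, blockPrimes, ← add_assoc]
    exact (primesIoc_union (blk_mono_cast (i := j) (j := j + n) (by omega))
      (blk_mono_cast (i := j + n) (j := j + n + 1) (by omega))).symm

lemma disjoint_blockPrimes {i j : ℕ} (h : i < j) : Disjoint (blockPrimes i) (blockPrimes j) :=
  primesIoc_disjoint (blk_mono_cast (by omega))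

lemma prime_of_mem_blockPrimes {j r : ℕ} (h : r ∈ blockPrimes j) : r.Prime := prime_of_mem h

lemma sum_wt_blockPrimes_le (j : ℕ) : ∑ r ∈ blockPrimes j, wt r ≤ Real.log 2 := by
  rw [Finset.sum_congr rfl fun r hr => wt_eq (prime_of_mem_blockPrimes hr).two_le]
  exact sum_blockPrimes_le j

lemma exists_sum_wt_mul_log_le : ∃ C > 0, ∀ j i : ℕ,
    ∑ r ∈ primesIoc (blk j) (blk (j + i)), wt r * Real.log r ≤ C * 2 ^ j * 2 ^ i := by
  obtain ⟨C, hC, hwin⟩ := exists_log_window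
  obtain ⟨c, D, hc, hD, hblk⟩ := exists_log_blk_bounds
  refine ⟨D + C, by linarith, fun j i => ?_⟩
  have h2 := two_le_blk_cast j
  have h3 := blk_mono_cast (show j ≤ j + i by omega)
  have h1 := (hwin (blk j) (blk (j + i)) (by linarith) h3).1
  have h4 : Real.log (blk (j + i) / blk j) ≤ Real.log (blk (j + i)) := by
    refine Real.log_le_log (div_pos (by linarith) (by linarith))
      (div_le_self (by positivity) (by linarith))
  have h5 := (hblk (j + i)).2
  have h6 : C * 1 ≤ C * (2 ^ j * 2 ^ i) := by
    refine mul_le_mul_of_nonneg_left ?_ (by linarith)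
    rw [← pow_add]
    exact one_le_pow₀ (by norm_num)
  rw [Finset.sum_congr rfl fun r hr => show wt r * Real.log r = Real.log r / (r - 1) by
    rw [wt_eq (prime_of_mem hr).two_le]; ring]
  rw [pow_add] at h5
  nlinarith

lemma exists_sum_blocks_coverCost_le : ∃ C > 0, ∀ (j N : ℕ) (β : ℝ), 0 ≤ β →
    β ≤ Real.log (blk (j + 1)) →
    ∑ a ∈ (primesIoc (blk j) (blk (j + N))).powerset,
      (∏ i ∈ a, wt i) * coverCost β (fun r : ℕ => Real.log r) a ≤
      C * (2 ^ j * ((2 * Real.exp 1 * Real.log 2) ^ N * kap N)) := by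
  obtain ⟨C, hC, hmain⟩ := exists_sum_coverCost_le
  obtain ⟨D, hD, hlog⟩ := exists_sum_wt_mul_log_le
  obtain ⟨c, D', hc, hD', hblk⟩ := exists_log_blk_bounds
  refine ⟨C * (D + 2 * D'), by positivity, fun j N β hβ hβ2 => ?_⟩
  have h := hmain (fun i => blockPrimes (j + i)) wt (fun r : ℕ => Real.log r) N β
    ((D + 2 * D') * 2 ^ j) wt_nonneg (fun r => Real.log_natCast_nonneg r) hβ ?_ ?_ ?_ ?_
  · rw [blockUnion_blockPrimes] at h
    exact h.trans (le_of_eq (by ring))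
  · refine (hβ2.trans (hblk (j + 1)).2).trans ?_
    have : 0 < D * 2 ^ j := by positivity
    rw [pow_succ]
    linarith
  · exact fun i i' h1 _ => disjoint_blockPrimes (by omega)
  · exact fun i _ => sum_wt_blockPrimes_le _
  · intro i _
    rw [blockUnion_blockPrimes]
    refine (hlog j i).trans ?_
    gcongr
    linarith

lemma exists_blk_index {x : ℝ} (hx : 2 < x) : ∃ g : ℕ, (blk g : ℝ) < x ∧ x ≤ blk (g + 1) := by
  have hex : ∃ g : ℕ, x ≤ blk g := by
    refine ⟨⌈x⌉₊, (Nat.le_ceil x).trans ?_⟩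
    exact_mod_cast blk_strictMono.le_apply
  have h0 : Nat.find hex ≠ 0 := by
    intro h
    have := Nat.find_spec hex
    rw [h] at this
    have h2 : (blk 0 : ℝ) = 2 := by norm_num [blk]
    linarith
  obtain ⟨g, hg⟩ := Nat.exists_eq_succ_of_ne_zero h0
  refine ⟨g, ?_, ?_⟩
  · exact not_le.1 (Nat.find_min hex (by omega))
  · have := Nat.find_spec hex
    rwa [hg] at this

theorem exists_sum_topSum_le : ∃ C > 0, ∀ (R y : ℝ) (v j p : ℕ), (blk v : ℝ) ≤ R →
    R ≤ blk (v + 1) → 2 ≤ y → y ^ 4 = R → p.Prime → (p : ℝ) ≤ y → j ≤ v → (blk j : ℝ) ≤ p →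
    (p : ℝ) ≤ blk (j + 1) →
    ∑ a ∈ (primesIoc p R).powerset, (∏ i ∈ a, wt i) * topSum R p a ≤
      C * ((1 / 2) ^ v * ((Real.exp 1 * Real.log 2) ^ (v - j) * kap (v - j))) := by
  obtain ⟨C1, hC1, htop⟩ := exists_topSum_le
  obtain ⟨c, D1, hc, hD1, hblk⟩ := exists_log_blk_bounds
  obtain ⟨C2, hC2, hcov⟩ := exists_sum_blocks_coverCost_le
  obtain ⟨D, hD, hlog⟩ := exists_sum_wt_mul_log_le
  have hθ : 1 < Real.exp 1 * Real.log 2 := by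
    have := log_two_bounds.1
    have := exp_one_bounds.1
    nlinarith
  set θ := Real.exp 1 * Real.log 2 with hθd
  have hθ0 : 0 < θ := by linarith
  obtain ⟨C3, hC3, hconv⟩ := exists_geom_kap_conv (ρ := 1 / θ) (by positivity)
    (by rw [div_lt_one hθ0]; exact hθ)
  refine ⟨32 * C1 * C2 / c ^ 2 * θ + 32 * C1 * C2 * D / c ^ 3 * θ * C3, by positivity, ?_⟩
  intro R y v j p hvR hRv hy hyR hp hpy hjv hjp hlp
  set B := coverCost (Real.log p) (fun r : ℕ => Real.log r) with hB
  have hlp0 : 0 ≤ Real.log p := Real.log_natCast_nonneg p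
  have hB0 : ∀ a, 0 ≤ B a := coverCost_nonneg hlp0 fun r => Real.log_natCast_nonneg r
  have hR0 : 0 < R := by rw [← hyR]; positivity
  have hly : 0 < Real.log y := Real.log_pos (by linarith)
  have hlyv : c * 2 ^ v / 4 ≤ Real.log y := by
    have h1 := (hblk v).1
    have h2 : Real.log (blk v) ≤ Real.log R :=
      Real.log_le_log (by linarith [two_le_blk_cast v]) hvR
    rw [← hyR, Real.log_pow] at h2
    push_cast at h2
    linarith
  set V := v - j with hV
  have hvj : v + 1 = j + (V + 1) := by omega
  set U : ℕ → Finset ℕ := fun i => primesIoc (blk j) (blk (j + i)) with hU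
  set K1 : ℝ := C1 / Real.log y ^ 2 with hK1
  set K2 : ℕ → ℝ := fun i => C1 / (c * 2 ^ (j + i)) ^ 2 / (2 * Real.log y) with hK2
  have hsubU : ∀ a ⊆ primesIoc p R, a ⊆ U (V + 1) := by
    intro a ha r hr
    have := mem_primesIoc.1 (ha hr)
    rw [hU]
    simp only
    rw [mem_primesIoc, ← hvj]
    exact ⟨this.1, by linarith, by linarith⟩
  have hpt : ∀ a ⊆ primesIoc p R, topSum R p a ≤ K1 * B a +
      ∑ i ∈ Finset.range (V + 1), if a ⊆ U (i + 1) then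
        K2 i * (B a * ∑ r ∈ a, Real.log r) else 0 := by
    intro a ha
    have hpr : ∀ r ∈ a, r.Prime := fun r hr => prime_of_mem (ha hr)
    have hsl : 0 ≤ ∑ r ∈ a, Real.log (r : ℝ) :=
      Finset.sum_nonneg fun r _ => Real.log_natCast_nonneg r
    have hK2n : ∀ i, 0 ≤ K2 i := fun i => by positivity
    have hterm : ∀ i, 0 ≤ if a ⊆ U (i + 1) then
        K2 i * (B a * ∑ r ∈ a, Real.log (r : ℝ)) else 0 := by
      intro i
      split_ifs
      · exact mul_nonneg (hK2n i) (mul_nonneg (hB0 a) hsl)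
      · exact le_rfl
    by_cases hbig : ∏ r ∈ a, (r : ℝ) ≤ y ^ 2
    · have h1 := htop R p a y hR0 hp.two_le (fun r hr => (hpr r hr).one_lt.le) (by linarith) ?_
      · have h2 : 0 ≤ ∑ i ∈ Finset.range (V + 1), if a ⊆ U (i + 1) then
            K2 i * (B a * ∑ r ∈ a, Real.log (r : ℝ)) else 0 := Finset.sum_nonneg fun i _ => hterm i
        have h3 : C1 * (B a / Real.log y ^ 2) = K1 * B a := by rw [hK1]; ring
        linarith
      · rintro q hq ⟨-, d, hd, -, h2⟩
        have h3 := prod_natCast_le_of_subset hd fun r hr => (hpr r hr).one_lt.le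
        by_contra hlt
        push Not at hlt
        have hq0 : (0 : ℝ) ≤ q := Nat.cast_nonneg q
        have h4 : p * (q * ∏ r ∈ d, (r : ℝ)) ≤ y * (y * y ^ 2) := by
          refine mul_le_mul hpy ?_ ?_ (by linarith)
          · exact mul_le_mul hlt.le (h3.trans hbig)
              (Finset.prod_nonneg fun r _ => Nat.cast_nonneg r) (by linarith)
          · exact mul_nonneg hq0 (Finset.prod_nonneg fun r _ => Nat.cast_nonneg r)
        nlinarith
    · push Not at hbig
      have hne : a.Nonempty := by
        rw [Finset.nonempty_iff_ne_empty]
        rintro rfl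
        rw [Finset.prod_empty] at hbig
        nlinarith
      obtain ⟨m, hm, hmax⟩ := Finset.exists_max_image a id hne
      simp only [id] at hmax
      have hm2 := mem_primesIoc.1 (ha hm)
      have hm3 : (2 : ℝ) < m := by linarith [two_le_blk_cast j]
      obtain ⟨g, hg1, hg2⟩ := exists_blk_index hm3
      have hgj : j ≤ g := by
        by_contra h
        have := blk_mono_cast (show g + 1 ≤ j by omega)
        linarith
      have hgv : g ≤ v := by
        by_contra h
        have := blk_mono_cast (show v + 1 ≤ g by omega)
        linarith
      have hin : a ⊆ U (g - j + 1) := by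
        intro r hr
        have h1 := mem_primesIoc.1 (ha hr)
        have h2 : (r : ℝ) ≤ m := by exact_mod_cast hmax r hr
        rw [hU]
        simp only
        rw [mem_primesIoc, show j + (g - j + 1) = g + 1 by omega]
        exact ⟨h1.1, by linarith, by linarith⟩
      have h1 := htop R p a (blk g) hR0 hp.two_le (fun r hr => (hpr r hr).one_lt.le)
        (by linarith [two_le_blk_cast g]) ?_
      · have h2 := Finset.single_le_sum (s := Finset.range (V + 1)) (fun i _ => hterm i)
          (Finset.mem_range.2 (show g - j < V + 1 by omega))
        rw [if_pos hin] at h2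
        have h3 : 2 * Real.log y ≤ ∑ r ∈ a, Real.log (r : ℝ) := by
          have h4 : Real.log (y ^ 2) ≤ Real.log (∏ r ∈ a, (r : ℝ)) :=
            Real.log_le_log (by positivity) hbig.le
          rw [Real.log_pow, Real.log_prod (fun r hr => by exact_mod_cast (hpr r hr).ne_zero)] at h4
          exact_mod_cast h4
        have h5 : C1 * (B a / Real.log (blk g) ^ 2) ≤ K2 (g - j) *
            (B a * ∑ r ∈ a, Real.log (r : ℝ)) := by
          have h6 : (c * 2 ^ g) ^ 2 ≤ Real.log (blk g) ^ 2 :=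
            pow_le_pow_left₀ (by positivity) (hblk g).1 2
          rw [hK2]
          simp only
          rw [show j + (g - j) = g by omega]
          calc C1 * (B a / Real.log (blk g) ^ 2) ≤ C1 * (B a / (c * 2 ^ g) ^ 2) := by
                gcongr
                exact hB0 a
            _ = C1 / (c * 2 ^ g) ^ 2 / (2 * Real.log y) * (B a * (2 * Real.log y)) := by
                field_simp
            _ ≤ _ := by
                gcongr
                exact hB0 a
        have h7 : 0 ≤ K1 * B a := mul_nonneg (by positivity) (hB0 a)
        linarith
      · rintro q hq ⟨h1, -⟩
        have h2 : (m : ℝ) < q := by exact_mod_cast h1 m hm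
        linarith
  have hUsub : ∀ i ≤ V, U (i + 1) ⊆ U (V + 1) := by
    intro i hi r hr
    simp only [hU, mem_primesIoc] at hr ⊢
    exact ⟨hr.1, hr.2.1, hr.2.2.trans (blk_mono_cast (by omega))⟩
  have hkV : kap (V + 1) ≤ kap V := kap_anti (by omega)
  have hpw : ∀ n : ℕ, (2 * Real.exp 1 * Real.log 2) ^ n = 2 ^ n * θ ^ n := fun n => by
    rw [← mul_pow, hθd, mul_assoc]
  have hlp' : Real.log p ≤ Real.log (blk (j + 1)) :=
    Real.log_le_log (by exact_mod_cast hp.pos) hlp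
  have hcov' : ∀ i, ∑ a ∈ (U i).powerset, (∏ r ∈ a, wt r) * B a ≤
      C2 * (2 ^ j * (2 ^ i * θ ^ i * kap i)) := fun i => by
    have := hcov j i (Real.log p) hlp0 hlp'
    rwa [hpw] at this
  have hA : K1 * ∑ a ∈ (U (V + 1)).powerset, (∏ r ∈ a, wt r) * B a ≤
      32 * C1 * C2 / c ^ 2 * θ * ((1 / 2) ^ v * (θ ^ V * kap V)) := by
    have h1 : K1 ≤ C1 / (c * 2 ^ v / 4) ^ 2 := by
      rw [hK1]
      gcongr
    calc _ ≤ C1 / (c * 2 ^ v / 4) ^ 2 * (C2 * (2 ^ j * (2 ^ (V + 1) * θ ^ (V + 1) * kap V))) := by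
          refine mul_le_mul h1 ((hcov' (V + 1)).trans ?_) ?_ (by positivity)
          · gcongr
          · exact Finset.sum_nonneg fun a _ => mul_nonneg (prod_wt_nonneg a) (hB0 a)
      _ = C1 / (c * 2 ^ v / 4) ^ 2 * (C2 * (2 ^ (v + 1) * θ ^ (V + 1) * kap V)) := by
          rw [hvj, pow_add 2 j (V + 1)]
          ring
      _ = _ := by
          rw [one_div_pow]
          field_simp
          ring
  have hBi : ∀ i, K2 i * ∑ a ∈ (U (i + 1)).powerset,
      (∏ r ∈ a, wt r) * B a * ∑ r ∈ a, Real.log (r : ℝ) ≤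
      32 * C1 * C2 * D / c ^ 3 * θ * (1 / 2) ^ v * (θ ^ i * kap i) := by
    intro i
    have h1 := sum_coverCost_log_le (U (i + 1)) wt_nonneg
      (fun r : ℕ => Real.log_natCast_nonneg r) hlp0
    have h2 := hlog j (i + 1)
    have h3 := hcov' (i + 1)
    have h4 : K2 i ≤ C1 / (c * 2 ^ (j + i)) ^ 2 / (2 * (c * 2 ^ v / 4)) := by
      rw [hK2]
      simp only
      gcongr
    have hki : kap (i + 1) ≤ kap i := kap_anti (by omega)
    have hk0 := kap_pos (i + 1)
    calc _ ≤ C1 / (c * 2 ^ (j + i)) ^ 2 / (2 * (c * 2 ^ v / 4)) *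
          (2 * (D * 2 ^ j * 2 ^ (i + 1)) * (C2 *
              (2 ^ j * (2 ^ (i + 1) * θ ^ (i + 1) * kap i)))) := by
          refine mul_le_mul h4 (h1.trans ?_) ?_ (by positivity)
          · refine mul_le_mul (by linarith) (h3.trans (by gcongr)) ?_ (by positivity)
            exact Finset.sum_nonneg fun a _ => mul_nonneg (prod_wt_nonneg a) (hB0 a)
          · exact Finset.sum_nonneg fun a _ => mul_nonneg (mul_nonneg (prod_wt_nonneg a) (hB0 a))
              (Finset.sum_nonneg fun r _ => Real.log_natCast_nonneg r)
      _ = 16 * C1 * C2 * D / c ^ 3 * θ * (1 / 2) ^ v * (θ ^ i * kap i) := by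
          rw [one_div_pow, pow_add, pow_succ, pow_succ]
          field_simp
          ring
      _ ≤ _ := by
          have := kap_pos i
          gcongr
          norm_num
  have hsumc : ∑ i ∈ Finset.range (V + 1), θ ^ i * kap i ≤ C3 * (θ ^ V * kap V) := by
    rw [← Finset.sum_range_reflect]
    calc _ = θ ^ V * ∑ i ∈ Finset.range (V + 1), (1 / θ) ^ i * kap (V - i) := by
          rw [Finset.mul_sum]
          refine Finset.sum_congr rfl fun i hi => ?_
          have hi' : i ≤ V := Nat.lt_succ_iff.1 (Finset.mem_range.1 hi)
          rw [show V + 1 - 1 - i = V - i by omega, ← mul_assoc]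
          congr 1
          rw [pow_sub₀ θ hθ0.ne' hi', one_div, inv_pow]
      _ ≤ θ ^ V * (C3 * kap V) := mul_le_mul_of_nonneg_left (hconv V) (by positivity)
      _ = _ := by ring
  calc _ ≤ ∑ a ∈ (primesIoc p R).powerset, (∏ i ∈ a, wt i) * (K1 * B a +
        ∑ i ∈ Finset.range (V + 1), if a ⊆ U (i + 1) then
        K2 i * (B a * ∑ r ∈ a, Real.log (r : ℝ)) else 0) :=
        Finset.sum_le_sum fun a ha =>
          mul_le_mul_of_nonneg_left (hpt a (Finset.mem_powerset.1 ha)) (prod_wt_nonneg a)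
    _ ≤ ∑ a ∈ (U (V + 1)).powerset, (∏ i ∈ a, wt i) * (K1 * B a +
        ∑ i ∈ Finset.range (V + 1), if a ⊆ U (i + 1) then
        K2 i * (B a * ∑ r ∈ a, Real.log (r : ℝ)) else 0) := by
        refine Finset.sum_le_sum_of_subset_of_nonneg ?_ fun a _ _ => ?_
        · exact fun a ha => Finset.mem_powerset.2 (hsubU a (Finset.mem_powerset.1 ha))
        · refine mul_nonneg (prod_wt_nonneg a) (add_nonneg (mul_nonneg (by positivity) (hB0 a))
            (Finset.sum_nonneg fun i _ => ?_))
          split_ifs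
          · exact mul_nonneg (by positivity) (mul_nonneg (hB0 a)
              (Finset.sum_nonneg fun r _ => Real.log_natCast_nonneg r))
          · exact le_rfl
    _ = K1 * ∑ a ∈ (U (V + 1)).powerset, (∏ r ∈ a, wt r) * B a +
        ∑ i ∈ Finset.range (V + 1), K2 i * ∑ a ∈ (U (i + 1)).powerset,
          (∏ r ∈ a, wt r) * B a * ∑ r ∈ a, Real.log (r : ℝ) := by
        simp only [mul_add, Finset.sum_add_distrib]
        congr 1
        · rw [Finset.mul_sum]
          exact Finset.sum_congr rfl fun a _ => by ring
        · simp only [Finset.mul_sum (s := Finset.range (V + 1))]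
          rw [Finset.sum_comm]
          refine Finset.sum_congr rfl fun i hi => ?_
          have hi' : i ≤ V := Nat.lt_succ_iff.1 (Finset.mem_range.1 hi)
          have hfil : (U (i + 1)).powerset = (U (V + 1)).powerset.filter (fun a =>
              a ⊆ U (i + 1)) := by
            ext a
            rw [Finset.mem_filter, Finset.mem_powerset, Finset.mem_powerset]
            exact ⟨fun h => ⟨h.trans (hUsub i hi'), h⟩, fun h => h.2⟩
          rw [hfil, Finset.sum_filter, Finset.mul_sum]
          refine Finset.sum_congr rfl fun a _ => ?_
          split_ifs <;> ring
    _ ≤ 32 * C1 * C2 / c ^ 2 * θ * ((1 / 2) ^ v * (θ ^ V * kap V)) +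
        ∑ i ∈ Finset.range (V + 1), 32 * C1 * C2 * D / c ^ 3 * θ * (1 / 2) ^ v * (θ ^ i * kap i) :=
        add_le_add hA (Finset.sum_le_sum fun i _ => hBi i)
    _ ≤ 32 * C1 * C2 / c ^ 2 * θ * ((1 / 2) ^ v * (θ ^ V * kap V)) +
        32 * C1 * C2 * D / c ^ 3 * θ * (1 / 2) ^ v * (C3 * (θ ^ V * kap V)) := by
        rw [← Finset.mul_sum]
        gcongr
    _ = _ := by ring

lemma exists_sum_powerset_le : ∃ C > 0, ∀ y z : ℝ, 2 ≤ y → y ≤ z →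
    ∑ b ∈ (primesIoc y z).powerset, ∏ r ∈ b, wt r ≤ C * (Real.log z / Real.log y) := by
  obtain ⟨C, hC, h⟩ := exists_prod_window
  refine ⟨C, hC, fun y z hy hyz => ?_⟩
  rw [← Finset.prod_one_add]
  refine le_trans (le_of_eq ?_) (h y z hy hyz)
  exact Finset.prod_congr rfl fun r hr => by rw [wt_eq (prime_of_mem hr).two_le]

/-- Sets of primes split off according to their smallest element `p` and the largest element `q`
of a subset that crosses `R`. -/
lemma mem_of_straddles {R x y : ℝ} (hyR : y ≤ R) {s : Finset ℕ} (hs : s ⊆ primesIoc 0 x)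
    (h : Straddles R s) : s ∈ (primesIoc y x).powerset ∪
      (primesIoc 0 y).biUnion fun p => (primesIoc p R).powerset.biUnion fun a =>
        ((primesIoc p R).filter (IsTopPrime R p a)).biUnion fun q =>
          ((primesIoc q x).powerset.biUnion fun b => {insert p (insert q (a ∪ b))}) := by
  have hA : (∀ r ∈ s, y < r) → s ⊆ primesIoc y x := fun h r hr => by
    have := mem_primesIoc.1 (hs hr)
    exact mem_primesIoc.2 ⟨this.1, h r hr, this.2.2⟩
  rw [Finset.mem_union]
  by_cases hy : ∀ r ∈ s, y < r
  · exact Or.inl (Finset.mem_powerset.2 (hA hy))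
  right
  rcases h with h | ⟨p, hp, hmin, hpR, d, hd, h1, h2⟩
  · exact absurd (fun r hr => hyR.trans_lt (h r hr)) hy
  have hpy : (p : ℝ) ≤ y := by
    push Not at hy
    obtain ⟨r, hr, hry⟩ := hy
    have : (p : ℝ) ≤ r := by exact_mod_cast hmin r hr
    linarith
  have hpr : ∀ r ∈ s, r.Prime := fun r hr => prime_of_mem (hs hr)
  have hds : d ⊆ s := hd.trans (Finset.erase_subset _ _)
  have hne : d.Nonempty := by
    rw [Finset.nonempty_iff_ne_empty]
    rintro rfl
    rw [Finset.prod_empty] at h2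
    linarith
  obtain ⟨q, hq, hmax⟩ := Finset.exists_max_image d id hne
  simp only [id] at hmax
  have hpq : p < q := lt_of_le_of_ne (hmin q (hds hq)) (Finset.ne_of_mem_erase (hd hq)).symm
  have hqR : (q : ℝ) ≤ R := by
    have := prod_natCast_le_of_subset (c := d) (d := {q}) (by simpa using hq)
      fun r hr => (hpr r (hds hr)).one_lt.le
    rw [Finset.prod_singleton] at this
    linarith
  simp only [Finset.mem_biUnion, Finset.mem_powerset, Finset.mem_filter, Finset.mem_singleton]
  refine ⟨p, mem_primesIoc.2 ⟨hpr p hp, by exact_mod_cast (hpr p hp).pos, hpy⟩,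
    s.filter (fun r => p < r ∧ r < q), ?_, q,
    ⟨mem_primesIoc.2 ⟨hpr q (hds hq), by exact_mod_cast hpq, hqR⟩, ?_⟩,
    s.filter (fun r => q < r), ?_, ?_⟩
  · intro r hr
    rw [Finset.mem_filter] at hr
    have : (r : ℝ) ≤ q := by exact_mod_cast hr.2.2.le
    exact mem_primesIoc.2 ⟨hpr r hr.1, by exact_mod_cast hr.2.1, by linarith⟩
  · refine ⟨fun r hr => (Finset.mem_filter.1 hr).2.2, d.erase q, ?_, ?_, ?_⟩
    · intro r hr
      rw [Finset.mem_erase] at hr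
      have h3 := hd hr.2
      rw [Finset.mem_erase] at h3
      rw [Finset.mem_filter]
      exact ⟨h3.2, lt_of_le_of_ne (hmin r h3.2) h3.1.symm, lt_of_le_of_ne (hmax r hr.2) hr.1⟩
    · rwa [Finset.mul_prod_erase d (fun r : ℕ => (r : ℝ)) hq]
    · rwa [Finset.mul_prod_erase d (fun r : ℕ => (r : ℝ)) hq]
  · intro r hr
    rw [Finset.mem_filter] at hr
    exact mem_primesIoc.2 ⟨hpr r hr.1, by exact_mod_cast hr.2, (mem_primesIoc.1 (hs hr.1)).2.2⟩
  · ext r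
    simp only [Finset.mem_insert, Finset.mem_union, Finset.mem_filter]
    constructor
    · intro hr
      have := hmin r hr
      rcases lt_trichotomy r q with h3 | h3 | h3
      · rcases this.eq_or_lt with h4 | h4
        · exact Or.inl h4.symm
        · exact Or.inr (Or.inr (Or.inl ⟨hr, h4, h3⟩))
      · exact Or.inr (Or.inl h3)
      · exact Or.inr (Or.inr (Or.inr ⟨hr, h3⟩))
    · rintro (rfl | rfl | h3 | h3)
      · exact hp
      · exact hds hq
      · exact h3.1
      · exact h3.1

lemma exists_sum_straddles_le_topSum : ∃ C > 0, ∀ R x y : ℝ, 2 ≤ y → y ≤ R → R ≤ x →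
    ∑ s ∈ (primesIoc 0 x).powerset with Straddles R s, ∏ r ∈ s, wt r ≤
      C * (Real.log x * (1 / Real.log y + ∑ p ∈ primesIoc 0 y, wt p *
        ∑ a ∈ (primesIoc p R).powerset, (∏ i ∈ a, wt i) * topSum R p a)) := by
  obtain ⟨C, hC, hpow⟩ := exists_sum_powerset_le
  refine ⟨C, hC, fun R x y hy hyR hRx => ?_⟩
  have hyx := hyR.trans hRx
  set f : Finset ℕ → ℝ := fun s => ∏ r ∈ s, wt r with hf
  have hf0 : ∀ s, 0 ≤ f s := prod_wt_nonneg
  have hb : ∀ p ∈ primesIoc 0 y, ∀ a ∈ (primesIoc p R).powerset,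
      ∀ q ∈ (primesIoc p R).filter (IsTopPrime R p a), ∑ b ∈ (primesIoc q x).powerset,
        ∑ s ∈ ({insert p (insert q (a ∪ b))} : Finset (Finset ℕ)), f s ≤
        C * Real.log x * (wt p * (f a * (wt q / Real.log q))) := by
    intro p hp a ha q hq
    obtain ⟨hq1, hq2⟩ := Finset.mem_filter.1 hq
    have hpq : p < q := by exact_mod_cast (mem_primesIoc.1 hq1).2.1
    have hap : ∀ r ∈ a, p < r := fun r hr => by
      exact_mod_cast (mem_primesIoc.1 (Finset.mem_powerset.1 ha hr)).2.1
    have h1 := hpow q x (two_le_of_mem hq1) ((mem_primesIoc.1 hq1).2.2.trans hRx)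
    calc _ = ∑ b ∈ (primesIoc q x).powerset, wt p * wt q * f a * ∏ r ∈ b, wt r := by
          refine Finset.sum_congr rfl fun b hbm => ?_
          have hqb : ∀ r ∈ b, q < r := fun r hr => by
            exact_mod_cast (mem_primesIoc.1 (Finset.mem_powerset.1 hbm hr)).2.1
          rw [Finset.sum_singleton, hf]
          simp only
          rw [Finset.prod_insert, Finset.prod_insert, Finset.prod_union]
          · ring
          · rw [Finset.disjoint_left]
            intro r h2 h3
            exact absurd (hq2.1 r h2) (hqb r h3).not_gt
          · rw [Finset.mem_union]
            rintro (h2 | h2)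
            · exact lt_irrefl _ (hq2.1 q h2)
            · exact lt_irrefl _ (hqb q h2)
          · rw [Finset.mem_insert, Finset.mem_union]
            rintro (h2 | h2 | h2)
            · omega
            · exact lt_irrefl _ (hap p h2)
            · exact absurd (hqb p h2) (by omega)
      _ = wt p * wt q * f a * ∑ b ∈ (primesIoc q x).powerset, ∏ r ∈ b, wt r := by
          rw [Finset.mul_sum]
      _ ≤ wt p * wt q * f a * (C * (Real.log x / Real.log q)) :=
          mul_le_mul_of_nonneg_left h1
            (mul_nonneg (mul_nonneg (wt_nonneg p) (wt_nonneg q)) (hf0 a))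
      _ = _ := by ring
  calc _ ≤ ∑ s ∈ (primesIoc y x).powerset ∪
      (primesIoc 0 y).biUnion fun p => (primesIoc p R).powerset.biUnion fun a =>
        ((primesIoc p R).filter (IsTopPrime R p a)).biUnion fun q =>
          ((primesIoc q x).powerset.biUnion fun b => {insert p (insert q (a ∪ b))}), f s := by
        refine Finset.sum_le_sum_of_subset_of_nonneg (fun s hs => ?_) fun s _ _ => hf0 s
        rw [Finset.mem_filter, Finset.mem_powerset] at hs
        exact mem_of_straddles hyR hs.1 hs.2
    _ ≤ ∑ s ∈ (primesIoc y x).powerset, f s + ∑ s ∈ (primesIoc 0 y).biUnion fun p =>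
        (primesIoc p R).powerset.biUnion fun a =>
        ((primesIoc p R).filter (IsTopPrime R p a)).biUnion fun q =>
          ((primesIoc q x).powerset.biUnion fun b => {insert p (insert q (a ∪ b))}), f s := by
        rw [← Finset.sum_union_inter]
        exact le_add_of_nonneg_right (Finset.sum_nonneg fun s _ => hf0 s)
    _ ≤ C * (Real.log x / Real.log y) + ∑ p ∈ primesIoc 0 y, ∑ a ∈ (primesIoc p R).powerset,
        ∑ q ∈ (primesIoc p R).filter (IsTopPrime R p a),
          C * Real.log x * (wt p * (f a * (wt q / Real.log q))) := by
        refine add_le_add (hpow y x hy hyx) ?_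
        refine (sum_biUnion_le _ _ hf0).trans (Finset.sum_le_sum fun p hp => ?_)
        refine (sum_biUnion_le _ _ hf0).trans (Finset.sum_le_sum fun a ha => ?_)
        refine (sum_biUnion_le _ _ hf0).trans (Finset.sum_le_sum fun q hq => ?_)
        exact (sum_biUnion_le _ _ hf0).trans (hb p hp a ha q hq)
    _ = _ := by
        simp only [← Finset.mul_sum, hf, topSum]
        ring

lemma sum_primesIoc_zero_le {n : ℕ} {y : ℝ} (hy : y ≤ blk n) (f : ℕ → ℝ) (hf : ∀ p, 0 ≤ f p) :
    ∑ p ∈ primesIoc 0 y, f p ≤ f 2 + ∑ j ∈ Finset.range n, ∑ p ∈ blockPrimes j, f p := by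
  rw [← sum_primesIoc_blk]
  have h2 : 2 ∉ primesIoc 2 (blk n : ℝ) := fun h => by
    have := (mem_primesIoc.1 h).2.1
    norm_num at this
  rw [← Finset.sum_insert h2]
  refine Finset.sum_le_sum_of_subset_of_nonneg (fun p hp => ?_) fun p _ _ => hf p
  have hp' := mem_primesIoc.1 hp
  rw [Finset.mem_insert]
  rcases hp'.1.two_le.eq_or_lt with h | h
  · exact Or.inl h.symm
  · exact Or.inr (mem_primesIoc.2 ⟨hp'.1, by exact_mod_cast h, hp'.2.2.trans hy⟩)

theorem exists_sum_straddles_le : ∃ C > 0, ∀ (R x : ℝ) (v : ℕ), 16 ≤ R → R ≤ x →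
    (blk v : ℝ) ≤ R → R ≤ blk (v + 1) →
    ∑ s ∈ (primesIoc 0 x).powerset with Straddles R s, ∏ r ∈ s, wt r ≤
      C * (Real.log x * (1 / Real.log R + (Real.exp 1 * Real.log 2 / 2) ^ v * kap v)) := by
  obtain ⟨C1, hC1, h1⟩ := exists_sum_straddles_le_topSum
  obtain ⟨C2, hC2, h2⟩ := exists_sum_topSum_le
  have hθ : 1 < Real.exp 1 * Real.log 2 := by
    have := log_two_bounds.1
    have := exp_one_bounds.1
    nlinarith
  set θ := Real.exp 1 * Real.log 2 with hθd
  have hθ0 : 0 < θ := by linarith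
  obtain ⟨C3, hC3, hconv⟩ := exists_geom_kap_conv (ρ := 1 / θ) (by positivity)
    (by rw [div_lt_one hθ0]; exact hθ)
  refine ⟨C1 * (4 + C2 * (1 + C3)), by positivity, fun R x v hR hRx hvR hRv => ?_⟩
  set y : ℝ := R ^ (1 / 4 : ℝ) with hy
  have hR0 : 0 < R := by linarith
  have hy4 : y ^ 4 = R := by
    rw [hy, ← Real.rpow_natCast, ← Real.rpow_mul hR0.le]
    norm_num
  have hy2 : 2 ≤ y := by
    by_contra h
    push Not at h
    have : y ^ 4 < 2 ^ 4 := pow_lt_pow_left₀ h (by positivity) (by norm_num)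
    rw [hy4] at this
    linarith
  have hyR : y ≤ R := by
    rw [← hy4]
    exact le_self_pow₀ (by linarith) (by norm_num)
  have hly : 0 < Real.log y := Real.log_pos (by linarith)
  have hlR : Real.log R = 4 * Real.log y := by
    rw [← hy4, Real.log_pow]
    norm_num
  have hlx : 0 ≤ Real.log x := Real.log_nonneg (by linarith)
  set T : ℕ → ℝ := fun p => ∑ a ∈ (primesIoc p R).powerset, (∏ i ∈ a, wt i) * topSum R p a with hT
  have hT0 : ∀ p, 0 ≤ T p := fun p =>
    Finset.sum_nonneg fun a _ => mul_nonneg (prod_wt_nonneg a) (topSum_nonneg R p a)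
  set g : ℕ → ℝ := fun p => if (p : ℝ) ≤ y then wt p * T p else 0 with hg
  have hg0 : ∀ p, 0 ≤ g p := fun p => by
    rw [hg]
    simp only
    split_ifs
    · exact mul_nonneg (wt_nonneg p) (hT0 p)
    · exact le_rfl
  have hK0 : ∀ j, 0 ≤ C2 * ((1 / 2) ^ v * (θ ^ (v - j) * kap (v - j))) := fun j => by
    have := kap_pos (v - j)
    positivity
  have hbl : ∀ j ≤ v, ∑ p ∈ blockPrimes j, g p ≤
      C2 * ((1 / 2) ^ v * (θ ^ (v - j) * kap (v - j))) := by
    intro j hj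
    have h3 : ∀ p ∈ blockPrimes j, g p ≤
        wt p * (C2 * ((1 / 2) ^ v * (θ ^ (v - j) * kap (v - j)))) := by
      intro p hp
      have hp' := mem_primesIoc.1 hp
      rw [hg]
      simp only
      split_ifs with h4
      · exact mul_le_mul_of_nonneg_left
          (h2 R y v j p hvR hRv hy2 hy4 hp'.1 h4 hj hp'.2.1.le hp'.2.2) (wt_nonneg p)
      · exact mul_nonneg (wt_nonneg p) (hK0 j)
    refine (Finset.sum_le_sum h3).trans ?_
    rw [← Finset.sum_mul]
    have h5 : ∑ p ∈ blockPrimes j, wt p ≤ 1 :=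
      (sum_wt_blockPrimes_le j).trans (by linarith [log_two_bounds.2])
    have := mul_le_mul_of_nonneg_right h5 (hK0 j)
    linarith
  have hg2 : g 2 ≤ C2 * ((1 / 2) ^ v * (θ ^ v * kap v)) := by
    have hb0 : (blk 0 : ℝ) = 2 := by norm_num [blk]
    have hb1 : ((2 : ℕ) : ℝ) ≤ blk (0 + 1) := by exact_mod_cast two_le_blk 1
    have h4 := h2 R y v 0 2 hvR hRv hy2 hy4 Nat.prime_two (by exact_mod_cast hy2) (Nat.zero_le v)
      (by rw [hb0]; norm_num) hb1
    rw [hg]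
    simp only
    rw [if_pos (by exact_mod_cast hy2), wt_eq le_rfl]
    norm_num at h4 ⊢
    exact h4
  have hsum : ∑ p ∈ primesIoc 0 y, wt p * T p ≤
      C2 * (1 + C3) * ((θ / 2) ^ v * kap v) := by
    calc _ = ∑ p ∈ primesIoc 0 y, g p := by
          refine Finset.sum_congr rfl fun p hp => ?_
          rw [hg]
          simp only
          rw [if_pos (mem_primesIoc.1 hp).2.2]
      _ ≤ _ := sum_primesIoc_zero_le (hyR.trans hRv) g hg0
      _ ≤ C2 * ((1 / 2) ^ v * (θ ^ v * kap v)) + ∑ j ∈ Finset.range (v + 1),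
          C2 * ((1 / 2) ^ v * (θ ^ (v - j) * kap (v - j))) :=
          add_le_add hg2 (Finset.sum_le_sum fun j hj =>
            hbl j (Nat.lt_succ_iff.1 (Finset.mem_range.1 hj)))
      _ = C2 * ((1 / 2) ^ v * (θ ^ v * kap v)) + C2 * ((1 / 2) ^ v * θ ^ v) *
          ∑ j ∈ Finset.range (v + 1), (1 / θ) ^ j * kap (v - j) := by
          rw [Finset.mul_sum]
          congr 1
          refine Finset.sum_congr rfl fun j hj => ?_
          rw [pow_sub₀ θ hθ0.ne' (Nat.lt_succ_iff.1 (Finset.mem_range.1 hj)), one_div θ, inv_pow]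
          ring
      _ ≤ C2 * ((1 / 2) ^ v * (θ ^ v * kap v)) + C2 * ((1 / 2) ^ v * θ ^ v) * (C3 * kap v) := by
          gcongr
          exact hconv v
      _ = _ := by
          rw [div_pow, div_pow, one_pow]
          ring
  refine (h1 R x y hy2 hyR hRx).trans ?_
  rw [mul_assoc C1]
  refine mul_le_mul_of_nonneg_left ?_ hC1.le
  rw [← mul_assoc, mul_comm (_ + _) (Real.log x), mul_assoc]
  refine mul_le_mul_of_nonneg_left ?_ hlx
  have hM : 0 ≤ (θ / 2) ^ v * kap v := mul_nonneg (by positivity) (kap_pos v).le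
  have h6 : 1 / Real.log y = 4 * (1 / Real.log R) := by
    rw [hlR]
    field_simp
  have h7 : 0 ≤ 1 / Real.log R := by rw [hlR]; positivity
  rw [h6]
  have h8 : 0 ≤ C2 * (1 + C3) * (1 / Real.log R) := by positivity
  nlinarith

/-- The exponent of `log R` in the density. -/
noncomputable def supportExponent : ℝ := 1 - (1 + Real.log (Real.log 2)) / Real.log 2

/-- The order of magnitude of the density. -/
noncomputable def supportDensity (R : ℝ) : ℝ :=
  Real.log R ^ (-supportExponent) * Real.log (Real.log R) ^ (-(3 / 2) : ℝ)

lemma two_pow_rpow_neg_supportExponent (v : ℕ) :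
    ((2 : ℝ) ^ v) ^ (-supportExponent) = (Real.exp 1 * Real.log 2 / 2) ^ v := by
  have ht : 0 < Real.log 2 := Real.log_pos (by norm_num)
  have h1 : Real.exp 1 * Real.log 2 / 2 = (2 : ℝ) ^ (-supportExponent) := by
    rw [Real.rpow_def_of_pos (by norm_num), supportExponent]
    have : Real.log 2 * -(1 - (1 + Real.log (Real.log 2)) / Real.log 2) =
        1 + Real.log (Real.log 2) - Real.log 2 := by
      field_simp
      ring
    rw [this, Real.exp_sub, Real.exp_add, Real.exp_log ht, Real.exp_log (by norm_num)]
  rw [h1, ← Real.rpow_natCast, ← Real.rpow_mul (by norm_num), ← Real.rpow_natCast,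
    ← Real.rpow_mul (by norm_num), mul_comm]

lemma supportExponent_nonneg : 0 ≤ supportExponent := by
  have h := two_pow_rpow_neg_supportExponent 1
  by_contra h0
  push Not at h0
  have h1 : (1 : ℝ) < (2 ^ 1 : ℝ) ^ (-supportExponent) :=
    Real.one_lt_rpow (by norm_num) (by linarith)
  rw [h, pow_one] at h1
  have := log_two_bounds
  have := exp_one_bounds
  nlinarith

lemma one_le_log_log {R : ℝ} (hR : 16 ≤ R) : 1 ≤ Real.log (Real.log R) := by
  have h1 : Real.log 16 ≤ Real.log R := Real.log_le_log (by norm_num) hR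
  have h2 : Real.log 16 = 4 * Real.log 2 := by
    rw [show (16 : ℝ) = 2 ^ 4 by norm_num, Real.log_pow]
    norm_num
  have h3 := log_two_bounds.1
  have h4 := exp_one_bounds.2
  rw [Real.le_log_iff_exp_le (by linarith)]
  linarith

lemma supportDensity_pos {R : ℝ} (hR : 16 ≤ R) : 0 < supportDensity R := by
  have h1 := one_le_log_log hR
  have h2 : 0 < Real.log R := Real.log_pos (by linarith)
  exact mul_pos (Real.rpow_pos_of_pos h2 _) (Real.rpow_pos_of_pos (by linarith) _)

lemma exists_supportDensity_bounds : ∃ c C : ℝ, 0 < c ∧ 0 < C ∧ ∀ (R : ℝ) (v : ℕ), 16 ≤ R →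
    (blk v : ℝ) ≤ R → R ≤ blk (v + 1) →
    c * supportDensity R ≤ (Real.exp 1 * Real.log 2 / 2) ^ v * kap v ∧
    (Real.exp 1 * Real.log 2 / 2) ^ v * kap v ≤ C * supportDensity R := by
  obtain ⟨c, C, hc, hC, hblk⟩ := exists_log_blk_bounds
  have ht := log_two_bounds
  set t := Real.log 2 with htd
  set A : ℝ := |Real.log (2 * C)| + 1 with hA
  set B : ℝ := 1 / t + |Real.log c| / t + 1 with hB
  have ht0 : 0 < t := by linarith
  have hA0 : 0 < A := by positivity
  have hB0 : 0 < B := by positivity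
  refine ⟨(c ^ (-supportExponent))⁻¹ * (B ^ (3 / 2 : ℝ))⁻¹,
    ((2 * C) ^ (-supportExponent))⁻¹ * (A ^ (-(3 / 2) : ℝ))⁻¹, by positivity, by positivity, ?_⟩
  intro R v hR hvR hRv
  have hll := one_le_log_log hR
  have hl0 : 0 < Real.log R := Real.log_pos (by linarith)
  have h1 : c * 2 ^ v ≤ Real.log R :=
    (hblk v).1.trans (Real.log_le_log (by linarith [two_le_blk_cast v]) hvR)
  have h2 : Real.log R ≤ 2 * C * 2 ^ v := by
    have := (Real.log_le_log (by linarith) hRv).trans (hblk (v + 1)).2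
    rw [pow_succ] at this
    linarith
  have hp : (0 : ℝ) < 2 ^ v := by positivity
  set L := Real.log (Real.log R) with hL
  have hL1 : L ≤ A * (v + 1) := by
    have h3 := Real.log_le_log hl0 h2
    rw [Real.log_mul (by positivity) (by positivity), Real.log_pow, ← htd, ← hL] at h3
    have := le_abs_self (Real.log (2 * C))
    have hv : (0 : ℝ) ≤ v := Nat.cast_nonneg v
    have h5 : 0 ≤ |Real.log (2 * C)| * v := by positivity
    rw [hA]
    nlinarith
  have hL2 : (v : ℝ) + 1 ≤ B * L := by
    have h3 := Real.log_le_log (by positivity) h1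
    rw [Real.log_mul (by positivity) (by positivity), Real.log_pow, ← htd, ← hL] at h3
    have := neg_abs_le (Real.log c)
    have h4 : (v : ℝ) ≤ (L + |Real.log c|) / t := by
      rw [le_div_iff₀ ht0]
      linarith
    have h5 : |Real.log c| / t * 1 ≤ |Real.log c| / t * L :=
      mul_le_mul_of_nonneg_left hll (by positivity)
    rw [hB]
    have h6 : (L + |Real.log c|) / t = 1 / t * L + |Real.log c| / t := by ring
    nlinarith
  have hδ := supportExponent_nonneg
  have hv0 : (0 : ℝ) < v + 1 := by positivity
  have hk1 : A ^ (-(3 / 2) : ℝ) * kap v ≤ L ^ (-(3 / 2) : ℝ) := by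
    rw [kap_eq_rpow, ← Real.mul_rpow hA0.le hv0.le]
    exact Real.rpow_le_rpow_of_nonpos (by linarith) hL1 (by norm_num)
  have hk2 : L ^ (-(3 / 2) : ℝ) ≤ B ^ (3 / 2 : ℝ) * kap v := by
    have h3 := Real.rpow_le_rpow_of_nonpos hv0 hL2 (z := -(3 / 2)) (by norm_num)
    rw [← kap_eq_rpow, Real.mul_rpow hB0.le (by linarith), Real.rpow_neg hB0.le,
      inv_mul_le_iff₀ (by positivity)] at h3
    exact h3
  have hz1 : (2 * C) ^ (-supportExponent) * (Real.exp 1 * t / 2) ^ v ≤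
      Real.log R ^ (-supportExponent) := by
    rw [← two_pow_rpow_neg_supportExponent, ← Real.mul_rpow (by positivity) hp.le]
    exact Real.rpow_le_rpow_of_nonpos hl0 h2 (by linarith)
  have hz2 : Real.log R ^ (-supportExponent) ≤
      c ^ (-supportExponent) * (Real.exp 1 * t / 2) ^ v := by
    rw [← two_pow_rpow_neg_supportExponent, ← Real.mul_rpow hc.le hp.le]
    exact Real.rpow_le_rpow_of_nonpos (by positivity) h1 (by linarith)
  have hkp := kap_pos v
  rw [supportDensity, ← hL]
  constructor
  · rw [← mul_inv, inv_mul_le_iff₀ (by positivity)]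
    have := mul_le_mul hz2 hk2 (by positivity) (by positivity)
    linarith
  · rw [← mul_inv, ← div_eq_inv_mul, le_div_iff₀ (by positivity)]
    have := mul_le_mul hz1 hk1 (by positivity) (by positivity)
    linarith

lemma exists_inv_log_le : ∃ C > 0, ∀ (R : ℝ) (v : ℕ), (blk v : ℝ) ≤ R →
    1 / Real.log R ≤ C * ((Real.exp 1 * Real.log 2 / 2) ^ v * kap v) := by
  obtain ⟨c, D, hc, -, hblk⟩ := exists_log_blk_bounds
  have hθ : 1 < Real.exp 1 * Real.log 2 := by
    have := log_two_bounds.1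
    have := exp_one_bounds.1
    nlinarith
  set θ := Real.exp 1 * Real.log 2 with hθd
  have hθ0 : 0 < θ := by linarith
  obtain ⟨C, hC, hgeo⟩ := exists_sum_le_of_geom (β := 1 / θ) (by positivity)
    (by rw [div_lt_one hθ0]; exact hθ)
  refine ⟨C / c, by positivity, fun R v hvR => ?_⟩
  have h1 : c * 2 ^ v ≤ Real.log R :=
    (hblk v).1.trans (Real.log_le_log (by linarith [two_le_blk_cast v]) hvR)
  have h2 := hgeo {v}
  have h3 := kap_sub_le (le_refl v)
  have h4 : kap 0 = 1 := by norm_num [kap]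
  rw [Nat.sub_self, h4] at h3
  rw [Finset.sum_singleton, one_div_pow, mul_one_div, div_le_iff₀ (by positivity)] at h2
  have h5 := kap_pos v
  have h6 : 1 ≤ C * θ ^ v * kap v := h3.trans (mul_le_mul_of_nonneg_right h2 h5.le)
  calc 1 / Real.log R ≤ 1 / (c * 2 ^ v) := one_div_le_one_div_of_le (by positivity) h1
    _ = 1 / (c * 2 ^ v) * 1 := (mul_one _).symm
    _ ≤ 1 / (c * 2 ^ v) * (C * θ ^ v * kap v) := mul_le_mul_of_nonneg_left h6 (by positivity)
    _ = _ := by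
      rw [div_pow]
      field_simp

theorem exists_card_mobiusSum_ne_zero_le : ∃ C > 0, ∀ x R : ℝ, 16 ≤ R → R ^ (5 / 2 : ℝ) ≤ x →
    (((Finset.Icc 1 ⌊x⌋₊).filter (fun n => mobiusSum n R ≠ 0)).card : ℝ) ≤
      C * (x * supportDensity R) := by
  obtain ⟨C1, hC1, hcard⟩ := exists_card_mul_log_le
  obtain ⟨C2, hC2, hsum⟩ := exists_sum_straddles_le
  obtain ⟨C3, hC3, hinv⟩ := exists_inv_log_le
  obtain ⟨c, C4, -, hC4, hdens⟩ := exists_supportDensity_bounds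
  refine ⟨5 * C1 * (C3 + C2 * (C3 + 1)) * C4, by positivity, fun x R hR hx => ?_⟩
  have hR0 : 0 < R := by linarith
  have hRx : R ≤ x := by
    refine le_trans ?_ hx
    nth_rewrite 1 [← Real.rpow_one R]
    exact Real.rpow_le_rpow_of_exponent_le (by linarith) (by norm_num)
  have hx0 : 0 < x := by linarith
  obtain ⟨v, hvR, hRv⟩ := exists_blk_index (show 2 < R by linarith)
  have hlR : 0 < Real.log R := Real.log_pos (by linarith)
  have hlx : 5 / 2 * Real.log R ≤ Real.log x := by
    rw [← Real.log_rpow hR0]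
    exact Real.log_le_log (by positivity) hx
  have h1 := hcard (fun n => Straddles R n.primeFactors) x (R ^ 2) (by linarith)
    (one_le_pow₀ (by linarith)) (fun n h hn => straddles_hereditary (by linarith) hn h)
  have h2 := (sum_inv_straddles_le (Straddles R) x).trans (le_trans (le_of_eq
    (Finset.sum_congr rfl fun s hs => Finset.prod_congr rfl fun r hr => (wt_eq
      (prime_of_mem (Finset.mem_powerset.1 (Finset.mem_filter.1 hs).1 hr)).two_le).symm))
    (hsum R x v hR hRx hvR.le hRv))
  have h3 := hinv R v hvR.le
  have h4 := (hdens R v hR hvR.le hRv).2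
  set M := (Real.exp 1 * Real.log 2 / 2) ^ v * kap v with hM
  rw [Real.log_pow] at h1
  push_cast at h1
  have h5 : (((Finset.Icc 1 ⌊x⌋₊).filter (fun n => mobiusSum n R ≠ 0)).card : ℝ) ≤
      (((Finset.Icc 1 ⌊x⌋₊).filter (fun n => Straddles R n.primeFactors)).card : ℝ) := by
    refine Nat.cast_le.2 (Finset.card_le_card fun n hn => ?_)
    rw [Finset.mem_filter] at hn ⊢
    exact ⟨hn.1, straddles_of_mobiusSum_ne_zero hn.2⟩
  refine h5.trans ?_
  set N := (((Finset.Icc 1 ⌊x⌋₊).filter (fun n => Straddles R n.primeFactors)).card : ℝ) with hN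
  have hN0 : 0 ≤ N := Nat.cast_nonneg _
  have h6 : N * (Real.log x / 5) ≤
      C1 * (x * (1 + C2 * (Real.log x * (1 / Real.log R + M)))) := by
    refine (mul_le_mul_of_nonneg_left (by linarith) hN0).trans (h1.trans ?_)
    gcongr
  have hlx0 : 0 < Real.log x := by linarith
  have h7 : 1 ≤ Real.log x * (C3 * M) := by
    have : 1 ≤ Real.log x * (1 / Real.log R) := by
      rw [mul_one_div, le_div_iff₀ hlR]
      linarith
    exact this.trans (mul_le_mul_of_nonneg_left h3 hlx0.le)
  have h8 : N * (Real.log x / 5) ≤ C1 * (x * (Real.log x * (C3 * M) +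
      C2 * (Real.log x * (C3 * M + M)))) := by
    refine h6.trans ?_
    gcongr
  have h9 : N ≤ 5 * C1 * (C3 + C2 * (C3 + 1)) * (x * M) := by
    refine le_of_mul_le_mul_right ?_ (show 0 < Real.log x / 5 by linarith)
    linarith
  calc N ≤ 5 * C1 * (C3 + C2 * (C3 + 1)) * (x * (C4 * supportDensity R)) := by
        refine h9.trans ?_
        gcongr
    _ = _ := by ring

lemma sum_inv_multiples_le (A : Finset ℕ) {q : ℕ} (hq : q.Prime) (Y : ℕ) :
    ∑ n ∈ (Finset.Icc 1 Y).filter (fun n => (∀ p ∈ A, ¬ p ∣ n) ∧ q ∣ n), 1 / (n : ℝ) ≤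
      1 / q * ∑ n ∈ (Finset.Icc 1 Y).filter (fun n => ∀ p ∈ A, ¬ p ∣ n), 1 / (n : ℝ) := by
  have hq0 : 0 < q := hq.pos
  calc _ ≤ ∑ n ∈ ((Finset.Icc 1 Y).filter (fun n => ∀ p ∈ A, ¬ p ∣ n)).image (q * ·),
        1 / (n : ℝ) := by
        refine Finset.sum_le_sum_of_subset_of_nonneg (fun n hn => ?_) fun n _ _ => by positivity
        rw [Finset.mem_filter, Finset.mem_Icc] at hn
        obtain ⟨⟨h1, h2⟩, h3, m, rfl⟩ := hn
        rw [Finset.mem_image]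
        refine ⟨m, Finset.mem_filter.2 ⟨Finset.mem_Icc.2 ⟨Nat.pos_of_mul_pos_left h1, ?_⟩,
          fun p hp h => h3 p hp (h.mul_left q)⟩, rfl⟩
        exact le_trans (Nat.le_mul_of_pos_left m hq0) h2
    _ = _ := by
        rw [Finset.sum_image fun a _ b _ h => Nat.eq_of_mul_eq_mul_left hq0 h, Finset.mul_sum]
        refine Finset.sum_congr rfl fun m _ => ?_
        push_cast
        rw [one_div_mul_one_div]

lemma prod_mul_harmonic_le (A : Finset ℕ) (hA : ∀ p ∈ A, p.Prime) (Y : ℕ) :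
    (∏ p ∈ A, (1 - 1 / (p : ℝ))) * ∑ n ∈ Finset.Icc 1 Y, 1 / (n : ℝ) ≤
      ∑ n ∈ (Finset.Icc 1 Y).filter (fun n => ∀ p ∈ A, ¬ p ∣ n), 1 / (n : ℝ) := by
  induction A using Finset.induction_on with
  | empty => simp
  | insert q A hqA ih =>
    have hq := hA q (Finset.mem_insert_self q A)
    have h1 := sum_inv_multiples_le A hq Y
    have h2 := ih fun p hp => hA p (Finset.mem_insert_of_mem hp)
    have hq1 : 1 / (q : ℝ) ≤ 1 := by
      rw [div_le_one (by exact_mod_cast hq.pos)]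
      exact_mod_cast hq.one_lt.le
    have h3 := mul_le_mul_of_nonneg_left h2 (sub_nonneg.2 hq1)
    have h4 := Finset.sum_filter_add_sum_filter_not
      ((Finset.Icc 1 Y).filter (fun n => ∀ p ∈ A, ¬ p ∣ n)) (fun n => q ∣ n)
      (fun n : ℕ => 1 / (n : ℝ))
    rw [Finset.filter_filter, Finset.filter_filter] at h4
    have h5 : (Finset.Icc 1 Y).filter (fun n => ∀ p ∈ insert q A, ¬ p ∣ n) =
        (Finset.Icc 1 Y).filter (fun n => (∀ p ∈ A, ¬ p ∣ n) ∧ ¬ q ∣ n) := by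
      refine Finset.filter_congr fun n _ => ?_
      rw [Finset.forall_mem_insert, and_comm]
    rw [Finset.prod_insert hqA, h5, mul_assoc]
    linarith

lemma exists_prod_one_sub_inv_ge : ∃ c > 0, ∀ z : ℝ, 2 ≤ z →
    c / Real.log z ≤ ∏ p ∈ primesIoc 0 z, (1 - 1 / (p : ℝ)) := by
  obtain ⟨C, hC, hw⟩ := exists_prod_window
  have ht : 0 < Real.log 2 := Real.log_pos (by norm_num)
  refine ⟨Real.log 2 / (2 * C), by positivity, fun z hz => ?_⟩
  have hlz : 0 < Real.log z := Real.log_pos (by linarith)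
  have h1 := hw 2 z le_rfl hz
  have h2 : primesIoc 0 z = insert 2 (primesIoc 2 z) := by
    ext p
    simp only [Finset.mem_insert, mem_primesIoc]
    constructor
    · rintro ⟨hp, -, h⟩
      rcases hp.two_le.eq_or_lt with h3 | h3
      · exact Or.inl h3.symm
      · exact Or.inr ⟨hp, by exact_mod_cast h3, h⟩
    · rintro (rfl | ⟨hp, h3, h4⟩)
      · exact ⟨Nat.prime_two, by norm_num, by exact_mod_cast hz⟩
      · exact ⟨hp, by linarith, h4⟩
  have h3 : 2 ∉ primesIoc 2 z := fun h => by
    have := (mem_primesIoc.1 h).2.1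
    norm_num at this
  rw [h2, Finset.prod_insert h3]
  have h4 : ∏ p ∈ primesIoc 2 z, (1 - 1 / (p : ℝ)) =
      (∏ p ∈ primesIoc 2 z, (1 + 1 / ((p : ℝ) - 1)))⁻¹ := by
    rw [← Finset.prod_inv_distrib]
    refine Finset.prod_congr rfl fun p hp => ?_
    have := two_le_of_mem hp
    have h5 : (p : ℝ) - 1 ≠ 0 := by linarith
    have h6 : (p : ℝ) ≠ 0 := by linarith
    field_simp
    ring_nf
    field_simp
  have hpos : 0 < ∏ p ∈ primesIoc 2 z, (1 + 1 / ((p : ℝ) - 1)) :=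
    Finset.prod_pos fun p hp => by
      have := two_le_of_mem hp
      have : 0 ≤ 1 / ((p : ℝ) - 1) := div_nonneg zero_le_one (by linarith)
      linarith
  rw [h4]
  calc Real.log 2 / (2 * C) / Real.log z = 1 / 2 * (C * (Real.log z / Real.log 2))⁻¹ := by
        field_simp
    _ ≤ 1 / 2 * (∏ p ∈ primesIoc 2 z, (1 + 1 / ((p : ℝ) - 1)))⁻¹ := by
        gcongr
    _ = _ := by norm_num

/-- A number is `z`-rough if all its prime factors exceed `z`. -/
def Rough (z : ℝ) (n : ℕ) : Prop := ∀ p : ℕ, p.Prime → p ∣ n → z < p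

lemma exists_sum_inv_rough_ge : ∃ c > 0, ∀ z Y : ℝ, 2 ≤ z → 1 ≤ Y →
    c / Real.log z * Real.log Y ≤ ∑ n ∈ (Finset.Icc 1 ⌊Y⌋₊).filter (Rough z), 1 / (n : ℝ) := by
  obtain ⟨c, hc, hprod⟩ := exists_prod_one_sub_inv_ge
  refine ⟨c, hc, fun z Y hz hY => ?_⟩
  have hlz : 0 < Real.log z := Real.log_pos (by linarith)
  have h1 := prod_mul_harmonic_le (primesIoc 0 z) (fun p hp => prime_of_mem hp) ⌊Y⌋₊
  have h2 : (Finset.Icc 1 ⌊Y⌋₊).filter (fun n => ∀ p ∈ primesIoc 0 z, ¬ p ∣ n) =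
      (Finset.Icc 1 ⌊Y⌋₊).filter (Rough z) := by
    refine Finset.filter_congr fun n _ => ?_
    constructor
    · intro h p hp hpn
      by_contra hzp
      exact h p (mem_primesIoc.2 ⟨hp, by exact_mod_cast hp.pos, not_lt.1 hzp⟩) hpn
    · intro h p hp hpn
      have := mem_primesIoc.1 hp
      linarith [h p this.1 hpn, this.2.2]
  rw [h2] at h1
  have h3 : Real.log Y ≤ ∑ n ∈ Finset.Icc 1 ⌊Y⌋₊, 1 / (n : ℝ) := by
    have h4 := log_add_one_le_harmonic ⌊Y⌋₊
    have h5 : Real.log Y ≤ Real.log (⌊Y⌋₊ + 1 : ℕ) := by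
      refine Real.log_le_log (by linarith) ?_
      push_cast
      exact (Nat.lt_floor_add_one Y).le
    refine h5.trans (h4.trans (le_of_eq ?_))
    rw [harmonic_eq_sum_Icc]
    push_cast
    simp only [one_div]
  refine le_trans (mul_le_mul (hprod z hz) h3 (Real.log_nonneg hY) ?_) h1
  exact le_trans (by positivity) (hprod z hz)

lemma exists_sum_log_window_ge : ∃ K : ℕ, K.Prime ∧ ∀ y z : ℝ, 1 ≤ y → K * y ≤ z →
    1 ≤ ∑ p ∈ primesIoc (z / K) z, Real.log p / p := by
  obtain ⟨C, hC, hw⟩ := exists_log_window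
  obtain ⟨K, hK, hKp⟩ := Nat.exists_infinite_primes ⌈Real.exp (C + 1)⌉₊
  have h1 : Real.exp (C + 1) ≤ K := (Nat.le_ceil _).trans (by exact_mod_cast hK)
  have hK0 : (0 : ℝ) < K := by exact_mod_cast hKp.pos
  have hK1 : (1 : ℝ) ≤ K := by exact_mod_cast hKp.one_lt.le
  refine ⟨K, hKp, fun y z hy hyz => ?_⟩
  have hz : 0 < z := by nlinarith
  have h2 : 1 ≤ z / K := by
    rw [le_div_iff₀ hK0]
    nlinarith
  have h3 := (hw (z / K) z (by linarith) (div_le_self hz.le hK1)).2 h2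
  have h4 : z / (z / K) = K := by field_simp
  rw [h4] at h3
  have h5 : C + 1 ≤ Real.log K := by rwa [Real.le_log_iff_exp_le hK0]
  linarith

lemma rough_mul_prime {z : ℝ} {m r : ℕ} (hm : Rough z m) (hr : r.Prime) (hz : z < r) :
    Rough z (m * r) := fun p hp h => by
  rcases hp.dvd_mul.1 h with h1 | h1
  · exact hm p hp h1
  · rwa [(Nat.prime_dvd_prime_iff_eq hp hr).1 h1]

theorem exists_rough_card_ge : ∃ c > 0, ∃ z₀ ≥ 2, ∀ z X : ℝ, z₀ ≤ z → z ^ (6 / 5 : ℝ) ≤ X →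
    c * (X / Real.log z) ≤ (((Finset.Icc 1 ⌊X⌋₊).filter (Rough z)).card : ℝ) := by
  obtain ⟨c, hc, hsum⟩ := exists_sum_inv_rough_ge
  obtain ⟨K, hK, hwin⟩ := exists_sum_log_window_ge
  have hK0 : (0 : ℝ) < K := by exact_mod_cast hK.pos
  have hK1 : (1 : ℝ) ≤ K := by exact_mod_cast hK.one_lt.le
  refine ⟨c / (12 * K), by positivity, max 2 ((K : ℝ) ^ (10 : ℝ)), le_max_left _ _,
    fun z X hz hX => ?_⟩
  have hz2 : 2 ≤ z := (le_max_left _ _).trans hz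
  have hzK : (K : ℝ) ^ (10 : ℝ) ≤ z := (le_max_right _ _).trans hz
  have hz0 : 0 < z := by linarith
  have hlz : 0 < Real.log z := Real.log_pos (by linarith)
  have hlK : 10 * Real.log K ≤ Real.log z := by
    rw [← Real.log_rpow hK0]
    exact Real.log_le_log (by positivity) hzK
  have hX0 : 0 < X := lt_of_lt_of_le (by positivity) hX
  have hlX : 6 / 5 * Real.log z ≤ Real.log X := by
    rw [← Real.log_rpow hz0]
    exact Real.log_le_log (by positivity) hX
  set Y : ℝ := X / (K * z) with hY
  have hlY : Real.log X / 12 ≤ Real.log Y := by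
    rw [hY, Real.log_div hX0.ne' (by positivity), Real.log_mul hK0.ne' hz0.ne']
    linarith
  have hY1 : 1 ≤ Y := by
    have : 0 < Real.log Y := by linarith
    by_contra h
    push Not at h
    exact absurd (Real.log_nonpos (by positivity) h.le) (by linarith)
  set S := (Finset.Icc 1 ⌊X⌋₊).filter (Rough z) with hS
  set M := (Finset.Icc 1 ⌊Y⌋₊).filter (Rough z) with hM
  have h1 : ∑ n ∈ S, ∑ r ∈ n.primeFactors, Real.log r ≤ S.card * Real.log X := by
    rw [← nsmul_eq_mul, ← Finset.sum_const]
    refine Finset.sum_le_sum fun n hn => ?_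
    obtain ⟨h2, -⟩ := Finset.mem_filter.1 hn
    rw [Finset.mem_Icc] at h2
    refine (sum_log_primeFactors_le (by omega)).trans (Real.log_le_log (by exact_mod_cast h2.1) ?_)
    exact (Nat.le_floor_iff hX0.le).1 h2.2
  have h2 : ∑ m ∈ M, ∑ r ∈ primesIoc z (X / m), Real.log r ≤
      ∑ n ∈ S, ∑ r ∈ n.primeFactors, Real.log r := by
    rw [Finset.sum_sigma', Finset.sum_sigma']
    rw [← Finset.sum_image (g := fun a : (_ : ℕ) × ℕ => (⟨a.1 * a.2, a.2⟩ : (_ : ℕ) × ℕ))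
      (f := fun a : (_ : ℕ) × ℕ => Real.log a.2)]
    · refine Finset.sum_le_sum_of_subset_of_nonneg (fun b hb => ?_)
        fun b _ _ => Real.log_natCast_nonneg _
      obtain ⟨⟨m, r⟩, ha, rfl⟩ := Finset.mem_image.1 hb
      obtain ⟨hm, hr⟩ := Finset.mem_sigma.1 ha
      obtain ⟨hr1, hr2, hr3⟩ := mem_primesIoc.1 hr
      obtain ⟨hm1, hm2⟩ := Finset.mem_filter.1 hm
      have hm0 : 0 < m := (Finset.mem_Icc.1 hm1).1
      have hmr : m * r ≠ 0 := mul_ne_zero hm0.ne' hr1.ne_zero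
      refine Finset.mem_sigma.2 ⟨Finset.mem_filter.2 ⟨Finset.mem_Icc.2
        ⟨Nat.pos_of_ne_zero hmr, Nat.le_floor ?_⟩, rough_mul_prime hm2 hr1 hr2⟩,
        Nat.mem_primeFactors.2 ⟨hr1, dvd_mul_left r m, hmr⟩⟩
      rw [le_div_iff₀ (by exact_mod_cast hm0)] at hr3
      push_cast
      simp only at hr3 ⊢
      linarith
    · rintro ⟨m, r⟩ ha ⟨m', r'⟩ - heq
      obtain ⟨-, hr⟩ := Finset.mem_sigma.1 ha
      simp only [Sigma.mk.injEq, heq_eq_eq] at heq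
      obtain ⟨h5, rfl⟩ := heq
      simp only at h5 hr
      rw [Nat.eq_of_mul_eq_mul_right (prime_of_mem hr).pos h5]
  have h3 : X / K * ∑ m ∈ M, 1 / (m : ℝ) ≤ ∑ m ∈ M, ∑ r ∈ primesIoc z (X / m), Real.log r := by
    rw [Finset.mul_sum]
    refine Finset.sum_le_sum fun m hm => ?_
    obtain ⟨h4, -⟩ := Finset.mem_filter.1 hm
    rw [Finset.mem_Icc] at h4
    have hm0 : (0 : ℝ) < m := by exact_mod_cast h4.1
    have hmY : (m : ℝ) ≤ Y := (Nat.le_floor_iff (by linarith)).1 h4.2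
    rw [hY, le_div_iff₀ (by positivity)] at hmY
    have h5 : K * z ≤ X / m := by
      rw [le_div_iff₀ hm0]
      linarith
    have h6 := hwin z (X / m) (by linarith) h5
    have h7 : z ≤ X / m / K := by
      rw [le_div_iff₀ hK0]
      linarith
    have hXm : 0 < X / m / K := by positivity
    calc X / K * (1 / m) = X / m / K * 1 := by ring
      _ ≤ X / m / K * ∑ p ∈ primesIoc (X / m / K) (X / m), Real.log p / p :=
          mul_le_mul_of_nonneg_left h6 hXm.le
      _ ≤ ∑ p ∈ primesIoc (X / m / K) (X / m), Real.log p := by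
          rw [Finset.mul_sum]
          refine Finset.sum_le_sum fun p hp => ?_
          have hp' := (mem_primesIoc.1 hp).2.1
          have hlp : 0 ≤ Real.log p := Real.log_natCast_nonneg p
          have hp0 : (0 : ℝ) < p := hXm.trans hp'
          rw [mul_div_assoc', div_le_iff₀ hp0, mul_comm]
          exact mul_le_mul_of_nonneg_left hp'.le hlp
      _ ≤ _ := by
          refine Finset.sum_le_sum_of_subset_of_nonneg (fun p hp => ?_)
            fun p _ _ => Real.log_natCast_nonneg p
          have hp' := mem_primesIoc.1 hp
          exact mem_primesIoc.2 ⟨hp'.1, h7.trans_lt hp'.2.1, hp'.2.2⟩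
  have h4 := hsum z Y hz2 hY1
  have h5 : X / K * (c / Real.log z * (Real.log X / 12)) ≤ S.card * Real.log X := by
    refine le_trans ?_ (h3.trans (h2.trans h1))
    refine mul_le_mul_of_nonneg_left (le_trans ?_ h4) (by positivity)
    exact mul_le_mul_of_nonneg_left hlY (by positivity)
  refine le_of_mul_le_mul_right (le_trans (le_of_eq ?_) h5) (show 0 < Real.log X by linarith)
  field_simp

/-- The products over `d` and `e` differ by a factor less than `K`. -/
def Near (K : ℝ) (d e : Finset ℕ) : Prop :=
  ∏ r ∈ e, (r : ℝ) < K * ∏ r ∈ d, (r : ℝ) ∧ ∏ r ∈ d, (r : ℝ) < K * ∏ r ∈ e, (r : ℝ)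

/-- The subsets of `a` that are near no other subset of `a`. -/
noncomputable def isolatedSets (K : ℝ) (a : Finset ℕ) : Finset (Finset ℕ) :=
  a.powerset.filter fun d => ∀ e ⊆ a, Near K d e → e = d

noncomputable def nearPairs (K : ℝ) (a : Finset ℕ) : Finset (Finset ℕ × Finset ℕ) :=
  (a.powerset ×ˢ a.powerset).filter fun y => y.1 ≠ y.2 ∧ Near K y.1 y.2

lemma two_pow_card_le (K : ℝ) (a : Finset ℕ) :
    2 ^ a.card ≤ (isolatedSets K a).card + (nearPairs K a).card := by
  rw [← Finset.card_powerset, ← Finset.card_filter_add_card_filter_not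
    (fun d => ∀ e ⊆ a, Near K d e → e = d) (s := a.powerset)]
  refine Nat.add_le_add le_rfl ((Finset.card_le_card fun d hd => ?_).trans
    (Finset.card_image_le (f := Prod.fst)))
  rw [Finset.mem_filter] at hd
  obtain ⟨h1, h2⟩ := hd
  push Not at h2
  obtain ⟨e, he, h3, h4⟩ := h2
  exact Finset.mem_image.2 ⟨(d, e), Finset.mem_filter.2
    ⟨Finset.mem_product.2 ⟨h1, Finset.mem_powerset.2 he⟩, h4.symm, h3⟩, rfl⟩

noncomputable def windowPrimes (R K : ℝ) (a : Finset ℕ) : Finset ℕ :=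
  (isolatedSets K a).biUnion fun d =>
    primesIoc (R / (∏ r ∈ d, (r : ℝ)) / K) (R / ∏ r ∈ d, (r : ℝ))

lemma sum_windowPrimes_ge {K : ℕ} (hwin : ∀ y z : ℝ, 1 ≤ y → K * y ≤ z →
    1 ≤ ∑ p ∈ primesIoc (z / K) z, Real.log p / p) (hK : 1 ≤ K) {R : ℝ} (hR : 1 < R)
    {a : Finset ℕ} (ha : ∀ r ∈ a, r.Prime) (haR : K * ∏ r ∈ a, (r : ℝ) ≤ R) :
    ((isolatedSets K a).card : ℝ) * (1 / Real.log R) ≤ ∑ P ∈ windowPrimes R K a, 1 / (P : ℝ) := by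
  have hone : ∀ d ⊆ a, 1 ≤ ∏ r ∈ d, (r : ℝ) := fun d hd =>
    Finset.one_le_prod fun r hr => by exact_mod_cast (ha r (hd hr)).one_lt.le
  have hK0 : (0 : ℝ) < K := by exact_mod_cast hK
  have hlR : 0 < Real.log R := Real.log_pos hR
  have hdisj : ∀ d ∈ isolatedSets K a, ∀ e ∈ isolatedSets K a,
      K * ∏ r ∈ d, (r : ℝ) ≤ ∏ r ∈ e, (r : ℝ) →
      Disjoint (primesIoc (R / (∏ r ∈ d, (r : ℝ)) / K) (R / ∏ r ∈ d, (r : ℝ)))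
        (primesIoc (R / (∏ r ∈ e, (r : ℝ)) / K) (R / ∏ r ∈ e, (r : ℝ))) := by
    intro d hd e he h
    refine (primesIoc_disjoint ?_).symm
    rw [div_div, mul_comm _ (K : ℝ)]
    have := hone d (Finset.mem_powerset.1 (Finset.mem_filter.1 hd).1)
    gcongr
  rw [windowPrimes, Finset.sum_biUnion, ← nsmul_eq_mul, ← Finset.sum_const]
  · refine Finset.sum_le_sum fun d hd => ?_
    have hda := Finset.mem_powerset.1 (Finset.mem_filter.1 hd).1
    have h1 := hone d hda
    have h2 := prod_natCast_le_of_subset hda fun r hr => (ha r hr).one_lt.le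
    have h3 := hwin 1 (R / ∏ r ∈ d, (r : ℝ)) le_rfl (by
      rw [mul_one, le_div_iff₀ (by linarith)]
      exact le_trans (by gcongr) haR)
    rw [div_le_iff₀ hlR, Finset.sum_mul]
    refine h3.trans (Finset.sum_le_sum fun P hP => ?_)
    rw [one_div_mul_eq_div]
    have hP' := mem_primesIoc.1 hP
    have : Real.log P ≤ Real.log R := Real.log_le_log (by exact_mod_cast hP'.1.pos)
      (hP'.2.2.trans (div_le_self (by linarith) h1))
    gcongr
  · intro d hd e he hne
    simp only [Function.onFun]
    have hd' := Finset.mem_filter.1 hd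
    have he' := Finset.mem_filter.1 he
    have h : ¬ Near K d e := fun h =>
      hne (hd'.2 e (Finset.mem_powerset.1 he'.1) h).symm
    rw [Near, not_and_or] at h
    rcases h with h | h
    · exact hdisj d hd e he (not_lt.1 h)
    · exact (hdisj e he d hd (not_lt.1 h)).symm

/-- The shape of the integers counted in the lower bound. -/
structure IsFrame (R : ℝ) (K : ℕ) (a : Finset ℕ) (P : ℕ) : Prop where
  prime_K : K.Prime
  prime_a : ∀ r ∈ a, r.Prime
  notMem : K ∉ a
  sq_le : (K * ∏ r ∈ a, (r : ℝ)) ^ 2 ≤ R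
  mem : P ∈ windowPrimes R K a

namespace IsFrame

variable {R : ℝ} {K P b : ℕ} {a : Finset ℕ}

lemma one_le_prod (h : IsFrame R K a P) : 1 ≤ ∏ r ∈ a, (r : ℝ) :=
  Finset.one_le_prod fun r hr => by exact_mod_cast (h.prime_a r hr).one_lt.le

lemma one_lt_cast (h : IsFrame R K a P) : (1 : ℝ) < K := by exact_mod_cast h.prime_K.one_lt

lemma lt_P (h : IsFrame R K a P) : K * ∏ r ∈ a, (r : ℝ) < P := by
  obtain ⟨d, hd, hP⟩ := Finset.mem_biUnion.1 h.mem
  have hda := Finset.mem_powerset.1 (Finset.mem_filter.1 hd).1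
  have h1 : 1 ≤ ∏ r ∈ d, (r : ℝ) :=
    Finset.one_le_prod fun r hr => by exact_mod_cast (h.prime_a r (hda hr)).one_lt.le
  have h2 := prod_natCast_le_of_subset hda fun r hr => (h.prime_a r hr).one_lt.le
  refine lt_of_le_of_lt ?_ (mem_primesIoc.1 hP).2.1
  have hK := h.one_lt_cast
  have ha := h.one_le_prod
  rw [div_div, le_div_iff₀ (by positivity)]
  refine le_trans ?_ h.sq_le
  rw [sq, mul_comm (∏ r ∈ d, (r : ℝ))]
  gcongr

lemma prime_P (h : IsFrame R K a P) : P.Prime := by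
  obtain ⟨d, hd, hP⟩ := Finset.mem_biUnion.1 h.mem
  exact prime_of_mem hP

lemma P_le (h : IsFrame R K a P) : (P : ℝ) ≤ R := by
  obtain ⟨d, hd, hP⟩ := Finset.mem_biUnion.1 h.mem
  have hda := Finset.mem_powerset.1 (Finset.mem_filter.1 hd).1
  have h1 : 1 ≤ ∏ r ∈ d, (r : ℝ) :=
    Finset.one_le_prod fun r hr => by exact_mod_cast (h.prime_a r (hda hr)).one_lt.le
  exact (mem_primesIoc.1 hP).2.2.trans (div_le_self ((sq_nonneg _).trans h.sq_le) h1)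

lemma K_lt_P (h : IsFrame R K a P) : K < P := by
  have h1 := h.lt_P
  have h2 := h.one_le_prod
  have h3 := h.one_lt_cast
  have : (K : ℝ) < P := by nlinarith
  exact_mod_cast this

lemma lt_P_of_mem (h : IsFrame R K a P) {r : ℕ} (hr : r ∈ a) : r < P := by
  have h1 := h.lt_P
  have h2 := prod_natCast_le_of_subset (c := a) (d := {r}) (by simpa using hr)
    fun r hr => (h.prime_a r hr).one_lt.le
  rw [Finset.prod_singleton] at h2
  have h3 := h.one_lt_cast
  have h4 := h.one_le_prod
  have : (r : ℝ) < P := by nlinarith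
  exact_mod_cast this

lemma primeFactors_eq (h : IsFrame R K a P) (hb : b ≠ 0) :
    (K * (∏ r ∈ a, r) * P * b).primeFactors = insert K (insert P a) ∪ b.primeFactors := by
  have ha0 : ∏ r ∈ a, r ≠ 0 := Finset.prod_ne_zero_iff.2 fun r hr => (h.prime_a r hr).ne_zero
  have hK0 := h.prime_K.ne_zero
  have hP0 := h.prime_P.ne_zero
  rw [Nat.primeFactors_mul (by positivity) hb, Nat.primeFactors_mul (by positivity) hP0,
    Nat.primeFactors_mul hK0 ha0, Nat.primeFactors_prod h.prime_a, h.prime_K.primeFactors,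
    h.prime_P.primeFactors]
  ext r
  simp only [Finset.mem_union, Finset.mem_singleton, Finset.mem_insert]
  tauto

lemma mobiusSum_ne_zero (h : IsFrame R K a P) (hb : b ≠ 0) (hbR : Rough R b) :
    mobiusSum (K * (∏ r ∈ a, r) * P * b) R ≠ 0 := by
  obtain ⟨d, hd, hP⟩ := Finset.mem_biUnion.1 h.mem
  obtain ⟨hda, hiso⟩ := Finset.mem_filter.1 hd
  rw [Finset.mem_powerset] at hda
  have hpf := h.primeFactors_eq hb
  have hPa : ∀ e ⊆ a, P ∉ e := fun e he h1 => lt_irrefl _ (h.lt_P_of_mem (he h1))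
  have hP' := mem_primesIoc.1 hP
  have hpos : ∀ e ⊆ a, 0 < ∏ r ∈ e, (r : ℝ) := fun e he =>
    Finset.prod_pos fun r hr => by exact_mod_cast (h.prime_a r (he hr)).pos
  have hK0 : (0 : ℝ) < K := by linarith [h.one_lt_cast]
  have hP0 : (0 : ℝ) < P := by exact_mod_cast h.prime_P.pos
  have h1 : R < K * (P * ∏ r ∈ d, (r : ℝ)) := by
    have := hP'.2.1
    rw [div_div, div_lt_iff₀ (mul_pos (hpos d hda) hK0)] at this
    linarith
  have h2 : P * ∏ r ∈ d, (r : ℝ) ≤ R := by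
    have := hP'.2.2
    rwa [le_div_iff₀ (hpos d hda)] at this
  refine _root_.mobiusSum_ne_zero (p := K) (s := insert P d) ?_ ?_ ?_
  · rw [hpf]
    simp
  · intro r hr
    rw [hpf, Finset.mem_erase, Finset.mem_union, Finset.mem_insert, Finset.mem_insert]
    rcases Finset.mem_insert.1 hr with rfl | hr
    · exact ⟨h.K_lt_P.ne', by simp⟩
    · refine ⟨?_, Or.inl (Or.inr (Or.inr (hda hr)))⟩
      rintro rfl
      exact h.notMem (hda hr)
  · intro u hu
    constructor
    · rintro ⟨h3, h4⟩
      have hu1 : ∀ r ∈ u, 1 ≤ r := fun r hr =>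
        (Nat.prime_of_mem_primeFactors (Finset.mem_of_mem_erase (hu hr))).one_lt.le
      have huPa : u ⊆ insert P a := by
        intro r hr
        have h5 := Finset.mem_erase.1 (hu hr)
        rw [hpf, Finset.mem_union] at h5
        rcases h5.2 with h6 | h6
        · exact (Finset.mem_insert.1 h6).resolve_left h5.1
        · have h7 := hbR r (Nat.prime_of_mem_primeFactors h6) (Nat.dvd_of_mem_primeFactors h6)
          have h8 := prod_natCast_le_of_subset (c := u) (d := {r}) (by simpa using hr) hu1
          rw [Finset.prod_singleton] at h8
          linarith
      have hPu : P ∈ u := by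
        by_contra hPu
        have hua : u ⊆ a := by
          intro r hr
          refine (Finset.mem_insert.1 (huPa hr)).resolve_left ?_
          rintro rfl
          exact hPu hr
        have h5 := prod_natCast_le_of_subset hua fun r hr => (h.prime_a r hr).one_lt.le
        have h6 : 1 ≤ K * ∏ r ∈ a, (r : ℝ) := by
          have := h.one_le_prod
          have := h.one_lt_cast
          nlinarith
        have h7 : K * ∏ r ∈ u, (r : ℝ) ≤ K * ∏ r ∈ a, (r : ℝ) := by gcongr
        have h8 := h.sq_le
        nlinarith
      have hea : u.erase P ⊆ a := by
        intro r hr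
        rw [Finset.mem_erase] at hr
        exact (Finset.mem_insert.1 (huPa hr.2)).resolve_left hr.1
      rw [← Finset.mul_prod_erase u (fun r : ℕ => (r : ℝ)) hPu] at h3 h4
      have hnear : Near K d (u.erase P) := by
        constructor
        · refine lt_of_mul_lt_mul_left ?_ hP0.le
          linarith
        · refine lt_of_mul_lt_mul_left ?_ hP0.le
          linarith
      rw [← hiso _ hea hnear, Finset.insert_erase hPu]
    · rintro rfl
      rw [Crosses, Finset.prod_insert (hPa d hda)]
      exact ⟨h2, h1⟩

lemma filter_primeFactors (h : IsFrame R K a P) (hb : b ≠ 0) (hbR : Rough R b) :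
    (K * (∏ r ∈ a, r) * P * b).primeFactors.filter (fun r : ℕ => (r : ℝ) ≤ R) =
      insert K (insert P a) := by
  rw [h.primeFactors_eq hb]
  have hPR := h.P_le
  ext r
  rw [Finset.mem_filter, Finset.mem_union]
  constructor
  · rintro ⟨h1 | h1, h2⟩
    · exact h1
    · have := hbR r (Nat.prime_of_mem_primeFactors h1) (Nat.dvd_of_mem_primeFactors h1)
      linarith
  · intro h1
    refine ⟨Or.inl h1, ?_⟩
    rcases Finset.mem_insert.1 h1 with rfl | h1
    · have : (r : ℝ) < P := by exact_mod_cast h.K_lt_P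
      linarith
    · rcases Finset.mem_insert.1 h1 with rfl | h1
      · exact hPR
      · have : (r : ℝ) < P := by exact_mod_cast h.lt_P_of_mem h1
        linarith

lemma injective {P' b' : ℕ} {a' : Finset ℕ} (h : IsFrame R K a P) (h' : IsFrame R K a' P')
    (hb : b ≠ 0) (hbR : Rough R b) (hb' : b' ≠ 0) (hbR' : Rough R b')
    (heq : K * (∏ r ∈ a, r) * P * b = K * (∏ r ∈ a', r) * P' * b') :
    a = a' ∧ P = P' ∧ b = b' := by
  have h1 := h.filter_primeFactors hb hbR
  rw [heq, h'.filter_primeFactors hb' hbR'] at h1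
  have hK : ∀ {a : Finset ℕ} {P : ℕ}, IsFrame R K a P → K ∉ insert P a := fun h2 h3 => by
    rcases Finset.mem_insert.1 h3 with h4 | h4
    · exact h2.K_lt_P.ne h4
    · exact h2.notMem h4
  have h2 : insert P' a' = insert P a := by
    rw [← Finset.erase_insert (hK h'), h1, Finset.erase_insert (hK h)]
  have hP : P = P' := by
    by_contra hne
    have h3 : P ∈ insert P' a' := h2 ▸ Finset.mem_insert_self P a
    have h4 : P' ∈ insert P a := h2 ▸ Finset.mem_insert_self P' a'
    have h5 := h'.lt_P_of_mem ((Finset.mem_insert.1 h3).resolve_left hne)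
    have h6 := h.lt_P_of_mem ((Finset.mem_insert.1 h4).resolve_left (Ne.symm hne))
    omega
  subst hP
  have hPa : ∀ {a : Finset ℕ}, IsFrame R K a P → P ∉ a := fun h2 h3 =>
    lt_irrefl _ (h2.lt_P_of_mem h3)
  have ha : a = a' := by
    rw [← Finset.erase_insert (hPa h), ← h2, Finset.erase_insert (hPa h')]
  subst ha
  refine ⟨rfl, rfl, ?_⟩
  have hpos : 0 < K * (∏ r ∈ a, r) * P := by
    have := h.prime_K.pos
    have := h.prime_P.pos
    have := Finset.prod_pos fun r hr => (h.prime_a r hr).pos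
    positivity
  exact Nat.eq_of_mul_eq_mul_left hpos heq

end IsFrame

lemma exists_card_ge_sum_isolatedSets {K : ℕ} (hK : K.Prime)
    (hwin : ∀ y z : ℝ, 1 ≤ y → K * y ≤ z → 1 ≤ ∑ p ∈ primesIoc (z / K) z, Real.log p / p) :
    ∃ c z₀ : ℝ, 0 < c ∧ 2 ≤ z₀ ∧ ∀ (x R : ℝ) (A : Finset (Finset ℕ)), z₀ ≤ R →
      R ^ (5 / 2 : ℝ) ≤ x →
      (∀ a ∈ A, (∀ r ∈ a, r.Prime) ∧ K ∉ a ∧ (K * ∏ r ∈ a, (r : ℝ)) ^ 4 ≤ R) →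
      c * (x / Real.log R ^ 2 * ∑ a ∈ A, (∏ r ∈ a, 1 / (r : ℝ)) * (isolatedSets K a).card) ≤
        (((Finset.Icc 1 ⌊x⌋₊).filter fun n => mobiusSum n R ≠ 0).card : ℝ) := by
  obtain ⟨c, hc, z₀, hz₀, hrough⟩ := exists_rough_card_ge
  have hK1 : (1 : ℝ) < K := by exact_mod_cast hK.one_lt
  refine ⟨c / K, z₀, by positivity, hz₀, fun x R A hR hx hA => ?_⟩
  have hR1 : 1 < R := by linarith
  have hlog := Real.log_pos hR1
  have hone : ∀ a ∈ A, 1 ≤ ∏ r ∈ a, (r : ℝ) := fun a ha =>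
    Finset.one_le_prod fun r hr => by exact_mod_cast ((hA a ha).1 r hr).one_lt.le
  have hq : ∀ a ∈ A, 1 ≤ K * ∏ r ∈ a, (r : ℝ) := fun a ha => by
    have := hone a ha
    nlinarith
  have hframe : ∀ a ∈ A, ∀ P ∈ windowPrimes R K a, IsFrame R K a P := fun a ha P hP =>
    ⟨hK, (hA a ha).1, (hA a ha).2.1,
      (pow_le_pow_right₀ (hq a ha) (by norm_num)).trans (hA a ha).2.2, hP⟩
  set B : (_ : Finset ℕ) × ℕ → Finset ℕ := fun y =>
    (Finset.Icc 1 ⌊x / ((K * ∏ r ∈ y.1, (r : ℝ)) * y.2)⌋₊).filter (Rough R) with hB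
  set S := (A.sigma (windowPrimes R K)).sigma B with hS
  have hcard : S.card ≤ ((Finset.Icc 1 ⌊x⌋₊).filter fun n => mobiusSum n R ≠ 0).card := by
    refine Finset.card_le_card_of_injOn (fun y => K * (∏ r ∈ y.1.1, r) * y.1.2 * y.2) ?_ ?_
    · rintro ⟨⟨a, P⟩, b⟩ hy
      simp only [hS, hB, Finset.coe_sigma, Set.mem_sigma_iff, Finset.mem_coe,
        Finset.mem_filter, Finset.mem_Icc] at hy
      obtain ⟨⟨ha, hP⟩, ⟨hb1, hb2⟩, hbR⟩ := hy
      have h := hframe a ha P hP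
      have hP0 := h.prime_P.pos
      have hP0' : (0 : ℝ) < P := by exact_mod_cast hP0
      have hq0 := hq a ha
      have h1 : (0 : ℕ) < ∏ r ∈ a, r := Finset.prod_pos fun r hr => ((hA a ha).1 r hr).pos
      have h2 := hK.pos
      simp only [Finset.coe_filter, Finset.mem_Icc, Set.mem_ofPred_eq]
      refine ⟨⟨Nat.one_le_iff_ne_zero.2 (by positivity), Nat.le_floor ?_⟩,
        h.mobiusSum_ne_zero (by omega) hbR⟩
      have h3 := (Nat.le_floor_iff' (by omega)).1 hb2
      rw [le_div_iff₀ (by positivity)] at h3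
      push_cast
      linarith
    · rintro ⟨⟨a, P⟩, b⟩ hy ⟨⟨a', P'⟩, b'⟩ hy' heq
      simp only [hS, hB, Finset.coe_sigma, Set.mem_sigma_iff, Finset.mem_coe,
        Finset.mem_filter, Finset.mem_Icc] at hy hy'
      obtain ⟨rfl, rfl, rfl⟩ := (hframe a hy.1.1 P hy.1.2).injective
        (hframe a' hy'.1.1 P' hy'.1.2) (by omega) hy.2.2 (by omega) hy'.2.2 heq
      rfl
  refine le_trans ?_ (Nat.cast_le.2 hcard)
  rw [hS, Finset.card_sigma, Finset.sum_sigma, Nat.cast_sum, ← mul_assoc, Finset.mul_sum]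
  refine Finset.sum_le_sum fun a ha => ?_
  have ha1 := hone a ha
  have hq1 := hq a ha
  have hx0 : 0 < x := lt_of_lt_of_le (by positivity) hx
  have hsum := sum_windowPrimes_ge hwin hK.one_lt.le hR1 (hA a ha).1
    ((le_self_pow₀ hq1 (by norm_num)).trans (hA a ha).2.2)
  rw [Nat.cast_sum]
  calc c / K * (x / Real.log R ^ 2) * ((∏ r ∈ a, 1 / (r : ℝ)) * (isolatedSets K a).card)
      = c * x / (K * (∏ r ∈ a, (r : ℝ)) * Real.log R) *
          ((isolatedSets K a).card * (1 / Real.log R)) := by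
        rw [Finset.prod_div_distrib, Finset.prod_const_one]
        field_simp
    _ ≤ c * x / (K * (∏ r ∈ a, (r : ℝ)) * Real.log R) *
          ∑ P ∈ windowPrimes R K a, 1 / (P : ℝ) := by gcongr
    _ ≤ _ := by
        rw [Finset.mul_sum]
        refine Finset.sum_le_sum fun P hP => ?_
        have h := hframe a ha P hP
        have hP0 : (0 : ℝ) < P := by exact_mod_cast h.prime_P.pos
        have hX : R ^ (6 / 5 : ℝ) ≤ x / ((K * ∏ r ∈ a, (r : ℝ)) * P) := by
          rw [le_div_iff₀ (by positivity)]
          have h1 : K * ∏ r ∈ a, (r : ℝ) ≤ R ^ (1 / 4 : ℝ) := by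
            have := Real.rpow_le_rpow (by positivity) (hA a ha).2.2 (by norm_num : (0:ℝ) ≤ 1 / 4)
            rwa [← Real.rpow_natCast, ← Real.rpow_mul (by positivity),
              show ((4 : ℕ) : ℝ) * (1 / 4) = 1 by norm_num, Real.rpow_one] at this
          calc R ^ (6 / 5 : ℝ) * ((K * ∏ r ∈ a, (r : ℝ)) * P)
              ≤ R ^ (6 / 5 : ℝ) * (R ^ (1 / 4 : ℝ) * R ^ (1 : ℝ)) := by
                rw [Real.rpow_one]
                have := h.P_le
                gcongr
            _ = R ^ (6 / 5 + (1 / 4 + 1) : ℝ) := by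
                rw [← Real.rpow_add (by linarith), ← Real.rpow_add (by linarith)]
            _ ≤ R ^ (5 / 2 : ℝ) := Real.rpow_le_rpow_of_exponent_le hR1.le (by norm_num)
            _ ≤ x := hx
        refine le_trans (le_of_eq ?_) (hrough R _ hR hX)
        field_simp

lemma prod_inv_nonneg (a : Finset ℕ) : 0 ≤ ∏ r ∈ a, 1 / (r : ℝ) :=
  Finset.prod_nonneg fun r _ => by positivity

lemma sum_inv_blockPrimes_le (j : ℕ) : ∑ r ∈ blockPrimes j, 1 / (r : ℝ) ≤ Real.log 2 := by
  refine (Finset.sum_le_sum fun r hr => ?_).trans (sum_blockPrimes_le j)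
  have : (1 : ℝ) < r := by exact_mod_cast (prime_of_mem hr).one_lt
  gcongr
  linarith

lemma sum_Ioc_sub_inv {m n : ℕ} (h : m ≤ n) :
    ∑ r ∈ Finset.Ioc m n, (1 / ((r : ℝ) - 1) - 1 / r) = 1 / m - 1 / n := by
  induction n, h using Nat.le_induction with
  | base => simp
  | succ n h ih =>
    rw [Finset.sum_Ioc_succ_top h, ih]
    push_cast
    ring

lemma le_sum_inv_blockPrimes (j : ℕ) :
    Real.log 2 - 2 / blk j ≤ ∑ r ∈ blockPrimes j, 1 / (r : ℝ) := by
  have h2 := two_le_blk j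
  have h1 : ∑ r ∈ blockPrimes j, (1 / ((r : ℝ) - 1) - 1 / r) ≤ 1 / blk j - 1 / blk (j + 1) := by
    rw [← sum_Ioc_sub_inv (blk_strictMono.monotone (Nat.le_succ j))]
    refine Finset.sum_le_sum_of_subset_of_nonneg (fun r hr => ?_) fun r hr _ => ?_
    · have := mem_primesIoc.1 hr
      exact Finset.mem_Ioc.2 ⟨by exact_mod_cast this.2.1, by exact_mod_cast this.2.2⟩
    · have : (2 : ℝ) < r := by
        have := (Finset.mem_Ioc.1 hr).1
        exact_mod_cast (by omega : 2 < r)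
      rw [sub_nonneg]
      gcongr <;> linarith
  rw [Finset.sum_sub_distrib] at h1
  have h3 := le_sum_blockPrimes j
  have h4 : (1 : ℝ) / blk j ≤ 2 / blk j := by gcongr; norm_num
  have h5 : (2 : ℝ) / blk j = 1 / blk j + 1 / blk j := by ring
  have h6 : (1 : ℝ) / blk (j + 1) ≤ 1 / blk j := by
    have := blk_mono_cast (Nat.le_succ j)
    have : (0 : ℝ) < blk j := by exact_mod_cast (by omega : 0 < blk j)
    gcongr
  have h7 : (0 : ℝ) < 1 / blk (j + 1) := by
    have : (0 : ℝ) < blk (j + 1) := by exact_mod_cast (by have := two_le_blk (j+1); omega)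
    positivity
  linarith

lemma le_sum_powerset_blockPrimes (j l : ℕ) :
    (1 - l * (l + 2) / (Real.log 2 * blk j)) * (Real.log 2 ^ l * (1 / (l.factorial : ℝ))) ≤
      ∑ s ∈ (blockPrimes j).powerset with s.card = l, ∏ r ∈ s, 1 / (r : ℝ) := by
  have hb := two_le_blk_cast j
  have hl2 : 0 < Real.log 2 := by linarith [log_two_bounds.1]
  have hb0 : (0 : ℝ) < blk j := by linarith
  by_cases h : (l + 2) / (blk j : ℝ) ≤ Real.log 2
  · have hω : ∀ r ∈ blockPrimes j, 1 / (r : ℝ) ≤ 1 / blk j := fun r hr => by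
      have := (mem_primesIoc.1 hr).2.1
      gcongr
    have h1 : (l + 2) / (blk j : ℝ) = l * (1 / blk j) + 2 / blk j := by ring
    refine le_trans ?_ (le_sum_powerset_card (w := fun r : ℕ => 1 / (r : ℝ))
      (fun r => by positivity) (by positivity) l hω (le_sum_inv_blockPrimes j) (by linarith))
    have h2 : Real.log 2 - 2 / blk j - l * (1 / (blk j : ℝ)) =
        Real.log 2 * (1 + -((l + 2) / (Real.log 2 * blk j))) := by
      field_simp
      ring
    have h3 : (l + 2) / (Real.log 2 * (blk j : ℝ)) ≤ 1 := by
      rw [div_le_one (by positivity)]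
      rwa [div_le_iff₀ hb0] at h
    have h4 := one_add_mul_le_pow (a := -((l + 2) / (Real.log 2 * (blk j : ℝ)))) (by linarith) l
    rw [h2, mul_pow, mul_assoc, mul_left_comm]
    refine mul_le_mul_of_nonneg_left ?_ (by positivity)
    refine mul_le_mul_of_nonneg_right (le_trans (le_of_eq ?_) h4) (by positivity)
    ring
  · push Not at h
    rcases Nat.eq_zero_or_pos l with rfl | hl
    · have h1 : (∅ : Finset ℕ) ∈ (blockPrimes j).powerset.filter fun s => s.card = 0 := by simp
      simpa using Finset.single_le_sum (f := fun s : Finset ℕ => ∏ r ∈ s, 1 / (r : ℝ))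
        (fun s _ => prod_inv_nonneg s) h1
    · refine le_trans (mul_nonpos_of_nonpos_of_nonneg ?_ (by positivity))
        (Finset.sum_nonneg fun s _ => prod_inv_nonneg s)
      rw [sub_nonpos, one_le_div (by positivity)]
      rw [lt_div_iff₀ hb0] at h
      have : (1 : ℝ) ≤ l := by exact_mod_cast hl
      nlinarith

lemma exists_le_sum_parkingSets : ∃ C₀ : ℕ, ∀ C N : ℕ, C₀ ≤ C →
    Real.log 2 ^ N * parking N N / 2 ≤
      ∑ a ∈ walkSets (fun i => blockPrimes (C + i)) (fun r k => k ≤ r) N N,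
          ∏ r ∈ a, 1 / (r : ℝ) := by
  obtain ⟨c, _, hc, _, hblk⟩ := exists_log_blk_bounds
  have hl2 : 0 < Real.log 2 := by linarith [log_two_bounds.1]
  obtain ⟨C₀, hC₀⟩ := pow_unbounded_of_one_lt (16 * 2 / (c ^ 2 * Real.log 2))
    (by norm_num : (1 : ℝ) < 4)
  refine ⟨C₀, fun C N hC => ?_⟩
  set θ : ℕ → ℝ := fun i => 1 - (1 / 2) ^ i / 4 with hθ
  have hpow : ∀ i : ℕ, (0 : ℝ) < (1 / 2) ^ i ∧ ((1 : ℝ) / 2) ^ i ≤ 1 := fun i =>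
    ⟨by positivity, pow_le_one₀ (by norm_num) (by norm_num)⟩
  have hprod : ∀ n : ℕ, 1 / 2 + (1 / 2) ^ n / 2 ≤ ∏ i ∈ Finset.range n, θ i := by
    intro n
    induction n with
    | zero => norm_num
    | succ n ih =>
      rw [Finset.prod_range_succ]
      obtain ⟨h1, h2⟩ := hpow n
      calc (1 / 2 + (1 / 2) ^ (n + 1) / 2 : ℝ) ≤ (1 / 2 + (1 / 2) ^ n / 2) * θ n := by
            rw [hθ, pow_succ]
            nlinarith
        _ ≤ _ := mul_le_mul_of_nonneg_right ih (by simp only [hθ]; linarith)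
  have hbig : ∀ i : ℕ, 16 * 4 ^ i ≤ Real.log 2 * blk (C + i) := by
    intro i
    have h1 := (hblk (C + i)).1
    have hb0 : (0 : ℝ) < blk (C + i) := by linarith [two_le_blk_cast (C + i)]
    have h2 : (c * 2 ^ (C + i)) ^ 2 / 2 ≤ blk (C + i) := by
      rw [← Real.exp_log hb0]
      have h3 := Real.quadratic_le_exp_of_nonneg (log_blk_pos (C + i)).le
      have h4 : (c * 2 ^ (C + i)) ^ 2 ≤ Real.log (blk (C + i)) ^ 2 := by gcongr
      have := log_blk_pos (C + i)
      linarith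
    have h5 : (4 : ℝ) ^ C₀ ≤ 4 ^ C := pow_le_pow_right₀ (by norm_num) hC
    have h6 := hC₀.le.trans h5
    rw [div_le_iff₀ (by positivity)] at h6
    have h7 : (c * 2 ^ (C + i)) ^ 2 = c ^ 2 * (4 ^ C * 4 ^ i) := by
      rw [mul_pow, ← pow_mul, mul_comm _ 2, pow_mul, ← pow_add]
      norm_num
    calc (16 * 4 ^ i : ℝ) = 16 * 2 * 4 ^ i / 2 := by ring
      _ ≤ 4 ^ C * (c ^ 2 * Real.log 2) * 4 ^ i / 2 := by gcongr
      _ = Real.log 2 * ((c * 2 ^ (C + i)) ^ 2 / 2) := by rw [h7]; ring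
      _ ≤ _ := by gcongr
  have hquad : ∀ i : ℕ, (i + 1) * (i + 3) ≤ 4 * 2 ^ i := by
    intro i
    rcases Nat.lt_or_ge i 2 with h | h
    · interval_cases i <;> norm_num
    · induction i, h using Nat.le_induction with
      | base => norm_num
      | succ i h ih => rw [pow_succ]; nlinarith
  refine le_trans ?_ (le_sum_parkingSets (w := fun r : ℕ => 1 / (r : ℝ)) (fun r => by positivity)
    hl2.le θ (fun i => by simp only [hθ]; linarith [(hpow i).2]) N N
    (fun i j hij _ => disjoint_blockPrimes (by omega)) fun i _ l hl =>
      le_trans ?_ (le_sum_powerset_blockPrimes (C + i) l))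
  · rw [div_eq_mul_one_div, mul_comm]
    have := walk_nonneg (fun r k => k ≤ r) N N
    gcongr
    linarith [hprod N, (hpow N).1]
  · refine mul_le_mul_of_nonneg_right ?_ (by positivity)
    simp only [hθ]
    refine sub_le_sub_left ?_ _
    have hb := hbig i
    have h1 : (0 : ℝ) < Real.log 2 * blk (C + i) := lt_of_lt_of_le (by positivity) hb
    rw [div_le_iff₀ h1]
    have h2 : (l * (l + 2) : ℝ) ≤ 4 * 2 ^ i := by
      have : l * (l + 2) ≤ 4 * 2 ^ i := le_trans (Nat.mul_le_mul hl (by omega)) (hquad i)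
      exact_mod_cast this
    calc (l * (l + 2) : ℝ) ≤ 4 * 2 ^ i := h2
      _ = (1 / 2) ^ i / 4 * (16 * 4 ^ i) := by
        rw [show (4 : ℝ) ^ i = 2 ^ i * 2 ^ i by rw [← mul_pow]; norm_num, one_div, inv_pow]
        field_simp
        norm_num
      _ ≤ _ := by gcongr

section
variable {ι : Type*} [DecidableEq ι]

lemma sum_filter_mul_sum_mem (U : Finset ι) (Q : Finset ι → Prop) (w : ι → ℝ)
    (F : Finset ι → ι → ℝ) :
    ∑ a ∈ U.powerset with Q a, (∏ i ∈ a, w i) * ∑ r ∈ a, F a r =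
      ∑ r ∈ U, w r * ∑ a ∈ (U.erase r).powerset with Q (insert r a),
        (∏ i ∈ a, w i) * F (insert r a) r := by
  have h : ∑ a ∈ U.powerset with Q a, (∏ i ∈ a, w i) * ∑ r ∈ a, F a r =
      ∑ a ∈ U.powerset, ∑ r ∈ a, if Q a then (∏ i ∈ a, w i) * F a r else 0 := by
    rw [Finset.sum_filter]
    refine Finset.sum_congr rfl fun s _ => ?_
    split_ifs
    · rw [Finset.mul_sum]
    · simp
  rw [h, sum_powerset_sum_mem]
  refine Finset.sum_congr rfl fun r _ => ?_
  rw [Finset.sum_filter, Finset.mul_sum]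
  refine Finset.sum_congr rfl fun a ha => ?_
  have hra : r ∉ a := fun h => by simpa using Finset.mem_powerset.1 ha h
  split_ifs
  · rw [Finset.prod_insert hra, mul_assoc]
  · simp

/-- The sets with `N - 1` elements to which an element of the block `E i` can be added to give a
set with `N` elements in which every initial union of blocks obeys the parking condition. -/
def IsDefective (E : ℕ → Finset ι) (N i : ℕ) (a : Finset ι) : Prop :=
  a.card + 1 = N ∧ ∀ j ≤ N, (a ∩ blockUnion E j).card ≤ j ∧
    (i < j → (a ∩ blockUnion E j).card + 1 ≤ j)

lemma isDefective_of_insert {E : ℕ → Finset ι} {N i : ℕ} {a : Finset ι} {r : ι} (hr : r ∈ E i)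
    (hra : r ∉ a) (h : IsWalkSet E (fun r k => k ≤ r) N N (insert r a)) : IsDefective E N i a := by
  obtain ⟨h1, h2⟩ := h
  rw [Finset.card_insert_of_notMem hra] at h1
  refine ⟨h1, fun j hj => ?_⟩
  rcases Nat.eq_zero_or_pos j with rfl | hj0
  · simp [blockUnion_zero]
  have h3 := h2 j hj0 hj
  refine ⟨le_trans (Finset.card_le_card ?_) h3, fun hij => ?_⟩
  · exact Finset.inter_subset_inter_right (Finset.subset_insert r a)
  · have hmem : r ∈ blockUnion E j := mem_blockUnion.2 ⟨i, hij, hr⟩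
    rwa [Finset.insert_inter_of_mem hmem, Finset.card_insert_of_notMem fun h =>
      hra (Finset.mem_inter.1 h).1] at h3

lemma sum_isDefective_le {E : ℕ → Finset ι} {w : ι → ℝ} (hw : ∀ i, 0 ≤ w i) {t : ℝ} (ht0 : 0 ≤ t)
    {N i : ℕ} (hi : i < N) (hE : ∀ i j, i < j → j < N → Disjoint (E i) (E j))
    (ht : ∀ i < N, ∑ x ∈ E i, w x ≤ t) :
    ∑ a ∈ (blockUnion E N).powerset with IsDefective E N i a,
        (∏ x ∈ a, w x) * 2 ^ (a ∩ blockUnion E (i + 1)).card ≤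
      ∑ k ∈ Finset.range (i + 1),
        2 ^ k * (t ^ (N - 1) * (parking (i + 1) k * ballot (N - 1 - i) (N - 1 - k))) := by
  set U := blockUnion E (i + 1) with hU
  set E' : ℕ → Finset ι := fun l => E (N - 1 - l) with hE'
  set m := N - 1 - i with hm
  set T := blockUnion E' m with hT
  have hUT : ∀ r ≤ N, blockUnion E N = blockUnion E (N - r) ∪ blockUnion E' r :=
    fun r hr => blockUnion_reverse E hr
  have hdisj : ∀ r ≤ N, Disjoint (blockUnion E (N - r)) (blockUnion E' r) := by
    intro r hr
    rw [Finset.disjoint_left]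
    intro x hx hx'
    obtain ⟨l, hl, hxl⟩ := mem_blockUnion.1 hx
    obtain ⟨l', hl', hxl'⟩ := mem_blockUnion.1 hx'
    exact Finset.disjoint_left.1 (hE l (N - 1 - l') (by omega) (by omega)) hxl hxl'
  have hNm : N - m = i + 1 := by omega
  have hsplit := hUT m (by omega)
  have hdUT := hdisj m (by omega)
  rw [hNm] at hsplit hdUT
  have hcard : ∀ r ≤ N, ∀ a ⊆ blockUnion E N,
      (a ∩ blockUnion E (N - r)).card + (a ∩ blockUnion E' r).card = a.card := by
    intro r hr a ha
    rw [← Finset.card_union_of_disjoint ((hdisj r hr).mono Finset.inter_subset_right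
      Finset.inter_subset_right), ← Finset.inter_union_distrib_left, ← hUT r hr,
      Finset.inter_eq_left.2 ha]
  rw [← Finset.sum_fiberwise_of_maps_to (g := fun a => (a ∩ U).card) (t := Finset.range (i + 1))]
  · refine Finset.sum_le_sum fun k hk => ?_
    have hk' := Finset.mem_range.1 hk
    have h1 := sum_walkSets_le (E := E) (fun r k => k ≤ r) hw (i + 1) k
      (fun i j h1 h2 => hE i j h1 (by omega)) (fun j hj => ht j (by omega))
    have h2 := sum_walkSets_le (E := E') (fun r k => r ≤ k) hw m (N - 1 - k)
      (fun i j h1 h2 => (hE _ _ (by omega) (by omega)).symm) (fun j hj => ht _ (by omega))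
    have h3 : t ^ (N - 1) = t ^ k * t ^ (N - 1 - k) := by rw [← pow_add]; congr 1; omega
    have hp : ∀ s : Finset ι, 0 ≤ ∏ i ∈ s, w i := fun s => Finset.prod_nonneg fun i _ => hw i
    calc _ = 2 ^ k * ∑ a ∈ (((blockUnion E N).powerset.filter (IsDefective E N i)).filter
            fun a => (a ∩ U).card = k), (∏ x ∈ a ∩ U, w x) * ∏ x ∈ a ∩ T, w x := by
          rw [Finset.mul_sum]
          refine Finset.sum_congr rfl fun a ha => ?_
          simp only [Finset.mem_filter, Finset.mem_powerset] at ha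
          rw [ha.2, mul_comm, ← Finset.prod_union (hdUT.mono Finset.inter_subset_right
            Finset.inter_subset_right), ← Finset.inter_union_distrib_left, ← hsplit,
            Finset.inter_eq_left.2 ha.1.1]
      _ ≤ 2 ^ k * ∑ y ∈ walkSets E (fun r k => k ≤ r) (i + 1) k ×ˢ
            walkSets E' (fun r k => r ≤ k) m (N - 1 - k),
            (∏ x ∈ y.1, w x) * ∏ x ∈ y.2, w x := by
          gcongr
          rw [← Finset.sum_image (s := _) (g := fun a => (a ∩ U, a ∩ T))
            (f := fun y : Finset ι × Finset ι => (∏ x ∈ y.1, w x) * ∏ x ∈ y.2, w x)]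
          · refine Finset.sum_le_sum_of_subset_of_nonneg ?_ fun y _ _ => mul_nonneg (hp _) (hp _)
            intro y hy
            obtain ⟨a, ha, rfl⟩ := Finset.mem_image.1 hy
            simp only [Finset.mem_filter, Finset.mem_powerset] at ha
            obtain ⟨⟨haN, hdef⟩, hak⟩ := ha
            refine Finset.mem_product.2 ⟨Finset.mem_filter.2 ⟨Finset.mem_powerset.2
              Finset.inter_subset_right, hak, fun r h4 h5 => ?_⟩, Finset.mem_filter.2
              ⟨Finset.mem_powerset.2 Finset.inter_subset_right, ?_, fun r h4 h5 => ?_⟩⟩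
            · simp only
              rw [Finset.inter_assoc, Finset.inter_eq_right.2 (blockUnion_mono E h5)]
              exact (hdef.2 r (by omega)).1
            · have h6 := hcard m (by omega) a haN
              have h7 := hdef.1
              rw [hNm, ← hU, ← hT] at h6
              simp only
              omega
            · simp only
              rw [Finset.inter_assoc, Finset.inter_eq_right.2 (blockUnion_mono E' h5)]
              have h6 := hcard r (by omega) a haN
              have h7 := hdef.1
              have h8 := (hdef.2 (N - r) (by omega)).2 (by omega)
              omega
          · intro a ha b hb hab
            simp only [Finset.coe_filter, Set.mem_ofPred_eq, Finset.mem_filter,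
              Finset.mem_powerset] at ha hb
            rw [Prod.mk.injEq] at hab
            rw [← Finset.inter_eq_left.2 ha.1.1, ← Finset.inter_eq_left.2 hb.1.1, hsplit,
              Finset.inter_union_distrib_left, Finset.inter_union_distrib_left, hab.1, hab.2]
      _ ≤ 2 ^ k * ((t ^ k * parking (i + 1) k) * (t ^ (N - 1 - k) * ballot m (N - 1 - k))) := by
          rw [Finset.sum_product]
          simp only
          rw [← Finset.sum_mul_sum]
          gcongr
          · exact Finset.sum_nonneg fun s _ => hp s
          · exact mul_nonneg (by positivity) (walk_nonneg _ _ _)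
      _ = _ := by rw [h3]; ring
  · intro a ha
    simp only [Finset.mem_filter, Finset.mem_powerset] at ha
    have := (ha.2.2 (i + 1) (by omega)).2 (by omega)
    rw [← hU] at this
    exact Finset.mem_range.2 (by omega)

end

lemma exists_sum_parking_mul_ballot_le : ∃ D > 0, ∀ N : ℕ,
    ∑ i ∈ Finset.range N, (1 / 2 : ℝ) ^ i * ∑ k ∈ Finset.range (i + 1),
      2 ^ k * (parking (i + 1) k * ballot (N - 1 - i) (N - 1 - k)) ≤
    D * (Real.exp 1 ^ N * kap N) := by
  obtain ⟨C, hC, hconv⟩ := exists_kap_conv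
  have he := exp_one_bounds
  set e := Real.exp 1
  obtain ⟨S, hS, hgeom⟩ := exists_sum_le_of_geom (β := e / 4) (by linarith) (by linarith)
  refine ⟨4 * e ^ 3 * S * C, by positivity, fun N => ?_⟩
  have hterm : ∀ i ∈ Finset.range N, (1 / 2 : ℝ) ^ i * ∑ k ∈ Finset.range (i + 1),
      2 ^ k * (parking (i + 1) k * ballot (N - 1 - i) (N - 1 - k)) ≤
      4 * e ^ 3 * S * e ^ N * (kap (i + 1) * kap (N - (i + 1))) := by
    intro i hi
    have hi := Finset.mem_range.1 hi
    rw [← Finset.sum_range_reflect, Finset.mul_sum]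
    have hk1 := kap_pos (i + 1)
    have hk2 := kap_pos (N - (i + 1))
    calc _ ≤ ∑ h ∈ Finset.range (i + 1), 4 * e ^ 3 * e ^ N * (kap (i + 1) * kap (N - (i + 1))) *
          (((h : ℝ) + 1) ^ 2 * (e / 4) ^ h) := by
          refine Finset.sum_le_sum fun h hh => ?_
          have hh := Finset.mem_range.1 hh
          have h1 := parking_sub_le (n := i + 1) (d := h + 1) (by omega)
          have h2 := ballot_add_le (N - (i + 1)) h
          rw [show i + 1 - 1 - h = i - h by omega, show N - 1 - (i - h) = N - (i + 1) + h by omega,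
            show N - 1 - i = N - (i + 1) by omega]
          rw [show i + 1 - (h + 1) = i - h by omega] at h1
          have h3 := walk_nonneg (fun r k => k ≤ r) (i + 1) (i - h)
          have h4 := walk_nonneg (fun r k => r ≤ k) (N - (i + 1)) (N - (i + 1) + h)
          have h5 : (1 / 2 : ℝ) ^ i * 2 ^ (i - h) = (1 / 2) ^ h := by
            obtain ⟨d, rfl⟩ := Nat.exists_eq_add_of_le (show h ≤ i by omega)
            rw [Nat.add_sub_cancel_left, pow_add, mul_assoc, ← mul_pow]
            norm_num
          calc _ = (1 / 2 : ℝ) ^ h * (parking (i + 1) (i - h) *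
                ballot (N - (i + 1)) (N - (i + 1) + h)) := by rw [← h5]; ring
            _ ≤ (1 / 2 : ℝ) ^ h * ((e * ((h + 1 : ℕ) + 1) * (e ^ (i + 1) * kap (i + 1))) *
                (2 * e ^ 2 * (e ^ (N - (i + 1)) * kap (N - (i + 1))) *
                  ((h + 1) * (e / 2) ^ h))) := by gcongr
            _ = 2 * e ^ 3 * e ^ N * (kap (i + 1) * kap (N - (i + 1))) *
                ((h + 2) * (h + 1) * (e / 4) ^ h) := by
              have h6 : e ^ N = e ^ (i + 1) * e ^ (N - (i + 1)) := by
                rw [← pow_add]; congr 1; omega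
              have h7 : (e / 4) ^ h = (1 / 2) ^ h * (e / 2) ^ h := by
                rw [← mul_pow]; congr 1; ring
              rw [h6, h7]
              push_cast
              ring
            _ ≤ 2 * e ^ 3 * e ^ N * (kap (i + 1) * kap (N - (i + 1))) *
                (2 * (h + 1) ^ 2 * (e / 4) ^ h) := by
              have h8 : ((h : ℝ) + 2) * (h + 1) ≤ 2 * (h + 1) ^ 2 := by nlinarith
              gcongr
            _ = _ := by ring
      _ = 4 * e ^ 3 * e ^ N * (kap (i + 1) * kap (N - (i + 1))) *
            ∑ h ∈ Finset.range (i + 1), ((h : ℝ) + 1) ^ 2 * (e / 4) ^ h := by rw [Finset.mul_sum]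
      _ ≤ 4 * e ^ 3 * e ^ N * (kap (i + 1) * kap (N - (i + 1))) * S := by
          have := hgeom (Finset.range (i + 1))
          gcongr
      _ = _ := by ring
  refine (Finset.sum_le_sum hterm).trans ?_
  rw [← Finset.mul_sum]
  have h1 := hconv N
  rw [Finset.sum_range_succ'] at h1
  have h2 := mul_pos (kap_pos 0) (kap_pos (N - 0))
  calc _ ≤ 4 * e ^ 3 * S * e ^ N * (C * kap N) := by
        gcongr
        linarith
    _ = _ := by ring

lemma exists_sum_inv_mul_log_prod_le : ∃ D > 0, ∀ C N : ℕ, 1 ≤ N →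
    ∑ a ∈ walkSets (fun i => blockPrimes (C + i)) (fun r k => k ≤ r) N N,
      (∏ r ∈ a, 1 / (r : ℝ)) * Real.log (∏ r ∈ a, (r : ℝ)) ≤
    D * 2 ^ (C + N) * ((Real.exp 1 * Real.log 2) ^ N * kap N) := by
  obtain ⟨D, hD, hlog⟩ := exists_sum_wt_mul_log_le
  have ht := log_two_bounds.1
  have he := exp_one_bounds
  refine ⟨D * (4 * Real.exp 1), by positivity, fun C N hN => ?_⟩
  set E : ℕ → Finset ℕ := fun i => blockPrimes (C + i) with hE
  have hprime : ∀ r ∈ blockUnion E N, r.Prime := fun r hr => by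
    obtain ⟨i, _, hi⟩ := mem_blockUnion.1 hr
    exact prime_of_mem_blockPrimes hi
  have hEd : ∀ i j, i < j → j < N → Disjoint (E i) (E j) :=
    fun i j h _ => disjoint_blockPrimes (by omega)
  have h1 : ∑ a ∈ walkSets E (fun r k => k ≤ r) N N,
      (∏ r ∈ a, 1 / (r : ℝ)) * Real.log (∏ r ∈ a, (r : ℝ)) =
      ∑ a ∈ (blockUnion E N).powerset with IsWalkSet E (fun r k => k ≤ r) N N a,
        (∏ r ∈ a, 1 / (r : ℝ)) * ∑ r ∈ a, Real.log r := by
    refine Finset.sum_congr rfl fun a ha => ?_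
    rw [Real.log_prod fun r hr => ?_]
    have := (hprime r (Finset.mem_powerset.1 (Finset.mem_filter.1 ha).1 hr)).ne_zero
    exact_mod_cast this
  have h2 := sum_walkSets_le (E := E) (w := fun r : ℕ => 1 / (r : ℝ)) (fun r k => k ≤ r)
    (fun r => by positivity) N (N - 1) hEd (fun i _ => sum_inv_blockPrimes_le (C + i))
  have h3 := parking_sub_le hN
  have h4 := hlog C N
  rw [← blockUnion_blockPrimes] at h4
  rw [h1, sum_filter_mul_sum_mem]
  calc _ ≤ ∑ r ∈ blockUnion E N, wt r * Real.log r *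
        (Real.log 2 ^ (N - 1) * parking N (N - 1)) := by
        refine Finset.sum_le_sum fun r hr => ?_
        have hr2 := (hprime r hr).two_le
        have hr1 : (1 : ℝ) < r := by exact_mod_cast hr2
        have hlogr := Real.log_natCast_nonneg r
        rw [← Finset.sum_mul, mul_assoc, mul_comm (Finset.sum _ _)]
        have hwt : 1 / (r : ℝ) ≤ wt r := by
          rw [wt_eq hr2]
          gcongr
          linarith
        refine mul_le_mul hwt (mul_le_mul_of_nonneg_left (le_trans ?_ h2) hlogr)
          (mul_nonneg hlogr (Finset.sum_nonneg fun a _ => prod_inv_nonneg a)) (wt_nonneg r)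
        refine Finset.sum_le_sum_of_subset_of_nonneg (fun a ha => ?_) fun a _ _ => prod_inv_nonneg a
        simp only [Finset.mem_filter, Finset.mem_powerset] at ha
        obtain ⟨ha1, ha2, ha3⟩ := ha
        have hra : r ∉ a := fun h => by simpa using ha1 h
        rw [Finset.card_insert_of_notMem hra] at ha2
        exact Finset.mem_filter.2 ⟨Finset.mem_powerset.2 (ha1.trans (Finset.erase_subset _ _)),
          by omega, fun q hq1 hq2 => (Finset.card_le_card (Finset.inter_subset_inter_right
            (Finset.subset_insert r a))).trans (ha3 q hq1 hq2)⟩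
    _ ≤ (D * 2 ^ C * 2 ^ N) * (Real.log 2 ^ (N - 1) *
          (Real.exp 1 * ((1 : ℕ) + 1) * (Real.exp 1 ^ N * kap N))) := by
        rw [← Finset.sum_mul]
        have := walk_nonneg (fun r k => k ≤ r) N (N - 1)
        gcongr
    _ ≤ _ := by
        have h5 : Real.log 2 ^ (N - 1) ≤ 2 * Real.log 2 ^ N := by
          obtain ⟨n, rfl⟩ := Nat.exists_eq_add_of_le' hN
          rw [Nat.add_sub_cancel, pow_succ]
          have : 0 < Real.log 2 ^ n := by positivity
          nlinarith
        have := kap_pos N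
        calc _ ≤ (D * 2 ^ C * 2 ^ N) * (2 * Real.log 2 ^ N *
          (Real.exp 1 * ((1 : ℕ) + 1) * (Real.exp 1 ^ N * kap N))) := by gcongr
          _ = _ := by rw [mul_pow, pow_add]; push_cast; ring

noncomputable def precursorPairs (K : ℝ) (a : Finset ℕ) (r : ℕ) : Finset (Finset ℕ × Finset ℕ) :=
  (a.powerset ×ˢ a.powerset).filter fun y =>
    (∀ s ∈ a, r < s → (s ∈ y.1 ↔ s ∈ y.2)) ∧ Near K (insert r y.1) y.2

lemma card_nearPairs_le (K : ℝ) (a : Finset ℕ) :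
    (nearPairs K a).card ≤ 2 * ∑ r ∈ a, (precursorPairs K (a.erase r) r).card := by
  set G := a.biUnion fun r => (precursorPairs K (a.erase r) r).image fun y => (insert r y.1, y.2)
    with hG
  have hcardG : G.card ≤ ∑ r ∈ a, (precursorPairs K (a.erase r) r).card :=
    Finset.card_biUnion_le.trans (Finset.sum_le_sum fun r _ => Finset.card_image_le)
  have hmem : ∀ d ⊆ a, ∀ e ⊆ a, ∀ r ∈ d, r ∉ e → Near K d e →
      (∀ s ∈ a, r < s → (s ∈ d ↔ s ∈ e)) → (d, e) ∈ G := by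
    intro d hd e he r hrd hre hnear hagree
    refine Finset.mem_biUnion.2 ⟨r, hd hrd, Finset.mem_image.2 ⟨(d.erase r, e),
      Finset.mem_filter.2 ⟨Finset.mem_product.2 ⟨Finset.mem_powerset.2
          (Finset.erase_subset_erase r hd),
        Finset.mem_powerset.2 (Finset.subset_erase.2 ⟨he, hre⟩)⟩, fun s hs hrs => ?_, ?_⟩, ?_⟩⟩
    · simp only [Finset.mem_erase]
      rw [← hagree s (Finset.mem_of_mem_erase hs) hrs]
      exact ⟨fun h => h.2, fun h => ⟨hrs.ne', h⟩⟩
    · simpa only [Finset.insert_erase hrd] using hnear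
    · simp only [Finset.insert_erase hrd]
  have hsub : nearPairs K a ⊆ G ∪ G.image Prod.swap := by
    rintro ⟨d, e⟩ hy
    simp only [nearPairs, Finset.mem_filter, Finset.mem_product, Finset.mem_powerset] at hy
    obtain ⟨⟨hd, he⟩, hne, hnear⟩ := hy
    have hs : (a.filter fun s => ¬ (s ∈ d ↔ s ∈ e)).Nonempty := by
      by_contra h
      rw [Finset.not_nonempty_iff_eq_empty, Finset.filter_eq_empty_iff] at h
      refine hne (Finset.ext fun s => ?_)
      by_cases hsa : s ∈ a
      · exact not_not.1 (h hsa)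
      · exact ⟨fun h => absurd (hd h) hsa, fun h => absurd (he h) hsa⟩
    obtain ⟨r, hr, hmax⟩ := Finset.exists_max_image _ id hs
    have hagree : ∀ s ∈ a, r < s → (s ∈ d ↔ s ∈ e) := fun s hsa hrs => by
      by_contra h
      exact absurd (hmax s (Finset.mem_filter.2 ⟨hsa, h⟩)) (not_le.2 hrs)
    have hr' := (Finset.mem_filter.1 hr).2
    rw [Finset.mem_union]
    by_cases hrd : r ∈ d
    · exact Or.inl (hmem d hd e he r hrd (fun h => hr' ⟨fun _ => h, fun _ => hrd⟩) hnear hagree)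
    · have hre : r ∈ e := by tauto
      exact Or.inr (Finset.mem_image.2 ⟨(e, d), hmem e he d hd r hre hrd ⟨hnear.2, hnear.1⟩
        fun s hs h => (hagree s hs h).symm, rfl⟩)
  calc _ ≤ (G ∪ G.image Prod.swap).card := Finset.card_le_card hsub
    _ ≤ G.card + (G.image Prod.swap).card := Finset.card_union_le _ _
    _ ≤ G.card + G.card := Nat.add_le_add le_rfl Finset.card_image_le
    _ ≤ _ := by omega

lemma exists_sum_blockPrimes_window_le {K : ℝ} (hK : 1 ≤ K) : ∃ D > 0, ∀ (j : ℕ) (Z : ℝ), 0 < Z →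
    ∑ r ∈ blockPrimes j with Z < K * (r : ℕ) ∧ (r : ℝ) < K * Z, 1 / (r : ℝ) ≤ D * (1 / 2) ^ j := by
  obtain ⟨C, hC, hwin⟩ := exists_log_window
  obtain ⟨c, _, hc, _, hblk⟩ := exists_log_blk_bounds
  have hK0 : 0 < K := by linarith
  have hlK := Real.log_nonneg hK
  refine ⟨(2 * Real.log K + C) / c, by positivity, fun j Z hZ => ?_⟩
  have hlb := log_blk_pos j
  have h1 := (hwin (Z / K) (K * Z) (by positivity)
    ((div_le_self hZ.le hK).trans (le_mul_of_one_le_left hZ.le hK))).1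
  rw [show K * Z / (Z / K) = K * K by field_simp, Real.log_mul hK0.ne' hK0.ne', ← two_mul] at h1
  calc _ ≤ ∑ r ∈ primesIoc (Z / K) (K * Z), Real.log r / ((r : ℝ) - 1) *
      (1 / Real.log (blk j)) := by
        refine le_trans (Finset.sum_le_sum fun r hr => ?_)
          (Finset.sum_le_sum_of_subset_of_nonneg (fun r hr => ?_) fun r hr _ => ?_)
        · have hr' := mem_primesIoc.1 (Finset.mem_filter.1 hr).1
          have h2 : (1 : ℝ) < r := by exact_mod_cast hr'.1.one_lt
          have h3 : Real.log (blk j) ≤ Real.log r :=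
            Real.log_le_log (by linarith [two_le_blk_cast j]) hr'.2.1.le
          rw [mul_one_div, div_div, div_le_div_iff₀ (by linarith) (mul_pos (by linarith) hlb)]
          nlinarith
        · obtain ⟨hr1, hr2, hr3⟩ := Finset.mem_filter.1 hr
          exact mem_primesIoc.2 ⟨prime_of_mem hr1, by rwa [div_lt_iff₀' hK0], hr3.le⟩
        · have h2 : (1 : ℝ) < r := by exact_mod_cast (prime_of_mem hr).one_lt
          exact mul_nonneg (div_nonneg (Real.log_nonneg h2.le) (by linarith)) (by positivity)
    _ ≤ (2 * Real.log K + C) * (1 / (c * 2 ^ j)) := by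
        rw [← Finset.sum_mul]
        have := (hblk j).1
        gcongr
    _ = _ := by rw [one_div_pow]; field_simp

/-- The pairs of subsets of `a` that agree outside of `U`. -/
noncomputable def agreeingPairs (U a : Finset ℕ) : Finset (Finset ℕ × Finset ℕ) :=
  (a.powerset ×ˢ a.powerset).filter fun y => ∀ s ∈ a, s ∉ U → (s ∈ y.1 ↔ s ∈ y.2)

lemma card_agreeingPairs_le (U a : Finset ℕ) :
    (agreeingPairs U a).card ≤ 2 ^ a.card * 2 ^ (a ∩ U).card := by
  rw [← Finset.card_powerset, ← Finset.card_powerset, ← Finset.card_product]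
  refine Finset.card_le_card_of_injOn (fun y => (y.1, y.2 ∩ U)) ?_ ?_
  · rintro ⟨d, e⟩ hy
    simp only [agreeingPairs, Finset.coe_filter, Set.mem_ofPred_eq, Finset.mem_product,
      Finset.mem_powerset] at hy
    simp only [Finset.coe_product, Set.mem_prod, Finset.mem_coe, Finset.mem_powerset]
    exact ⟨hy.1.1, Finset.inter_subset_inter_right hy.1.2⟩
  · rintro ⟨d, e⟩ hy ⟨d', e'⟩ hy' heq
    simp only [agreeingPairs, Finset.coe_filter, Set.mem_ofPred_eq, Finset.mem_product,
      Finset.mem_powerset] at hy hy'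
    simp only [Prod.mk.injEq] at heq ⊢
    obtain ⟨rfl, h⟩ := heq
    refine ⟨rfl, Finset.ext fun s => ?_⟩
    by_cases hsU : s ∈ U
    · have := Finset.ext_iff.1 h s
      simpa [hsU] using this
    · by_cases hsa : s ∈ a
      · rw [← hy.2 s hsa hsU, hy'.2 s hsa hsU]
      · exact ⟨fun h => absurd (hy.1.2 h) hsa, fun h => absurd (hy'.1.2 h) hsa⟩

lemma sum_precursorPairs_le {K D : ℝ} {C : ℕ} (hD : ∀ (j : ℕ) (Z : ℝ), 0 < Z →
      ∑ r ∈ blockPrimes j with Z < K * (r : ℕ) ∧ (r : ℝ) < K * Z, 1 / (r : ℝ) ≤ D * (1 / 2) ^ j)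
    (N i : ℕ) :
    ∑ r ∈ blockPrimes (C + i), 1 / (r : ℝ) *
      ∑ a ∈ ((blockUnion (fun i => blockPrimes (C + i)) N).erase r).powerset with
        IsWalkSet (fun i => blockPrimes (C + i)) (fun r k => k ≤ r) N N (insert r a),
        (∏ s ∈ a, 1 / (s : ℝ)) * ((precursorPairs K a r).card : ℝ) ≤
      D * (1 / 2) ^ (C + i) * 2 ^ (N - 1) *
        ∑ a ∈ (blockUnion (fun i => blockPrimes (C + i)) N).powerset with
          IsDefective (fun i => blockPrimes (C + i)) N i a, (∏ s ∈ a, 1 / (s : ℝ)) *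
            2 ^ (a ∩ blockUnion (fun i => blockPrimes (C + i)) (i + 1)).card := by
  set E : ℕ → Finset ℕ := fun i => blockPrimes (C + i) with hE
  set U := blockUnion E (i + 1) with hU
  set S := (blockUnion E N).powerset.filter (IsDefective E N i) with hS
  have hprime : ∀ r ∈ blockUnion E N, r.Prime := fun r hr => by
    obtain ⟨i, _, hi⟩ := mem_blockUnion.1 hr
    exact prime_of_mem_blockPrimes hi
  have hcard : ∀ r ∈ E i, ∀ a ⊆ blockUnion E N, r ∉ a → (precursorPairs K a r).card ≤
      ((agreeingPairs U a).filter fun y => Near K (insert r y.1) y.2).card := by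
    intro r hr a ha hra
    refine Finset.card_le_card fun y hy => ?_
    simp only [precursorPairs, agreeingPairs, Finset.mem_filter] at hy ⊢
    refine ⟨⟨hy.1, fun s hs hsU => hy.2.1 s hs ?_⟩, hy.2.2⟩
    obtain ⟨l, hl, hsl⟩ := mem_blockUnion.1 (ha hs)
    have hil : i < l := by
      by_contra h
      exact hsU (mem_blockUnion.2 ⟨l, by omega, hsl⟩)
    have h1 := (mem_primesIoc.1 hr).2.2
    have h2 := (mem_primesIoc.1 hsl).2.1
    have h3 := blk_mono_cast (show C + i + 1 ≤ C + l by omega)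
    exact_mod_cast (h1.trans h3).trans_lt h2
  calc _ ≤ ∑ r ∈ E i, 1 / (r : ℝ) * ∑ a ∈ S, if r ∈ a then 0 else (∏ s ∈ a, 1 / (s : ℝ)) *
        (((agreeingPairs U a).filter fun y => Near K (insert r y.1) y.2).card : ℝ) := by
        refine Finset.sum_le_sum fun r hr => mul_le_mul_of_nonneg_left ?_ (by positivity)
        refine le_trans (Finset.sum_le_sum fun a ha => ?_)
          (Finset.sum_le_sum_of_subset_of_nonneg (fun a ha => ?_) fun a _ _ => ?_)
        · obtain ⟨ha1, ha2⟩ := Finset.mem_filter.1 ha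
          have ha1 := Finset.mem_powerset.1 ha1
          have hra : r ∉ a := fun h => by simpa using ha1 h
          rw [if_neg hra]
          have := prod_inv_nonneg a
          have := hcard r hr a (ha1.trans (Finset.erase_subset _ _)) hra
          gcongr
        · obtain ⟨ha1, ha2⟩ := Finset.mem_filter.1 ha
          have ha1 := Finset.mem_powerset.1 ha1
          have hra : r ∉ a := fun h => by simpa using ha1 h
          exact Finset.mem_filter.2 ⟨Finset.mem_powerset.2 (ha1.trans (Finset.erase_subset _ _)),
            isDefective_of_insert hr hra ha2⟩
        · have := prod_inv_nonneg a
          split_ifs <;> positivity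
    _ = ∑ a ∈ S, (∏ s ∈ a, 1 / (s : ℝ)) * ∑ y ∈ agreeingPairs U a, ∑ r ∈ E i,
          if r ∉ a ∧ Near K (insert r y.1) y.2 then 1 / (r : ℝ) else 0 := by
        simp_rw [Finset.mul_sum]
        rw [Finset.sum_comm]
        refine Finset.sum_congr rfl fun a _ => ?_
        rw [Finset.sum_comm]
        refine Finset.sum_congr rfl fun r _ => ?_
        by_cases hra : r ∈ a
        · simp [hra]
        · simp only [hra, not_false_eq_true, true_and, if_false]
          rw [Finset.card_filter]
          push_cast
          rw [Finset.mul_sum, Finset.mul_sum]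
          refine Finset.sum_congr rfl fun y _ => ?_
          split_ifs
          · ring
          · simp
    _ ≤ ∑ a ∈ S, (∏ s ∈ a, 1 / (s : ℝ)) * (2 ^ (N - 1) * 2 ^ (a ∩ U).card *
          (D * (1 / 2) ^ (C + i))) := by
        have hD0 : 0 ≤ D * (1 / 2 : ℝ) ^ (C + i) := le_trans
          (Finset.sum_nonneg fun r _ => by positivity) (hD (C + i) 1 one_pos)
        refine Finset.sum_le_sum fun a ha => mul_le_mul_of_nonneg_left ?_ (prod_inv_nonneg a)
        obtain ⟨ha1, ha2⟩ := Finset.mem_filter.1 ha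
        have ha1 := Finset.mem_powerset.1 ha1
        have hN : N - 1 = a.card := by have := ha2.1; omega
        have h1 := card_agreeingPairs_le U a
        have h2 : ((agreeingPairs U a).card : ℝ) ≤ 2 ^ (N - 1) * 2 ^ (a ∩ U).card := by
          rw [hN]
          exact_mod_cast h1
        refine le_trans (Finset.sum_le_card_nsmul _ _ (D * (1 / 2) ^ (C + i)) fun y hy => ?_) ?_
        · simp only [agreeingPairs, Finset.mem_filter, Finset.mem_product,
            Finset.mem_powerset] at hy
          have hpos : ∀ d ⊆ a, 0 < ∏ r ∈ d, (r : ℝ) := fun d hd =>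
            Finset.prod_pos fun r hr => by exact_mod_cast (hprime r (ha1 (hd hr))).pos
          have h3 := hpos _ hy.1.1
          have h4 := hpos _ hy.1.2
          refine le_trans ?_ (hD (C + i) ((∏ r ∈ y.2, (r : ℝ)) / ∏ r ∈ y.1, (r : ℝ))
            (by positivity))
          rw [Finset.sum_filter]
          refine Finset.sum_le_sum fun r _ => ?_
          have h5 : (r ∉ a ∧ Near K (insert r y.1) y.2) →
              (∏ r ∈ y.2, (r : ℝ)) / ∏ r ∈ y.1, (r : ℝ) < K * (r : ℕ) ∧
              (r : ℝ) < K * ((∏ r ∈ y.2, (r : ℝ)) / ∏ r ∈ y.1, (r : ℝ)) := by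
            rintro ⟨hra, h6, h7⟩
            rw [Finset.prod_insert fun h => hra (hy.1.1 h)] at h6 h7
            rw [div_lt_iff₀ h3, ← mul_div_assoc, lt_div_iff₀ h3, mul_assoc]
            exact ⟨h6, h7⟩
          split_ifs with h6 h7
          · exact le_rfl
          · exact absurd (h5 h6) h7
          · positivity
          · exact le_rfl
        · rw [nsmul_eq_mul]
          gcongr
    _ = _ := by
        rw [Finset.mul_sum]
        exact Finset.sum_congr rfl fun a _ => by ring

lemma exists_sum_nearPairs_le {K : ℝ} (hK : 1 ≤ K) : ∃ D > 0, ∀ C N : ℕ,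
    ∑ a ∈ walkSets (fun i => blockPrimes (C + i)) (fun r k => k ≤ r) N N,
      (∏ r ∈ a, 1 / (r : ℝ)) * ((nearPairs K a).card : ℝ) ≤
    D * (1 / 2) ^ C * (2 ^ N * ((Real.exp 1 * Real.log 2) ^ N * kap N)) := by
  obtain ⟨D₁, hD₁, hwin⟩ := exists_sum_blockPrimes_window_le hK
  obtain ⟨D₂, hD₂, hconv⟩ := exists_sum_parking_mul_ballot_le
  have ht := log_two_bounds.1
  have he := exp_one_bounds
  refine ⟨2 * D₁ * D₂, by positivity, fun C N => ?_⟩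
  set E : ℕ → Finset ℕ := fun i => blockPrimes (C + i) with hE
  have hEd : ∀ i j, i < j → j < N → Disjoint (E i) (E j) :=
    fun i j h _ => disjoint_blockPrimes (by omega)
  calc _ ≤ ∑ a ∈ (blockUnion E N).powerset with IsWalkSet E (fun r k => k ≤ r) N N a,
        (∏ r ∈ a, 1 / (r : ℝ)) * ∑ r ∈ a, 2 * ((precursorPairs K (a.erase r) r).card : ℝ) := by
        refine Finset.sum_le_sum fun a _ => mul_le_mul_of_nonneg_left ?_ (prod_inv_nonneg a)
        rw [← Finset.mul_sum]
        exact_mod_cast card_nearPairs_le K a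
    _ = 2 * ∑ r ∈ blockUnion E N, 1 / (r : ℝ) * ∑ a ∈ ((blockUnion E N).erase r).powerset with
          IsWalkSet E (fun r k => k ≤ r) N N (insert r a),
          (∏ s ∈ a, 1 / (s : ℝ)) * ((precursorPairs K a r).card : ℝ) := by
        rw [sum_filter_mul_sum_mem, Finset.mul_sum]
        refine Finset.sum_congr rfl fun r _ => ?_
        rw [mul_left_comm, Finset.mul_sum _ _ 2]
        congr 1
        refine Finset.sum_congr rfl fun a ha => ?_
        have hra : r ∉ a := fun h => by
          simpa using Finset.mem_powerset.1 (Finset.mem_filter.1 ha).1 h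
        rw [Finset.erase_insert hra]
        ring
    _ ≤ 2 * ∑ i ∈ Finset.range N, D₁ * (1 / 2) ^ (C + i) * 2 ^ (N - 1) *
          ∑ k ∈ Finset.range (i + 1), 2 ^ k * (Real.log 2 ^ (N - 1) *
            (parking (i + 1) k * ballot (N - 1 - i) (N - 1 - k))) := by
        refine mul_le_mul_of_nonneg_left ?_ (by norm_num)
        rw [blockUnion, Finset.sum_biUnion]
        · refine Finset.sum_le_sum fun i hi => (sum_precursorPairs_le hwin N i).trans ?_
          have := sum_isDefective_le (E := E) (w := fun r : ℕ => 1 / (r : ℝ))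
            (fun r => by positivity) (by linarith) (Finset.mem_range.1 hi) hEd
            (fun i _ => sum_inv_blockPrimes_le (C + i))
          gcongr
        · intro i hi j hj hij
          rcases Nat.lt_or_gt_of_ne hij with h | h
          · exact hEd i j h (by simpa using hj)
          · exact (hEd j i h (by simpa using hi)).symm
    _ = 2 * D₁ * (1 / 2) ^ C * 2 ^ (N - 1) * Real.log 2 ^ (N - 1) *
          ∑ i ∈ Finset.range N, (1 / 2 : ℝ) ^ i * ∑ k ∈ Finset.range (i + 1),
            2 ^ k * (parking (i + 1) k * ballot (N - 1 - i) (N - 1 - k)) := by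
        rw [Finset.mul_sum, Finset.mul_sum]
        refine Finset.sum_congr rfl fun i _ => ?_
        rw [Finset.mul_sum, Finset.mul_sum, Finset.mul_sum, Finset.mul_sum]
        refine Finset.sum_congr rfl fun k _ => ?_
        rw [pow_add]
        ring
    _ ≤ 2 * D₁ * (1 / 2) ^ C * 2 ^ (N - 1) * Real.log 2 ^ (N - 1) *
          (D₂ * (Real.exp 1 ^ N * kap N)) := by
        gcongr
        exact hconv N
    _ ≤ 2 * D₁ * (1 / 2) ^ C * (2 ^ N * Real.log 2 ^ N) *
          (D₂ * (Real.exp 1 ^ N * kap N)) := by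
        have hk := kap_pos N
        have h1 : (2 : ℝ) ^ (N - 1) * Real.log 2 ^ (N - 1) ≤ 2 ^ N * Real.log 2 ^ N := by
          rw [← mul_pow, ← mul_pow]
          exact pow_le_pow_right₀ (by linarith) (by omega)
        rw [mul_assoc (2 * D₁ * (1 / 2) ^ C)]
        gcongr
    _ = _ := by rw [mul_pow]; ring

lemma exists_sum_isolatedSets_ge {K : ℝ} (hK : 1 ≤ K) : ∃ C : ℕ, ∃ D : ℝ, 0 < D ∧ K ≤ blk C ∧
    ∀ (N : ℕ) (Y : ℝ), 1 ≤ N → 0 < Y → D * 2 ^ N ≤ Real.log Y →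
      2 ^ N * ((Real.exp 1 * Real.log 2) ^ N * kap N) / 8 ≤
      ∑ a ∈ walkSets (fun i => blockPrimes (C + i)) (fun r k => k ≤ r) N N with
        ∏ r ∈ a, ((r : ℕ) : ℝ) ≤ Y, (∏ r ∈ a, 1 / (r : ℝ)) * ((isolatedSets K a).card : ℝ) := by
  obtain ⟨C₀, hmain⟩ := exists_le_sum_parkingSets
  obtain ⟨D₁, hD₁, hlog⟩ := exists_sum_inv_mul_log_prod_le
  obtain ⟨D₂, hD₂, hnear⟩ := exists_sum_nearPairs_le hK
  obtain ⟨C₁, hC₁⟩ := exists_pow_lt_of_lt_one (show 0 < 1 / (4 * D₂) by positivity)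
    (show (1 / 2 : ℝ) < 1 by norm_num)
  obtain ⟨C₂, hC₂⟩ := exists_nat_ge K
  set C := C₀ + C₁ + C₂ with hC
  have ht := log_two_bounds.1
  refine ⟨C, 8 * D₁ * 2 ^ C, by positivity, ?_, fun N Y hN hY0 hY => ?_⟩
  · have h1 : C₂ ≤ blk C := (show C₂ ≤ C by omega).trans blk_strictMono.le_apply
    exact hC₂.trans (by exact_mod_cast h1)
  set W := walkSets (fun i => blockPrimes (C + i)) (fun r k => k ≤ r) N N with hW
  set M := (Real.exp 1 * Real.log 2) ^ N * kap N with hM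
  have hM0 : 0 < M := mul_pos (by positivity) (kap_pos N)
  have hprime : ∀ a ∈ W, ∀ r ∈ a, r.Prime := fun a ha r hr => by
    obtain ⟨i, _, hi⟩ := mem_blockUnion.1 (Finset.mem_powerset.1 (Finset.mem_filter.1 ha).1 hr)
    exact prime_of_mem_blockPrimes hi
  have h1 : M / 2 ≤ ∑ a ∈ W, ∏ r ∈ a, 1 / (r : ℝ) := by
    refine le_trans ?_ (hmain C N (by omega))
    have := le_parking_self N
    rw [hM, mul_pow, mul_comm (Real.exp 1 ^ N), mul_assoc]
    gcongr
  have h2 : ∑ a ∈ W, (∏ r ∈ a, 1 / (r : ℝ)) * ((nearPairs K a).card : ℝ) ≤ 2 ^ N * M / 4 := by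
    refine (hnear C N).trans ?_
    have h3 : (1 / 2 : ℝ) ^ C ≤ 1 / (4 * D₂) :=
      (pow_le_pow_of_le_one (by norm_num) (by norm_num) (by omega)).trans hC₁.le
    calc D₂ * (1 / 2) ^ C * (2 ^ N * M) ≤ D₂ * (1 / (4 * D₂)) * (2 ^ N * M) := by gcongr
      _ = _ := by field_simp
  have hlY : 0 < Real.log Y := lt_of_lt_of_le (by positivity) hY
  have h3 : ∑ a ∈ W with ¬ ∏ r ∈ a, ((r : ℕ) : ℝ) ≤ Y, ∏ r ∈ a, 1 / (r : ℝ) ≤ M / 8 := by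
    calc _ ≤ ∑ a ∈ W, (∏ r ∈ a, 1 / (r : ℝ)) * Real.log (∏ r ∈ a, (r : ℝ)) *
          (1 / Real.log Y) := by
          refine le_trans (Finset.sum_le_sum fun a ha => ?_)
            (Finset.sum_le_sum_of_subset_of_nonneg (Finset.filter_subset _ _) fun a ha _ => ?_)
          · obtain ⟨ha1, ha2⟩ := Finset.mem_filter.1 ha
            rw [mul_assoc]
            refine le_mul_of_one_le_right (prod_inv_nonneg a) ?_
            rw [mul_one_div, one_le_div hlY]
            exact Real.log_le_log hY0 (not_le.1 ha2).le
          · have : 1 ≤ ∏ r ∈ a, (r : ℝ) :=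
              Finset.one_le_prod fun r hr => by exact_mod_cast (hprime a ha r hr).one_lt.le
            have := Real.log_nonneg this
            have := prod_inv_nonneg a
            positivity
      _ ≤ D₁ * 2 ^ (C + N) * M * (1 / (8 * D₁ * 2 ^ C * 2 ^ N)) := by
          rw [← Finset.sum_mul]
          have := hlog C N hN
          gcongr
      _ = _ := by rw [pow_add]; field_simp
  have h4 := Finset.sum_filter_add_sum_filter_not W (fun a => ∏ r ∈ a, ((r : ℕ) : ℝ) ≤ Y)
    fun a => ∏ r ∈ a, 1 / (r : ℝ)
  have h5 : ∑ a ∈ W with ∏ r ∈ a, ((r : ℕ) : ℝ) ≤ Y, (∏ r ∈ a, 1 / (r : ℝ)) * (2 ^ N -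
      ((nearPairs K a).card : ℝ)) ≤ ∑ a ∈ W with ∏ r ∈ a, ((r : ℕ) : ℝ) ≤ Y,
        (∏ r ∈ a, 1 / (r : ℝ)) * ((isolatedSets K a).card : ℝ) := by
    refine Finset.sum_le_sum fun a ha => mul_le_mul_of_nonneg_left ?_ (prod_inv_nonneg a)
    have h6 := two_pow_card_le K a
    rw [(Finset.mem_filter.1 (Finset.mem_filter.1 ha).1).2.1] at h6
    have : (2 : ℝ) ^ N ≤ (isolatedSets K a).card + (nearPairs K a).card := by exact_mod_cast h6
    linarith
  have h6 : ∑ a ∈ W with ∏ r ∈ a, ((r : ℕ) : ℝ) ≤ Y, (∏ r ∈ a, 1 / (r : ℝ)) *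
      ((nearPairs K a).card : ℝ) ≤ 2 ^ N * M / 4 := by
    refine le_trans (Finset.sum_le_sum_of_subset_of_nonneg (Finset.filter_subset _ _)
      fun a _ _ => ?_) h2
    exact mul_nonneg (prod_inv_nonneg a) (by positivity)
  simp_rw [mul_sub] at h5
  rw [Finset.sum_sub_distrib, ← Finset.sum_mul] at h5
  have h7 : 3 / 8 * M ≤ ∑ a ∈ W with ∏ r ∈ a, ((r : ℕ) : ℝ) ≤ Y, ∏ r ∈ a, 1 / (r : ℝ) := by linarith
  have h8 := mul_le_mul_of_nonneg_right h7 (show (0 : ℝ) ≤ 2 ^ N by positivity)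
  linarith

lemma mobiusSum_eq_one {n : ℕ} {R : ℝ} (hn : n ≠ 0) (hR : 1 ≤ R) (h : Rough R n) :
    mobiusSum n R = 1 := by
  have hset : n.divisors.filter (fun d : ℕ => (d : ℝ) ≤ R) = {1} := by
    ext d
    rw [Finset.mem_filter, Nat.mem_divisors, Finset.mem_singleton]
    constructor
    · rintro ⟨⟨hd, -⟩, hdR⟩
      by_contra h1
      have h2 := h _ (Nat.minFac_prime h1) ((Nat.minFac_dvd d).trans hd)
      have h3 : (d.minFac : ℝ) ≤ d := by
        exact_mod_cast Nat.minFac_le (Nat.pos_of_dvd_of_pos hd (Nat.pos_of_ne_zero hn))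
      linarith
    · rintro rfl
      exact ⟨⟨one_dvd n, hn⟩, by exact_mod_cast hR⟩
  rw [mobiusSum, hset, Finset.sum_singleton, ArithmeticFunction.moebius_apply_one]

lemma supportDensity_le_one {R : ℝ} (hR : 16 ≤ R) : supportDensity R ≤ 1 := by
  have h1 := one_le_log_log hR
  have h2 : 0 < Real.log R := Real.log_pos (by linarith)
  have h3 : 1 ≤ Real.log R := by
    by_contra h
    have := Real.log_nonpos h2.le (not_le.1 h).le
    linarith
  exact mul_le_one₀ (Real.rpow_le_one_of_one_le_of_nonpos h3
    (neg_nonpos.2 supportExponent_nonneg)) (by positivity)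
    (Real.rpow_le_one_of_one_le_of_nonpos h1 (by norm_num))

lemma exists_card_mobiusSum_ne_zero_ge_of_le (R₀ : ℝ) : ∃ c > 0, ∀ x R : ℝ, 16 ≤ R → R ≤ R₀ →
    R ^ (5 / 2 : ℝ) ≤ x →
    c * x ≤ (((Finset.Icc 1 ⌊x⌋₊).filter fun n => mobiusSum n R ≠ 0).card : ℝ) := by
  obtain ⟨c, hc, z₀, hz₀, hrough⟩ := exists_rough_card_ge
  set z := max z₀ R₀ with hz
  have hz2 : 2 ≤ z := hz₀.trans (le_max_left _ _)
  have hlz : 0 < Real.log z := Real.log_pos (by linarith)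
  refine ⟨min (c / Real.log z) (1 / z ^ (6 / 5 : ℝ)), by positivity, fun x R hR hRR₀ hx => ?_⟩
  have hx1 : 1 ≤ x := (Real.one_le_rpow (by linarith) (by norm_num)).trans hx
  rcases le_total (z ^ (6 / 5 : ℝ)) x with h | h
  · calc _ ≤ c / Real.log z * x := by
          gcongr
          exact min_le_left _ _
      _ = c * (x / Real.log z) := by ring
      _ ≤ _ := hrough z x (le_max_left _ _) h
      _ ≤ _ := by
        refine Nat.cast_le.2 (Finset.card_le_card fun n hn => ?_)
        obtain ⟨hn1, hn2⟩ := Finset.mem_filter.1 hn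
        refine Finset.mem_filter.2 ⟨hn1, ?_⟩
        rw [mobiusSum_eq_one (Nat.one_le_iff_ne_zero.1 (Finset.mem_Icc.1 hn1).1) (by linarith)
          fun p hp hpn => (hRR₀.trans (le_max_right _ _)).trans_lt (hn2 p hp hpn)]
        exact one_ne_zero
  · have h1 : 1 ∈ (Finset.Icc 1 ⌊x⌋₊).filter fun n => mobiusSum n R ≠ 0 := by
      refine Finset.mem_filter.2 ⟨Finset.mem_Icc.2 ⟨le_rfl, Nat.le_floor (by simpa using hx1)⟩, ?_⟩
      rw [mobiusSum_eq_one one_ne_zero (by linarith) fun p hp h =>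
        absurd (Nat.dvd_one.1 h) hp.ne_one]
      exact one_ne_zero
    have h2 : (1 : ℝ) ≤ (((Finset.Icc 1 ⌊x⌋₊).filter fun n => mobiusSum n R ≠ 0).card : ℝ) := by
      exact_mod_cast Finset.card_pos.2 ⟨1, h1⟩
    refine le_trans ?_ h2
    calc _ ≤ 1 / z ^ (6 / 5 : ℝ) * z ^ (6 / 5 : ℝ) := by
          gcongr
          exact min_le_right _ _
      _ = 1 := by field_simp

lemma exists_card_mobiusSum_ne_zero_ge_of_large : ∃ c R₀ : ℝ, 0 < c ∧ ∀ x R : ℝ, 16 ≤ R →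
    R₀ ≤ R → R ^ (5 / 2 : ℝ) ≤ x →
    c * (x * supportDensity R) ≤
      (((Finset.Icc 1 ⌊x⌋₊).filter fun n => mobiusSum n R ≠ 0).card : ℝ) := by
  obtain ⟨K, hK, hwin⟩ := exists_sum_log_window_ge
  obtain ⟨c₁, z₀, hc₁, hz₀, hcount⟩ := exists_card_ge_sum_isolatedSets hK hwin
  have hK1 : (1 : ℝ) ≤ K := by exact_mod_cast hK.one_lt.le
  obtain ⟨C, D, hD, hKC, hiso⟩ := exists_sum_isolatedSets_ge hK1
  obtain ⟨c₂, C₂, hc₂, hC₂, hblk⟩ := exists_log_blk_bounds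
  obtain ⟨c₃, _, hc₃, _, hdens⟩ := exists_supportDensity_bounds
  obtain ⟨L, hL⟩ := pow_unbounded_of_one_lt (8 * D / c₂) (by norm_num : (1 : ℝ) < 2)
  have ht := log_two_bounds.1
  have he := exp_one_bounds.1
  set q := Real.exp 1 * Real.log 2 with hq
  have hq0 : 0 < q := by positivity
  refine ⟨c₁ * c₃ / (32 * C₂ ^ 2 * (2 * q) ^ L), max (max z₀ (blk (L + 2))) (K ^ 8 : ℝ),
    by positivity, fun x R hR hR₀ hx => ?_⟩
  have hz₀R : z₀ ≤ R := (le_max_left _ _).trans ((le_max_left _ _).trans hR₀)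
  have hLR : (blk (L + 2) : ℝ) ≤ R := (le_max_right _ _).trans ((le_max_left _ _).trans hR₀)
  have hKR : (K : ℝ) ^ 8 ≤ R := (le_max_right _ _).trans hR₀
  have hR0 : 0 < R := by linarith
  have hlR : 0 < Real.log R := Real.log_pos (by linarith)
  obtain ⟨v, hv1, hv2⟩ := exists_blk_index (show 2 < R by linarith)
  have hLv : L + 1 ≤ v := by
    by_contra h
    have h1 : (blk (v + 1) : ℝ) < blk (L + 2) := by
      exact_mod_cast blk_strictMono (show v + 1 < L + 2 by omega)
    linarith
  obtain ⟨N, rfl⟩ := Nat.exists_eq_add_of_le' (show L ≤ v by omega)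
  set Y := R ^ (1 / 8 : ℝ) with hY
  have hY8 : Y ^ 8 = R := by
    rw [hY, ← Real.rpow_natCast, ← Real.rpow_mul hR0.le]
    norm_num
  have hY0 : 0 < Y := Real.rpow_pos_of_pos hR0 _
  have hKY : K ≤ Y := by
    rw [← hY8] at hKR
    exact le_of_pow_le_pow_left₀ (by norm_num) hY0.le hKR
  have hlY : D * 2 ^ N ≤ Real.log Y := by
    rw [hY, Real.log_rpow hR0]
    have h1 := (hblk (N + L)).1
    have h2 : Real.log (blk (N + L)) ≤ Real.log R :=
      Real.log_le_log (by linarith [two_le_blk_cast (N + L)]) hv1.le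
    rw [div_lt_iff₀ hc₂] at hL
    have h3 : 8 * D * 2 ^ N ≤ 2 ^ L * c₂ * 2 ^ N := by gcongr
    rw [pow_add] at h1
    linarith
  have hprime : ∀ a ∈ walkSets (fun i => blockPrimes (C + i)) (fun r k => k ≤ r) N N,
      ∀ r ∈ a, r.Prime ∧ K < r := fun a ha r hr => by
    obtain ⟨i, _, hi⟩ := mem_blockUnion.1 (Finset.mem_powerset.1 (Finset.mem_filter.1 ha).1 hr)
    refine ⟨prime_of_mem_blockPrimes hi, ?_⟩
    have h1 := (mem_primesIoc.1 hi).2.1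
    have h2 := blk_mono_cast (show C ≤ C + i by omega)
    exact_mod_cast (hKC.trans h2).trans_lt h1
  have hmain := hcount x R ((walkSets (fun i => blockPrimes (C + i))
    (fun r k => k ≤ r) N N).filter fun a => ∏ r ∈ a, (r : ℝ) ≤ Y) hz₀R hx fun a ha => by
      obtain ⟨ha1, ha2⟩ := Finset.mem_filter.1 ha
      refine ⟨fun r hr => (hprime a ha1 r hr).1, fun h => lt_irrefl _ (hprime a ha1 K h).2, ?_⟩
      have h1 : 0 ≤ ∏ r ∈ a, (r : ℝ) := Finset.prod_nonneg fun r _ => by positivity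
      calc (K * ∏ r ∈ a, (r : ℝ)) ^ 4 ≤ (Y * Y) ^ 4 := by gcongr
        _ = R := by rw [← hY8]; ring
  refine le_trans ?_ hmain
  have hiso' := hiso N Y (by omega) hY0 hlY
  have hdens' := (hdens R (N + L) hR hv1.le hv2).1
  have hx0 : 0 < x := lt_of_lt_of_le (by positivity) hx
  have hlR2 : Real.log R ≤ C₂ * 2 ^ (N + L + 1) :=
    (Real.log_le_log hR0 hv2).trans (hblk (N + L + 1)).2
  have hkap : kap (N + L) ≤ kap N := kap_anti (by omega)
  have hkap0 := kap_pos (N + L)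
  calc c₁ * c₃ / (32 * C₂ ^ 2 * (2 * q) ^ L) * (x * supportDensity R)
      = c₁ * x / (32 * C₂ ^ 2 * (2 * q) ^ L) * (c₃ * supportDensity R) := by ring
    _ ≤ c₁ * x / (32 * C₂ ^ 2 * (2 * q) ^ L) * ((q / 2) ^ (N + L) * kap (N + L)) := by gcongr
    _ = c₁ * (x / (C₂ * 2 ^ (N + L + 1)) ^ 2 * (2 ^ N * (q ^ N * kap (N + L)) / 8)) := by
      have h4 : (4 : ℝ) ^ N = 2 ^ N * 2 ^ N := by rw [← mul_pow]; norm_num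
      rw [div_pow, mul_pow 2 q]
      field_simp
      ring
    _ ≤ c₁ * (x / Real.log R ^ 2 * (2 ^ N * (q ^ N * kap N) / 8)) := by gcongr
    _ ≤ _ := by gcongr

theorem exists_card_mobiusSum_ne_zero_ge : ∃ c > 0, ∀ x R : ℝ, 16 ≤ R → R ^ (5 / 2 : ℝ) ≤ x →
    c * (x * supportDensity R) ≤
      (((Finset.Icc 1 ⌊x⌋₊).filter fun n => mobiusSum n R ≠ 0).card : ℝ) := by
  obtain ⟨c₁, R₀, hc₁, hlarge⟩ := exists_card_mobiusSum_ne_zero_ge_of_large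
  obtain ⟨c₂, hc₂, hsmall⟩ := exists_card_mobiusSum_ne_zero_ge_of_le R₀
  refine ⟨min c₁ c₂, by positivity, fun x R hR hx => ?_⟩
  have hx0 : 0 < x := lt_of_lt_of_le (by positivity) hx
  have hd := supportDensity_pos hR
  rcases le_total R₀ R with h | h
  · refine le_trans ?_ (hlarge x R hR h hx)
    gcongr
    exact min_le_left _ _
  · refine le_trans ?_ (hsmall x R hR h hx)
    have h1 := supportDensity_le_one hR
    calc _ ≤ c₂ * (x * 1) := by
          gcongr
          exact min_le_right _ _
      _ = _ := by rw [mul_one]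

/-- There exist absolute constants `c₁, c₂ > 0` such that for all `R ≥ 16` and
`x ≥ R^{5/2}`,
`c₁·x·(log R)^{−δ}·(log log R)^{−3/2} ≤ #{n ≤ x : Σ_{d | n, d ≤ R} μ(d) ≠ 0}
  ≤ c₂·x·(log R)^{−δ}·(log log R)^{−3/2}`,
where `δ = 1 − (1 + log log 2)/log 2`. -/
theorem support_M_f0 :
    ∃ c₁ c₂ : ℝ, 0 < c₁ ∧ 0 < c₂ ∧ ∀ x R : ℝ, 16 ≤ R → R ^ (5 / 2 : ℝ) ≤ x →
      c₁ * x * Real.log R ^ (-(1 - (1 + Real.log (Real.log 2)) / Real.log 2)) *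
          Real.log (Real.log R) ^ (-(3 / 2) : ℝ) ≤
        (((Finset.Icc 1 ⌊x⌋₊).filter
          (fun n : ℕ =>
            (∑ d ∈ n.divisors.filter (fun d : ℕ => (d : ℝ) ≤ R),
              ArithmeticFunction.moebius d) ≠ 0)).card : ℝ) ∧
      (((Finset.Icc 1 ⌊x⌋₊).filter
          (fun n : ℕ =>
            (∑ d ∈ n.divisors.filter (fun d : ℕ => (d : ℝ) ≤ R),
              ArithmeticFunction.moebius d) ≠ 0)).card : ℝ) ≤
        c₂ * x * Real.log R ^ (-(1 - (1 + Real.log (Real.log 2)) / Real.log 2)) *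
          Real.log (Real.log R) ^ (-(3 / 2) : ℝ) := by
  obtain ⟨c₁, hc₁, hlower⟩ := exists_card_mobiusSum_ne_zero_ge
  obtain ⟨c₂, hc₂, hupper⟩ := exists_card_mobiusSum_ne_zero_le
  refine ⟨c₁, c₂, hc₁, hc₂, fun x R hR hx => ⟨le_trans (le_of_eq ?_) (hlower x R hR hx),
    (hupper x R hR hx).trans (le_of_eq ?_)⟩⟩ <;>
  · rw [supportDensity, supportExponent]
    ring
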